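/- Let ℓ, m be positive integers and k = m/ℓ (a rational number). For any set A ⊆ ℕ with upper density d̄(A) > 1 − 1/(k+2), there exist an infinite set B ⊆ ℕ and a positive integer t such that {m·b₁ + ℓ·b₂ : b₁, b₂ ∈ B and b₁ ≤ b₂} + t ⊆ A. -/

import Mathlib

open Filter MeasureTheory Topology

open scoped Classical in
/-- Upper Banach density: `limsup` over window length `N` of the maximal count of
elements of `A` in a window of length `N`, divided by `N`. -/
noncomputable def upperBanachDensity (A : Set ℕ) : ℝ :=
  Filter.limsup
    (fun N : ℕ => ⨆ M : ℕ, (((Finset.Ico M (M + N)).filter (· ∈ A)).card : ℝ) / N)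
    Filter.atTop

open scoped Classical in
/-- Natural upper density of a set of naturals. -/
noncomputable def upperDensity (A : Set ℕ) : ℝ :=
  Filter.limsup (fun N : ℕ => (((Finset.Icc 1 N).filter (· ∈ A)).card : ℝ) / N)
    Filter.atTop

open scoped Classical in
/-- Natural lower density of a set of naturals. -/
noncomputable def lowerDensity (A : Set ℕ) : ℝ :=
  Filter.liminf (fun N : ℕ => (((Finset.Icc 1 N).filter (· ∈ A)).card : ℝ) / N)
    Filter.atTop

section Wiener
variable {H : Type*} [NormedAddCommGroup H] [InnerProductSpace ℂ H]

lemma sr_pow_norm (U : H →L[ℂ] H) (hU : ∀ x, ‖U x‖ = ‖x‖) (n : ℕ) (x : H) :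
    ‖(U ^ n) x‖ = ‖x‖ := by
  induction n with
  | zero => simp
  | succ n ih => rw [pow_succ']; exact (hU _).trans ih

lemma sr_pow_add (U : H →L[ℂ] H) (n k : ℕ) (x : H) :
    (U ^ (n + k)) x = (U ^ n) ((U ^ k) x) := by
  rw [pow_add]; rfl

lemma sr_inner (U : H →L[ℂ] H) (hU : ∀ x, ‖U x‖ = ‖x‖) (s : ℕ) (x y : H) :
    inner ℂ ((U ^ s) x) ((U ^ s) y) = inner ℂ x y :=
  LinearIsometry.inner_map_map
    (⟨((U ^ s : H →L[ℂ] H) : H →ₗ[ℂ] H), fun z => sr_pow_norm U hU s z⟩ : H →ₗᵢ[ℂ] H) x y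

/-- von Neumann: orthogonality to eigenvectors kills twisted averages. -/
lemma sr_twisted [CompleteSpace H] (U : H →L[ℂ] H) (hU : ∀ x, ‖U x‖ = ‖x‖) (F : H)
    (hF : ∀ (l : ℂ) (v : H), U v = l • v → inner ℂ v F = 0) (z : ℂ) (hz : ‖z‖ = 1) :
    Tendsto (fun M : ℕ => (M : ℂ)⁻¹ • ∑ b ∈ Finset.range M, z ^ b • (U ^ b) F) atTop (𝓝 0) := by
  have hn : ‖z • U‖ ≤ 1 := by
    refine ContinuousLinearMap.opNorm_le_bound _ zero_le_one fun x => ?_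
    simp [norm_smul, hz, hU]
  have h := (z • U).tendsto_birkhoffAverage_orthogonalProjection hn F
  set K := (z • U).eqLocus (1 : H →L[ℂ] H) with hK
  have hP : (K.orthogonalProjectionOnto F : H) = 0 := by
    set v := K.orthogonalProjectionOnto F with hv
    have hv1 : z • U (v : H) = v := by
      have : (z • U) (v : H) = (1 : H →L[ℂ] H) (v : H) := v.2
      simpa using this
    have hz0 : z ≠ 0 := by
      intro h0; simp [h0] at hz
    have h1 : U (v : H) = z⁻¹ • (v : H) := by
      conv_rhs => rw [← hv1]
      rw [smul_smul, inv_mul_cancel₀ hz0, one_smul]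
    have h2 := hF _ _ h1
    have h3 : inner ℂ (v : H) F = inner ℂ (v : H) (v : H) := by
      have := Submodule.sub_starProjection_mem_orthogonal (K := K) F
      have h4 := this v v.2
      rw [inner_sub_right] at h4
      have h5 := sub_eq_zero.mp h4
      exact h5
    rw [h3] at h2
    exact inner_self_eq_zero.mp h2
  rw [hP] at h
  refine h.congr fun M => ?_
  simp only [birkhoffAverage, birkhoffSum]
  congr 1
  refine Finset.sum_congr rfl fun b _ => ?_
  have : (⇑(z • U))^[b] F = ((z • U) ^ b) F := by
    rw [FunLike.coe_pow_eq_iterate]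
  simp only [id, this, smul_pow]
  rfl

lemma sr_block (U : H →L[ℂ] H) (hU : ∀ x, ‖U x‖ = ‖x‖) (F : H) (z : ℂ) (hz : ‖z‖ = 1)
    (k q r : ℕ) (c : ℝ)
    (hc : ‖∑ b ∈ Finset.range k, z ^ b • (U ^ b) F‖ ≤ c) :
    ‖∑ b ∈ Finset.range (q * k + r), z ^ b • (U ^ b) F‖ ≤ q * c + r * ‖F‖ := by
  induction q with
  | zero =>
    simp only [Nat.cast_zero, zero_mul, zero_add]
    refine (norm_sum_le _ _).trans ?_
    have : ∀ b ∈ Finset.range r, ‖z ^ b • (U ^ b) F‖ ≤ ‖F‖ := by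
      intro b _
      rw [norm_smul, norm_pow, hz, one_pow, one_mul, sr_pow_norm U hU]
    refine (Finset.sum_le_card_nsmul _ _ _ this).trans ?_
    rw [Finset.card_range, nsmul_eq_mul]
  | succ q ih =>
    have : (q + 1) * k + r = k + (q * k + r) := by ring
    rw [this, Finset.sum_range_add]
    have h2 : ∑ x ∈ Finset.range (q * k + r), z ^ (k + x) • (U ^ (k + x)) F
        = z ^ k • (U ^ k) (∑ x ∈ Finset.range (q * k + r), z ^ x • (U ^ x) F) := by
      rw [map_sum, Finset.smul_sum]
      refine Finset.sum_congr rfl fun x _ => ?_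
      rw [map_smul, smul_smul, ← pow_add, sr_pow_add]
    rw [h2]
    refine (norm_add_le _ _).trans ?_
    rw [norm_smul, norm_pow, hz, one_pow, one_mul, sr_pow_norm U hU]
    rw [Nat.cast_add_one]
    linarith

lemma sr_twisted_unif [CompleteSpace H] (U : H →L[ℂ] H) (hU : ∀ x, ‖U x‖ = ‖x‖) (F : H)
    (hF : ∀ (l : ℂ) (v : H), U v = l • v → inner ℂ v F = 0) (τ : ℝ) (hτ : 0 < τ) :
    ∀ᶠ M : ℕ in atTop, ∀ z : ℂ, ‖z‖ = 1 →
      ‖∑ b ∈ Finset.range M, z ^ b • (U ^ b) F‖ ≤ τ * M := by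
  have key : ∀ z ∈ Metric.sphere (0:ℂ) 1, ∃ k : ℕ, 0 < k ∧
      ‖∑ b ∈ Finset.range k, z ^ b • (U ^ b) F‖ < τ / 2 * k := by
    intro z hz
    have hz' : ‖z‖ = 1 := by simpa using hz
    have h := (sr_twisted U hU F hF z hz').norm
    rw [norm_zero] at h
    have h2 := (h.eventually (gt_mem_nhds (half_pos hτ))).and (eventually_gt_atTop 0)
    obtain ⟨k, hk, hk0⟩ := h2.exists
    refine ⟨k, hk0, ?_⟩
    have hk0' : (0:ℝ) < k := by exact_mod_cast hk0
    rw [norm_smul, norm_inv, Complex.norm_natCast, inv_mul_lt_iff₀ hk0'] at hk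
    linarith
  choose! k hk0 hk using key
  have hcpt := isCompact_sphere (0:ℂ) 1
  let V : ℂ → Set ℂ := fun z => {w | ‖∑ b ∈ Finset.range (k z), w ^ b • (U ^ b) F‖ < τ / 2 * k z}
  obtain ⟨t, ht, hcov⟩ := hcpt.elim_nhds_subcover V (fun z hz => by
    have hcont : Continuous (fun w : ℂ => ‖∑ b ∈ Finset.range (k z), w ^ b • (U ^ b) F‖) := by
      fun_prop
    exact hcont.continuousAt.eventually (gt_mem_nhds (hk z hz)))
  have hM : ∀ᶠ M : ℕ in atTop, ∀ z ∈ t, (k z : ℝ) * ‖F‖ ≤ τ / 2 * M := by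
    rw [Filter.eventually_all_finset]
    intro z _
    have : Tendsto (fun M : ℕ => τ / 2 * (M:ℝ)) atTop atTop :=
      tendsto_natCast_atTop_atTop.const_mul_atTop (by positivity)
    exact this.eventually_ge_atTop _
  filter_upwards [hM] with M hM z hz
  have hz' : z ∈ Metric.sphere (0:ℂ) 1 := by simpa using hz
  obtain ⟨w, hw, hzw⟩ := Set.mem_iUnion₂.mp (hcov hz')
  have hb := sr_block U hU F z hz (k w) (M / k w) (M % k w) _ (le_of_lt hzw)
  rw [mul_comm (M / k w), Nat.div_add_mod] at hb
  refine hb.trans ?_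
  have h1 : ((M / k w : ℕ) : ℝ) * k w ≤ M := by exact_mod_cast Nat.div_mul_le_self M (k w)
  have h2 : ((M % k w : ℕ) : ℝ) ≤ k w := by
    exact_mod_cast (Nat.mod_lt M (hk0 w (ht w hw))).le
  have h3 := hM w hw
  have h4 : ((M % k w : ℕ) : ℝ) * ‖F‖ ≤ k w * ‖F‖ := by gcongr
  nlinarith

end Wiener

section Wiener2
open ComplexConjugate

lemma sr_orth (R : ℕ) (hR : 0 < R) : ∃ ω : ℕ → ℂ, (∀ j, ‖ω j‖ = 1) ∧
    ∀ a b, a < R → b < R →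
      ∑ j ∈ Finset.range R, ω j ^ a * conj (ω j ^ b) = if a = b then (R : ℂ) else 0 := by
  have hp := Complex.isPrimitiveRoot_exp R hR.ne'
  set ζ := Complex.exp (2 * Real.pi * Complex.I / R) with hζ
  have hn : ‖ζ‖ = 1 := hp.norm'_eq_one hR.ne'
  have hcz : conj ζ = ζ⁻¹ := by rw [Complex.inv_def, Complex.normSq_eq_norm_sq, hn]; simp
  have hz0 : ζ ≠ 0 := by intro h; simp [h] at hn
  refine ⟨fun j => ζ ^ j, fun j => by simp [hn], fun a b ha hb => ?_⟩
  have h1 : ∀ j, (ζ ^ j) ^ a * conj ((ζ ^ j) ^ b) = (ζ ^ a * (ζ ^ b)⁻¹) ^ j := by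
    intro j
    simp only [map_pow, hcz, mul_pow, inv_pow, ← pow_mul]
    rw [mul_comm j a, mul_comm j b]
  simp only [h1]
  split_ifs with hab
  · subst hab
    rw [mul_inv_cancel₀ (pow_ne_zero _ hz0)]
    simp
  · set w := ζ ^ a * (ζ ^ b)⁻¹ with hw
    have hw1 : w - 1 ≠ 0 := by
      intro h
      apply hab
      apply hp.pow_inj ha hb
      have : w = 1 := sub_eq_zero.mp h
      rw [hw] at this
      exact (mul_inv_eq_one₀ (pow_ne_zero _ hz0)).mp this
    have hwR : w ^ R = 1 := by
      rw [hw, mul_pow, inv_pow, ← pow_mul, ← pow_mul, mul_comm a, mul_comm b, pow_mul, pow_mul,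
        hp.pow_eq_one]; simp
    have := geom_sum_mul w R
    rw [hwR, sub_self] at this
    exact (mul_eq_zero.mp this).resolve_right hw1

variable {H : Type*} [NormedAddCommGroup H] [InnerProductSpace ℂ H]

lemma sr_psi_sum (U : H →L[ℂ] H) (hU : ∀ x, ‖U x‖ = ‖x‖) (F : H) (τ : ℝ) (N M : ℕ)
    (hMN : 2 * M ≤ N) (hN : 0 < N)
    (hT : ∀ z : ℂ, ‖z‖ = 1 → ‖∑ b ∈ Finset.range N, z ^ b • (U ^ b) F‖ ≤ τ * N) :
    ∑ h ∈ Finset.range M, ‖(inner ℂ F ((U ^ h) F) : ℂ)‖ ^ 2 ≤ 4 * τ ^ 2 * N * ‖F‖ ^ 2 := by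
  obtain ⟨ω, hω, horth⟩ := sr_orth (2 * N) (by omega)
  set R := 2 * N with hR
  set ψ : ℕ → ℂ := fun h => inner ℂ F ((U ^ h) F) with hψ
  set S := ∑ h ∈ Finset.range M, ‖ψ h‖ ^ 2 with hS
  set v : ℕ → H := fun j => ∑ b ∈ Finset.range N, (ω j) ^ b • (U ^ b) F with hv
  set Q : ℕ → ℂ := fun j => ∑ h ∈ Finset.range M, ψ h * (ω j) ^ h with hQ
  set g : ℕ → ℕ → ℂ := fun b b' => inner ℂ ((U ^ b) F) ((U ^ b') F) with hg
  have hgb : ∀ b h, g b (b + h) = ψ h := by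
    intro b h
    simp only [hg, hψ]
    rw [sr_pow_add, sr_inner U hU]
  have hP : ∀ j, ((‖v j‖ ^ 2 : ℝ) : ℂ) = ∑ b ∈ Finset.range N, ∑ b' ∈ Finset.range N,
      g b b' * ((ω j) ^ b' * conj ((ω j) ^ b)) := by
    intro j
    have := inner_self_eq_norm_sq_to_K (𝕜 := ℂ) (v j)
    push_cast
    rw [show ((‖v j‖ : ℂ)) ^ 2 = inner ℂ (v j) (v j) from this.symm]
    simp only [hv]
    rw [sum_inner]
    refine Finset.sum_congr rfl fun b _ => ?_
    rw [inner_sum]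
    refine Finset.sum_congr rfl fun b' _ => ?_
    rw [inner_smul_left, inner_smul_right]
    ring
  have h1 : ∑ j ∈ Finset.range R, ‖v j‖ ^ 2 = R * (N * ‖F‖ ^ 2) := by
    have : ((∑ j ∈ Finset.range R, ‖v j‖ ^ 2 : ℝ) : ℂ) = ((R * (N * ‖F‖ ^ 2) : ℝ) : ℂ) := by
      rw [Complex.ofReal_sum]
      simp only [hP]
      rw [Finset.sum_comm]
      have e1 : ∀ b ∈ Finset.range N, ∑ j ∈ Finset.range R, ∑ b' ∈ Finset.range N,
          g b b' * ((ω j) ^ b' * conj ((ω j) ^ b)) = R * ‖F‖ ^ 2 := by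
        intro b hb
        rw [Finset.sum_comm]
        have hb1 := Finset.mem_range.mp hb
        have e2 : ∀ b' ∈ Finset.range N, ∑ j ∈ Finset.range R,
            g b b' * ((ω j) ^ b' * conj ((ω j) ^ b)) = if b' = b then g b b' * R else 0 := by
          intro b' hb'
          have hb2 := Finset.mem_range.mp hb'
          rw [← Finset.mul_sum, horth b' b (by omega) (by omega)]
          split_ifs <;> simp
        rw [Finset.sum_congr rfl e2, Finset.sum_ite_eq' , if_pos hb]
        have := hgb b 0
        rw [add_zero] at this
        rw [this]
        simp only [hψ, pow_zero]
        have := inner_self_eq_norm_sq_to_K (𝕜 := ℂ) F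
        rw [show (1 : H →L[ℂ] H) F = F from rfl, this, mul_comm]; rfl
      rw [Finset.sum_congr rfl e1]
      simp; ring
    exact_mod_cast this
  have h2 : ∑ j ∈ Finset.range R, ‖Q j‖ ^ 2 = R * S := by
    have : ((∑ j ∈ Finset.range R, ‖Q j‖ ^ 2 : ℝ) : ℂ) = ((R * S : ℝ) : ℂ) := by
      rw [Complex.ofReal_sum]
      have e0 : ∀ j ∈ Finset.range R, ((‖Q j‖ ^ 2 : ℝ) : ℂ) = ∑ h ∈ Finset.range M,
          ∑ h' ∈ Finset.range M, ψ h * conj (ψ h') * ((ω j) ^ h * conj ((ω j) ^ h')) := by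
        intro j _
        push_cast
        rw [← Complex.mul_conj', hQ]
        simp only [map_sum]
        rw [Finset.sum_mul_sum]
        refine Finset.sum_congr rfl fun b _ => Finset.sum_congr rfl fun b' _ => ?_
        rw [map_mul]; ring
      rw [Finset.sum_congr rfl e0, Finset.sum_comm]
      have e1 : ∀ b ∈ Finset.range M, ∑ j ∈ Finset.range R, ∑ b' ∈ Finset.range M,
          ψ b * conj (ψ b') * ((ω j) ^ b * conj ((ω j) ^ b')) = R * ((‖ψ b‖ ^ 2 : ℝ) : ℂ) := by
        intro b hb
        rw [Finset.sum_comm]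
        have hb1 := Finset.mem_range.mp hb
        have e2 : ∀ b' ∈ Finset.range M, ∑ j ∈ Finset.range R,
            ψ b * conj (ψ b') * ((ω j) ^ b * conj ((ω j) ^ b'))
              = if b = b' then ψ b * conj (ψ b') * R else 0 := by
          intro b' hb'
          have hb2 := Finset.mem_range.mp hb'
          rw [← Finset.mul_sum, horth b b' (by omega) (by omega)]
          split_ifs <;> simp
        rw [Finset.sum_congr rfl e2, Finset.sum_ite_eq, if_pos hb, Complex.mul_conj']
        push_cast
        ring
      rw [Finset.sum_congr rfl e1, ← Finset.mul_sum]
      simp [hS]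
    exact_mod_cast this
  have h3 : (R : ℝ) * (N / 2 * S) ≤ ∑ j ∈ Finset.range R, ‖v j‖ ^ 2 * ‖Q j‖ := by
    have e : ∑ j ∈ Finset.range R, ((‖v j‖ ^ 2 : ℝ) : ℂ) * conj (Q j)
        = ((R * ∑ h ∈ Finset.range M, ((N - h : ℕ) : ℝ) * ‖ψ h‖ ^ 2 : ℝ) : ℂ) := by
      have e0 : ∀ j ∈ Finset.range R, ((‖v j‖ ^ 2 : ℝ) : ℂ) * conj (Q j)
          = ∑ h ∈ Finset.range M, ∑ b ∈ Finset.range N, ∑ b' ∈ Finset.range N,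
            conj (ψ h) * g b b' * ((ω j) ^ b' * conj ((ω j) ^ (b + h))) := by
        intro j _
        rw [hP, hQ]
        simp only [map_sum]
        rw [Finset.mul_sum]
        refine Finset.sum_congr rfl fun h _ => ?_
        rw [Finset.sum_mul]
        refine Finset.sum_congr rfl fun b _ => ?_
        rw [Finset.sum_mul]
        refine Finset.sum_congr rfl fun b' _ => ?_
        rw [map_mul, pow_add, map_mul]; ring
      rw [Finset.sum_congr rfl e0, Finset.sum_comm]
      have e1 : ∀ h ∈ Finset.range M, ∑ j ∈ Finset.range R, ∑ b ∈ Finset.range N,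
          ∑ b' ∈ Finset.range N, conj (ψ h) * g b b' * ((ω j) ^ b' * conj ((ω j) ^ (b + h)))
          = R * ((((N - h : ℕ) : ℝ) * ‖ψ h‖ ^ 2 : ℝ) : ℂ) := by
        intro h hh
        have hh1 := Finset.mem_range.mp hh
        rw [Finset.sum_comm]
        have e2 : ∀ b ∈ Finset.range N, ∑ j ∈ Finset.range R, ∑ b' ∈ Finset.range N,
            conj (ψ h) * g b b' * ((ω j) ^ b' * conj ((ω j) ^ (b + h)))
            = if b ∈ Finset.range (N - h) then R * ((‖ψ h‖ ^ 2 : ℝ) : ℂ) else 0 := by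
          intro b hb
          have hb1 := Finset.mem_range.mp hb
          rw [Finset.sum_comm]
          have e3 : ∀ b' ∈ Finset.range N, ∑ j ∈ Finset.range R,
              conj (ψ h) * g b b' * ((ω j) ^ b' * conj ((ω j) ^ (b + h)))
              = if b' = b + h then R * ((‖ψ h‖ ^ 2 : ℝ) : ℂ) else 0 := by
            intro b' hb'
            have hb2 := Finset.mem_range.mp hb'
            rw [← Finset.mul_sum, horth b' (b + h) (by omega) (by omega)]
            split_ifs with hbb
            · rw [hbb, hgb, mul_comm (conj (ψ h)), Complex.mul_conj']
              push_cast; ring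
            · simp
          rw [Finset.sum_congr rfl e3, Finset.sum_ite_eq']
          simp only [Finset.mem_range]
          congr 1
          simp only [eq_iff_iff]; omega
        rw [Finset.sum_congr rfl e2, Finset.sum_ite_mem]
        have : Finset.range N ∩ Finset.range (N - h) = Finset.range (N - h) := by
          apply Finset.inter_eq_right.mpr
          intro x; simp only [Finset.mem_range]; omega
        rw [this, Finset.sum_const, Finset.card_range, nsmul_eq_mul]
        push_cast; ring
      rw [Finset.sum_congr rfl e1, ← Finset.mul_sum]
      push_cast; rfl
    have e4 : (R : ℝ) * (N / 2 * S) ≤ R * ∑ h ∈ Finset.range M, ((N - h : ℕ) : ℝ) * ‖ψ h‖ ^ 2 := by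
      gcongr
      rw [hS, Finset.mul_sum]
      refine Finset.sum_le_sum fun h hh => ?_
      have hh1 := Finset.mem_range.mp hh
      gcongr
      rw [div_le_iff₀ (by norm_num)]
      have : N ≤ (N - h) * 2 := by omega
      exact_mod_cast this
    refine e4.trans ?_
    have e5 : R * ∑ h ∈ Finset.range M, ((N - h : ℕ) : ℝ) * ‖ψ h‖ ^ 2
        = ‖∑ j ∈ Finset.range R, ((‖v j‖ ^ 2 : ℝ) : ℂ) * conj (Q j)‖ := by
      rw [e, Complex.norm_real, Real.norm_of_nonneg (by positivity)]
    rw [e5]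
    refine (norm_sum_le _ _).trans (Finset.sum_le_sum fun j _ => ?_)
    rw [norm_mul, Complex.norm_real, Real.norm_of_nonneg (by positivity), RCLike.norm_conj]
  have h4 : (∑ j ∈ Finset.range R, ‖v j‖ ^ 2 * ‖Q j‖) ^ 2
      ≤ (∑ j ∈ Finset.range R, (‖v j‖ ^ 2) ^ 2) * ∑ j ∈ Finset.range R, ‖Q j‖ ^ 2 :=
    Finset.sum_mul_sq_le_sq_mul_sq _ _ _
  have h5 : ∑ j ∈ Finset.range R, (‖v j‖ ^ 2) ^ 2 ≤ (τ * N) ^ 2 * (R * (N * ‖F‖ ^ 2)) := by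
    rw [← h1, Finset.mul_sum]
    refine Finset.sum_le_sum fun j _ => ?_
    rw [sq (‖v j‖ ^ 2)]
    gcongr
    exact hT _ (hω j)
  have hS0 : 0 ≤ S := Finset.sum_nonneg fun _ _ => by positivity
  rcases hS0.eq_or_lt with h0 | hpos
  · rw [← h0]; positivity
  have hN' : (0:ℝ) < N := by exact_mod_cast hN
  have hR' : (R:ℝ) = 2 * N := by rw [hR]; push_cast; ring
  rw [h2] at h4
  have h6 : ((R : ℝ) * (N / 2 * S)) ^ 2 ≤ (τ * N) ^ 2 * (R * (N * ‖F‖ ^ 2)) * (R * S) := by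
    calc _ ≤ (∑ j ∈ Finset.range R, ‖v j‖ ^ 2 * ‖Q j‖) ^ 2 := by gcongr
      _ ≤ _ := h4
      _ ≤ _ := by gcongr
  rw [hR'] at h6
  have h7 : S * (N ^ 4 * S) ≤ (4 * τ ^ 2 * N * ‖F‖ ^ 2) * (N ^ 4 * S) := by nlinarith [h6]
  exact le_of_mul_le_mul_right h7 (by positivity)

/-- Weak mixing: arbitrary bounded weights. -/
lemma sr_wiener [CompleteSpace H] (U : H →L[ℂ] H) (hU : ∀ x, ‖U x‖ = ‖x‖) (F : H)
    (hF : ∀ (l : ℂ) (v : H), U v = l • v → inner ℂ v F = 0) (m : ℕ) (hm : 0 < m)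
    (τ : ℝ) (hτ : 0 < τ) :
    ∀ᶠ M : ℕ in atTop, ∀ φ : ℕ → ℂ, (∀ b, ‖φ b‖ ≤ 1) →
      ‖∑ b ∈ Finset.range M, φ b • (U ^ (m * b)) F‖ ≤ τ * M := by
  set ψ : ℕ → ℂ := fun h => inner ℂ F ((U ^ h) F) with hψ
  have hm' : (0:ℝ) < m := by exact_mod_cast hm
  obtain ⟨κ, hκ, hκ2⟩ : ∃ κ : ℝ, 0 < κ ∧ 2 * (m * (8 * κ ^ 2 * ‖F‖ ^ 2)) ≤ τ ^ 4 / 2 := by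
    refine ⟨τ ^ 2 / (8 * m * (‖F‖ + 1)), by positivity, ?_⟩
    have h1 : τ ^ 2 / (8 * m * (‖F‖ + 1)) * ‖F‖ ≤ τ ^ 2 / (8 * m) := by
      rw [div_mul_eq_mul_div, div_le_div_iff₀ (by positivity) (by positivity)]
      have : 0 ≤ ‖F‖ := norm_nonneg _
      have : 0 < τ ^ 2 * m := by positivity
      nlinarith
    have h2 : (τ ^ 2 / (8 * m * (‖F‖ + 1)) * ‖F‖) ^ 2 ≤ (τ ^ 2 / (8 * m)) ^ 2 := by gcongr
    have h3 : m * (τ ^ 2 / (8 * m)) ^ 2 ≤ τ ^ 4 / 64 := by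
      rw [div_pow, mul_div_assoc', div_le_div_iff₀ (by positivity) (by positivity)]
      have : (1:ℝ) ≤ m := by exact_mod_cast hm
      have : 0 ≤ τ ^ 4 * m * (m - 1) := mul_nonneg (by positivity) (by linarith)
      nlinarith
    have h4 := mul_le_mul_of_nonneg_left h2 hm'.le
    have h5 : (0:ℝ) ≤ τ ^ 4 := by positivity
    calc _ = 16 * (m * (τ ^ 2 / (8 * m * (‖F‖ + 1)) * ‖F‖) ^ 2) := by ring
      _ ≤ τ ^ 4 / 2 := by linarith
  have hunif := sr_twisted_unif U hU F hF κ hκ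
  have ht : Tendsto (fun M : ℕ => 2 * (m * M)) atTop atTop :=
    tendsto_atTop_mono (fun M => by nlinarith : ∀ M : ℕ, M ≤ 2 * (m * M)) tendsto_id
  filter_upwards [ht.eventually hunif, eventually_gt_atTop 0] with M hM hM0 φ hφ
  have hM0' : (0:ℝ) < M := by exact_mod_cast hM0
  have hs := sr_psi_sum U hU F κ (2 * (m * M)) (m * M) le_rfl (by positivity) hM
  have hs2 : ∑ h ∈ Finset.range M, ‖ψ (m * h)‖ ^ 2 ≤ 8 * κ ^ 2 * (m * M) * ‖F‖ ^ 2 := by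
    have : ∑ h ∈ Finset.range M, ‖ψ (m * h)‖ ^ 2
        ≤ ∑ h ∈ Finset.range (m * M), ‖ψ h‖ ^ 2 := by
      rw [← Finset.sum_image (f := fun h => ‖ψ h‖ ^ 2) (g := fun h => m * h)
        (fun a _ b _ hab => Nat.eq_of_mul_eq_mul_left hm hab)]
      refine Finset.sum_le_sum_of_subset_of_nonneg ?_ fun _ _ _ => by positivity
      intro x hx
      obtain ⟨y, hy, rfl⟩ := Finset.mem_image.mp hx
      rw [Finset.mem_range] at hy ⊢
      exact Nat.mul_lt_mul_of_pos_left hy hm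
    refine this.trans (hs.trans (le_of_eq ?_))
    push_cast; ring
  set W := ∑ h ∈ Finset.range M, ‖ψ (m * h)‖ with hW
  have hW0 : 0 ≤ W := Finset.sum_nonneg fun _ _ => norm_nonneg _
  have hW2 : W ^ 2 ≤ M * (8 * κ ^ 2 * (m * M) * ‖F‖ ^ 2) := by
    have := sq_sum_le_card_mul_sum_sq (s := Finset.range M) (f := fun h => ‖ψ (m * h)‖)
    rw [Finset.card_range] at this
    exact this.trans (by gcongr)
  have hW3 : 2 * W ≤ τ ^ 2 * M := by
    have : (2 * W) ^ 2 ≤ (τ ^ 2 * M) ^ 2 := by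
      have e : (2 * W) ^ 2 ≤ 2 * (2 * (m * (8 * κ ^ 2 * ‖F‖ ^ 2))) * M ^ 2 := by nlinarith
      refine e.trans ?_
      have : 2 * (2 * (m * (8 * κ ^ 2 * ‖F‖ ^ 2))) ≤ τ ^ 4 := by linarith
      calc _ ≤ τ ^ 4 * (M:ℝ) ^ 2 := by gcongr
        _ = _ := by ring
    exact (sq_le_sq₀ (by positivity) (by positivity)).mp this
  have hgb : ∀ b h, ‖(inner ℂ ((U ^ (m * b)) F) ((U ^ (m * (b + h))) F) : ℂ)‖ = ‖ψ (m * h)‖ := by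
    intro b h
    rw [mul_add, sr_pow_add, sr_inner U hU]
  have hgs : ∀ b b', ‖(inner ℂ ((U ^ (m * b)) F) ((U ^ (m * b')) F) : ℂ)‖
      = ‖ψ (m * (b' - b))‖ ∨ ‖(inner ℂ ((U ^ (m * b)) F) ((U ^ (m * b')) F) : ℂ)‖
      = ‖ψ (m * (b - b'))‖ := by
    intro b b'
    rcases le_total b b' with h | h
    · left
      have := hgb b (b' - b)
      rwa [Nat.add_sub_cancel' h] at this
    · right
      have := hgb b' (b - b')
      rw [Nat.add_sub_cancel' h] at this
      rw [norm_inner_symm]; exact this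
  have hrow : ∀ b ∈ Finset.range M, ∑ b' ∈ Finset.range M,
      ‖(inner ℂ ((U ^ (m * b)) F) ((U ^ (m * b')) F) : ℂ)‖ ≤ 2 * W := by
    intro b hb
    have hb1 := Finset.mem_range.mp hb
    have hsplit : Finset.range M = Finset.range (b + 1) ∪ Finset.Ico b M := by
      ext x; simp only [Finset.mem_range, Finset.mem_union, Finset.mem_Ico]; omega
    have e1 : ∑ b' ∈ Finset.range (b + 1),
        ‖(inner ℂ ((U ^ (m * b)) F) ((U ^ (m * b')) F) : ℂ)‖ ≤ W := by
      have : ∀ b' ∈ Finset.range (b + 1), ‖(inner ℂ ((U ^ (m * b)) F) ((U ^ (m * b')) F) : ℂ)‖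
          = ‖ψ (m * (b + 1 - 1 - b'))‖ := by
        intro b' hb'
        have hb2 := Finset.mem_range.mp hb'
        have := hgb b' (b - b')
        rw [Nat.add_sub_cancel' (by omega)] at this
        rw [norm_inner_symm]; exact this
      rw [Finset.sum_congr rfl this, Finset.sum_range_reflect (fun h => ‖ψ (m * h)‖)]
      refine Finset.sum_le_sum_of_subset_of_nonneg ?_ fun _ _ _ => norm_nonneg _
      intro x; simp only [Finset.mem_range]; omega
    have e2 : ∑ b' ∈ Finset.Ico b M,
        ‖(inner ℂ ((U ^ (m * b)) F) ((U ^ (m * b')) F) : ℂ)‖ ≤ W := by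
      rw [Finset.sum_Ico_eq_sum_range]
      simp only [hgb]
      refine Finset.sum_le_sum_of_subset_of_nonneg ?_ fun _ _ _ => norm_nonneg _
      intro x; simp only [Finset.mem_range]; omega
    have e3 : ∑ b' ∈ Finset.range M, ‖(inner ℂ ((U ^ (m * b)) F) ((U ^ (m * b')) F) : ℂ)‖
        ≤ ∑ b' ∈ Finset.range (b + 1), ‖(inner ℂ ((U ^ (m * b)) F) ((U ^ (m * b')) F) : ℂ)‖
        + ∑ b' ∈ Finset.Ico b M, ‖(inner ℂ ((U ^ (m * b)) F) ((U ^ (m * b')) F) : ℂ)‖ := by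
      rw [hsplit, ← Finset.sum_union_inter]
      exact le_add_of_nonneg_right (Finset.sum_nonneg fun _ _ => norm_nonneg _)
    linarith
  have hfin : ‖∑ b ∈ Finset.range M, φ b • (U ^ (m * b)) F‖ ^ 2 ≤ (τ * M) ^ 2 := by
    have e : ‖∑ b ∈ Finset.range M, φ b • (U ^ (m * b)) F‖ ^ 2
        ≤ ∑ b ∈ Finset.range M, ∑ b' ∈ Finset.range M,
          ‖(inner ℂ ((U ^ (m * b)) F) ((U ^ (m * b')) F) : ℂ)‖ := by
      have e1 : ‖∑ b ∈ Finset.range M, φ b • (U ^ (m * b)) F‖ ^ 2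
        = ‖(inner ℂ (∑ b ∈ Finset.range M, φ b • (U ^ (m * b)) F)
          (∑ b ∈ Finset.range M, φ b • (U ^ (m * b)) F) : ℂ)‖ := by
        rw [inner_self_eq_norm_sq_to_K]; simp
      rw [e1, sum_inner]
      refine (norm_sum_le _ _).trans (Finset.sum_le_sum fun b _ => ?_)
      rw [inner_sum]
      refine (norm_sum_le _ _).trans (Finset.sum_le_sum fun b' _ => ?_)
      rw [inner_smul_left, inner_smul_right, norm_mul, norm_mul, RCLike.norm_conj, ← mul_assoc]
      have := mul_le_mul (hφ b) (hφ b') (norm_nonneg _) zero_le_one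
      rw [mul_one] at this
      exact mul_le_of_le_one_left (norm_nonneg _) this
    refine e.trans ((Finset.sum_le_card_nsmul _ _ _ hrow).trans ?_)
    rw [Finset.card_range, nsmul_eq_mul]
    nlinarith
  exact (sq_le_sq₀ (by positivity) (by positivity)).mp hfin

end Wiener2

section Decomp
variable {H : Type*} [NormedAddCommGroup H] [InnerProductSpace ℂ H]

lemma sr_decomp [CompleteSpace H] (U : H →L[ℂ] H) (hU : ∀ x, ‖U x‖ = ‖x‖) (F : H)
    (τ : ℝ) (hτ : 0 < τ) :
    ∃ (n : ℕ) (v : Fin n → H) (l : Fin n → ℂ) (T Fu : H), (∀ j, U (v j) = l j • v j) ∧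
      (∀ j, ‖l j‖ = 1) ∧ ‖T‖ ≤ τ ∧ F = (∑ j, v j) + T + Fu ∧
      ∀ (l : ℂ) (v : H), U v = l • v → inner ℂ v Fu = 0 := by
  set s : Set H := {v | ∃ l : ℂ, U v = l • v} with hs
  set E := Submodule.span ℂ s with hE
  set K := E.topologicalClosure with hK
  have : CompleteSpace K := E.isClosed_topologicalClosure.completeSpace_coe
  set p : H := K.starProjection F with hp
  have hpK : p ∈ K := Submodule.starProjection_apply_mem K F
  have hpc : p ∈ closure (E : Set H) := by
    have := hpK
    rw [hK, ← SetLike.mem_coe, Submodule.topologicalClosure_coe] at this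
    exact this
  obtain ⟨e, heE, he⟩ := Metric.mem_closure_iff.mp hpc τ hτ
  obtain ⟨n, c, g, hsum⟩ := Submodule.mem_span_set'.mp (show e ∈ Submodule.span ℂ s from heE)
  have hl : ∀ j, ∃ l : ℂ, ‖l‖ = 1 ∧ U (c j • (g j : H)) = l • (c j • (g j : H)) := by
    intro j
    obtain ⟨l, hl⟩ := (g j).2
    by_cases h0 : (g j : H) = 0
    · exact ⟨1, by simp, by simp [h0]⟩
    · refine ⟨l, ?_, ?_⟩
      · have h1 := hU (g j : H)
        rw [hl, norm_smul] at h1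
        have : ‖(g j : H)‖ ≠ 0 := by simpa using h0
        field_simp at h1
        exact h1
      · rw [map_smul, hl, smul_comm]
  choose l hl1 hl2 using hl
  refine ⟨n, fun j => c j • (g j : H), l, p - e, F - p, hl2, hl1, ?_, ?_, ?_⟩
  · rw [← dist_eq_norm]; exact he.le
  · rw [hsum]; abel
  · intro l v hv
    have hvK : v ∈ K := E.le_topologicalClosure (Submodule.subset_span ⟨l, hv⟩)
    exact Submodule.sub_starProjection_mem_orthogonal (K := K) F v hvK

lemma sr_eig_pow (U : H →L[ℂ] H) (v : H) (l : ℂ) (h : U v = l • v) (b : ℕ) :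
    (U ^ b) v = l ^ b • v := by
  induction b with
  | zero => simp
  | succ b ih => rw [pow_succ']; change U ((U ^ b) v) = _; rw [ih, map_smul, h, smul_smul, pow_succ]

end Decomp

section AbsDecomp
variable {E : Type*} [SeminormedAddCommGroup E] [InnerProductSpace ℂ E]

lemma sr_iter_norm (S : E →ₗ[ℂ] E) (hS : ∀ x, ‖S x‖ = ‖x‖) (n : ℕ) (x : E) :
    ‖(S ^ n) x‖ = ‖x‖ := by
  induction n with
  | zero => simp
  | succ n ih => rw [pow_succ']; exact (hS _).trans ih

lemma sr_abs (S : E →ₗ[ℂ] E) (hS : ∀ x, ‖S x‖ = ‖x‖) (F : E) (m : ℕ) (hm : 0 < m)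
    (τ : ℝ) (hτ : 0 < τ) :
    ∃ (n : ℕ) (l : Fin n → ℂ) (C : ℝ), (∀ j, ‖l j‖ = 1) ∧ 0 ≤ C ∧ ∀ τ' : ℝ, 0 < τ' →
      ∃ (G : Fin n → E) (g Fu : E), F = (∑ j, G j) + g + Fu ∧ (∀ j, ‖G j‖ ≤ C) ∧
        (∀ j b, ‖(S ^ b) (G j) - l j ^ b • G j‖ ≤ τ') ∧ ‖g‖ ≤ τ ∧
        ∀ᶠ M : ℕ in atTop, ∀ φ : ℕ → ℂ, (∀ b, ‖φ b‖ ≤ 1) →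
          ‖∑ b ∈ Finset.range M, φ b • (S ^ (m * b)) Fu‖ ≤ τ' * M := by
  let H := UniformSpace.Completion E
  let ι : E →L[ℂ] H := UniformSpace.Completion.toComplL
  have hι : ∀ x, ‖ι x‖ = ‖x‖ := fun x => UniformSpace.Completion.norm_coe x
  have hd : DenseRange ι := UniformSpace.Completion.denseRange_coe
  let S1 : E →L[ℂ] H := ι.comp (S.mkContinuous 1 (fun x => by rw [hS, one_mul]))
  let U : H →L[ℂ] H := S1.extend ι
  have hui : IsUniformInducing ι := UniformSpace.Completion.isUniformInducing_coe E
  have hUι : ∀ x, U (ι x) = ι (S x) := fun x => ContinuousLinearMap.extend_eq S1 hd hui x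
  have hU : ∀ x, ‖U x‖ = ‖x‖ := by
    intro x
    refine hd.induction_on (p := fun x => ‖U x‖ = ‖x‖) x
      (isClosed_eq (by fun_prop) (by fun_prop)) (fun a => ?_)
    rw [hUι, hι, hι, hS]
  have hUp : ∀ b x, (U ^ b) (ι x) = ι ((S ^ b) x) := by
    intro b x
    induction b with
    | zero => simp
    | succ b ih =>
      rw [pow_succ', pow_succ']
      change U ((U ^ b) (ι x)) = ι (S ((S ^ b) x))
      rw [ih, hUι]
  obtain ⟨n, v, l, T, Fu, hv, hl, hT, hF, hperp⟩ := sr_decomp U hU (ι F) (τ / 2) (half_pos hτ)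
  refine ⟨n, l, (∑ j, ‖v j‖) + 1, hl, by positivity, fun τ' hτ' => ?_⟩
  set κ := min (min (τ / 2) (τ' / (2 * (n + 1)))) (min 1 (τ' / 2)) with hκ
  have hκ0 : 0 < κ := by positivity
  have hκ1 : κ ≤ τ / 2 := (min_le_left _ _).trans (min_le_left _ _)
  have hκ2 : κ ≤ τ' / (2 * (n + 1)) := (min_le_left _ _).trans (min_le_right _ _)
  have hκ3 : κ ≤ 1 := (min_le_right _ _).trans (min_le_left _ _)
  have hκ4 : κ ≤ τ' / 2 := (min_le_right _ _).trans (min_le_right _ _)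
  have happ : ∀ x : H, ∃ y : E, ‖x - ι y‖ ≤ κ := by
    intro x
    obtain ⟨y, hy⟩ := hd.exists_dist_lt x hκ0
    exact ⟨y, by rw [← dist_eq_norm]; exact hy.le⟩
  choose G hG using fun j => happ (v j)
  obtain ⟨g, hg⟩ := happ T
  refine ⟨G, g, F - ((∑ j, G j) + g), by abel, fun j => ?_, fun j b => ?_, ?_, ?_⟩
  · rw [← hι]
    have h1 : ‖ι (G j)‖ ≤ ‖v j‖ + ‖v j - ι (G j)‖ := by
      have := norm_sub_le (v j) (v j - ι (G j))
      rwa [sub_sub_cancel] at this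
    have h2 : ‖v j‖ ≤ ∑ j, ‖v j‖ :=
      Finset.single_le_sum (f := fun j => ‖v j‖) (fun _ _ => norm_nonneg _) (Finset.mem_univ j)
    have := hG j
    linarith
  · rw [← hι, map_sub, map_smul, ← hUp]
    have e : (U ^ b) (ι (G j)) - l j ^ b • ι (G j)
        = l j ^ b • (v j - ι (G j)) - (U ^ b) (v j - ι (G j)) := by
      rw [map_sub, sr_eig_pow U _ _ (hv j), smul_sub]; abel
    rw [e]
    refine (norm_sub_le _ _).trans ?_
    rw [norm_smul, norm_pow, hl, one_pow, one_mul, sr_pow_norm U hU]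
    have := hG j
    linarith
  · rw [← hι]
    have h1 : ‖ι g‖ ≤ ‖T‖ + ‖T - ι g‖ := by
      have := norm_sub_le T (T - ι g)
      rwa [sub_sub_cancel] at this
    linarith
  · have hdiff : ‖ι (F - ((∑ j, G j) + g)) - Fu‖ ≤ τ' / 2 := by
      have e : ι (F - ((∑ j, G j) + g)) - Fu = (∑ j, (v j - ι (G j))) + (T - ι g) := by
        rw [map_sub, map_add, map_sum, hF, Finset.sum_sub_distrib]; abel
      rw [e]
      have h1 : ‖∑ j, (v j - ι (G j))‖ ≤ n * κ := by
        refine (norm_sum_le _ _).trans ?_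
        refine (Finset.sum_le_card_nsmul _ _ κ fun j _ => hG j).trans ?_
        simp
      have h2 : (n + 1) * κ ≤ τ' / 2 := by
        have := mul_le_mul_of_nonneg_left hκ2 (by positivity : (0:ℝ) ≤ n + 1)
        refine this.trans (le_of_eq ?_)
        field_simp
      refine (norm_add_le _ _).trans ?_
      linarith
    filter_upwards [sr_wiener U hU Fu hperp m hm (τ' / 2) (half_pos hτ')] with M hM φ hφ
    rw [← hι, map_sum]
    have e : ∑ b ∈ Finset.range M, ι (φ b • (S ^ (m * b)) (F - ((∑ j, G j) + g)))
        = ∑ b ∈ Finset.range M, φ b • (U ^ (m * b)) Fu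
          + ∑ b ∈ Finset.range M, φ b • (U ^ (m * b)) (ι (F - ((∑ j, G j) + g)) - Fu) := by
      rw [← Finset.sum_add_distrib]
      refine Finset.sum_congr rfl fun b _ => ?_
      rw [map_smul, ← hUp, ← smul_add, ← map_add, add_sub_cancel]
    rw [e]
    refine (norm_add_le _ _).trans ?_
    have h2 : ‖∑ b ∈ Finset.range M, φ b • (U ^ (m * b)) (ι (F - ((∑ j, G j) + g)) - Fu)‖
        ≤ M * (τ' / 2) := by
      refine (norm_sum_le _ _).trans ?_
      refine (Finset.sum_le_card_nsmul _ _ (τ' / 2) fun b _ => ?_).trans (by simp)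
      rw [norm_smul, sr_pow_norm U hU]
      exact (mul_le_of_le_one_left (norm_nonneg _) (hφ b)).trans hdiff
    have := hM φ hφ
    linarith

end AbsDecomp

set_option linter.unusedSectionVars false
section Mean
variable {E : Type*} [NormedAddCommGroup E] [NormedSpace ℝ E]

/-- bounded sequences -/
def SrB (u : ℕ → E) : Prop := ∃ C : ℝ, ∀ n, ‖u n‖ ≤ C

/-- Cesàro averages -/
noncomputable def srAvg (u : ℕ → E) (M : ℕ) : E := (M : ℝ)⁻¹ • ∑ c ∈ Finset.range M, u c

/-- mean along an ultrafilter -/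
noncomputable def srMean (𝒰 : Ultrafilter ℕ) (u : ℕ → E) : E := limUnder (𝒰 : Filter ℕ) (srAvg u)

lemma SrB.add {u v : ℕ → E} (hu : SrB u) (hv : SrB v) : SrB (fun n => u n + v n) := by
  obtain ⟨C, hC⟩ := hu; obtain ⟨D, hD⟩ := hv
  exact ⟨C + D, fun n => (norm_add_le _ _).trans (add_le_add (hC n) (hD n))⟩

lemma SrB.sub {u v : ℕ → E} (hu : SrB u) (hv : SrB v) : SrB (fun n => u n - v n) := by
  obtain ⟨C, hC⟩ := hu; obtain ⟨D, hD⟩ := hv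
  exact ⟨C + D, fun n => (norm_sub_le _ _).trans (add_le_add (hC n) (hD n))⟩

lemma SrB.comp {u : ℕ → E} (hu : SrB u) (p : ℕ → ℕ) : SrB (fun n => u (p n)) := by
  obtain ⟨C, hC⟩ := hu; exact ⟨C, fun n => hC _⟩

lemma SrB.norm {u : ℕ → E} (hu : SrB u) : SrB (fun n => ‖u n‖) := by
  obtain ⟨C, hC⟩ := hu; exact ⟨C, fun n => by simpa using hC n⟩

lemma SrB.const (x : E) : SrB (fun _ : ℕ => x) := ⟨‖x‖, fun _ => le_rfl⟩

lemma SrB.sum {ι : Type*} (s : Finset ι) {u : ι → ℕ → E} (hu : ∀ i ∈ s, SrB (u i)) :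
    SrB (fun n => ∑ i ∈ s, u i n) := by
  classical
  induction s using Finset.induction_on with
  | empty => simpa using SrB.const (0 : E)
  | insert a s ha ih =>
    simp only [Finset.sum_insert ha]
    exact (hu a (Finset.mem_insert_self _ _)).add
      (ih fun i hi => hu i (Finset.mem_insert_of_mem hi))

lemma SrB.mul {R : Type*} [NormedRing R] [NormedSpace ℝ R] {u v : ℕ → R} (hu : SrB u)
    (hv : SrB v) : SrB (fun n => u n * v n) := by
  obtain ⟨C, hC⟩ := hu; obtain ⟨D, hD⟩ := hv
  refine ⟨C * D, fun n => (norm_mul_le _ _).trans ?_⟩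
  exact mul_le_mul (hC n) (hD n) (norm_nonneg _) ((norm_nonneg _).trans (hC n))

lemma SrB.smulc {u : ℕ → E} (hu : SrB u) (r : ℝ) : SrB (fun n => r • u n) := by
  obtain ⟨C, hC⟩ := hu
  refine ⟨‖r‖ * C, fun n => ?_⟩
  rw [norm_smul]; exact mul_le_mul_of_nonneg_left (hC n) (norm_nonneg _)

lemma srAvg_norm_le {u : ℕ → E} {C : ℝ} (hC : ∀ n, ‖u n‖ ≤ C) (M : ℕ) : ‖srAvg u M‖ ≤ C := by
  have hC0 : 0 ≤ C := (norm_nonneg _).trans (hC 0)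
  unfold srAvg
  rw [norm_smul, norm_inv, Real.norm_natCast]
  rcases Nat.eq_zero_or_pos M with rfl | hM
  · simpa using hC0
  · have : (0:ℝ) < M := by exact_mod_cast hM
    rw [inv_mul_le_iff₀ this]
    refine (norm_sum_le _ _).trans ((Finset.sum_le_card_nsmul _ _ C fun c _ => hC c).trans ?_)
    simp

variable [ProperSpace E]

lemma srMean_tendsto (𝒰 : Ultrafilter ℕ) {u : ℕ → E} (hu : SrB u) :
    Tendsto (srAvg u) 𝒰 (𝓝 (srMean 𝒰 u)) := by
  obtain ⟨C, hC⟩ := hu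
  have hcpt := isCompact_closedBall (0:E) C
  have hmem : ((𝒰.map (srAvg u) : Ultrafilter E) : Filter E) ≤ 𝓟 (Metric.closedBall 0 C) := by
    rw [le_principal_iff, Ultrafilter.coe_map]
    exact Filter.mem_map.mpr (Filter.univ_mem' fun M => by simpa using srAvg_norm_le hC M)
  obtain ⟨x, _, hx⟩ := hcpt.ultrafilter_le_nhds _ hmem
  exact tendsto_nhds_limUnder ⟨x, hx⟩

lemma srMean_eq (𝒰 : Ultrafilter ℕ) {u : ℕ → E} {x : E} (h : Tendsto (srAvg u) 𝒰 (𝓝 x)) :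
    srMean 𝒰 u = x := h.limUnder_eq

lemma srMean_add (𝒰 : Ultrafilter ℕ) {u v : ℕ → E} (hu : SrB u) (hv : SrB v) :
    srMean 𝒰 (fun n => u n + v n) = srMean 𝒰 u + srMean 𝒰 v := by
  refine srMean_eq _ (((srMean_tendsto 𝒰 hu).add (srMean_tendsto 𝒰 hv)).congr fun M => ?_)
  simp [srAvg, Finset.sum_add_distrib]

lemma srMean_sub (𝒰 : Ultrafilter ℕ) {u v : ℕ → E} (hu : SrB u) (hv : SrB v) :
    srMean 𝒰 (fun n => u n - v n) = srMean 𝒰 u - srMean 𝒰 v := by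
  refine srMean_eq _ (((srMean_tendsto 𝒰 hu).sub (srMean_tendsto 𝒰 hv)).congr fun M => ?_)
  simp [srAvg, Finset.sum_sub_distrib, smul_sub]

lemma srMean_sum (𝒰 : Ultrafilter ℕ) {ι : Type*} (s : Finset ι) {u : ι → ℕ → E}
    (hu : ∀ i ∈ s, SrB (u i)) :
    srMean 𝒰 (fun n => ∑ i ∈ s, u i n) = ∑ i ∈ s, srMean 𝒰 (u i) := by
  refine srMean_eq _ ((tendsto_finsetSum s fun i hi => srMean_tendsto 𝒰 (hu i hi)).congr
    fun M => ?_)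
  simp only [srAvg]
  rw [← Finset.smul_sum, Finset.sum_comm]

lemma srMean_clm (𝒰 : Ultrafilter ℕ) {G : Type*} [NormedAddCommGroup G] [NormedSpace ℝ G]
    (T : E →L[ℝ] G) {u : ℕ → E} (hu : SrB u) :
    srMean 𝒰 (fun n => T (u n)) = T (srMean 𝒰 u) := by
  have := (T.continuous.tendsto _).comp (srMean_tendsto 𝒰 hu)
  refine Tendsto.limUnder_eq (this.congr fun M => ?_)
  simp [srAvg, map_sum]

lemma srMean_const (𝒰 : Ultrafilter ℕ) (h𝒰 : (𝒰 : Filter ℕ) ≤ atTop) (x : E) :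
    srMean 𝒰 (fun _ => x) = x := by
  refine srMean_eq _ (tendsto_const_nhds.congr' ?_)
  have : ∀ᶠ M : ℕ in 𝒰, 0 < M := h𝒰 (eventually_gt_atTop 0)
  filter_upwards [this] with M hM
  simp only [srAvg, Finset.sum_const, Finset.card_range]
  rw [← Nat.cast_smul_eq_nsmul ℝ, smul_smul, inv_mul_cancel₀ (by positivity), one_smul]

lemma srMean_shift1 (𝒰 : Ultrafilter ℕ) (h𝒰 : (𝒰 : Filter ℕ) ≤ atTop) {u : ℕ → E} (hu : SrB u) :
    srMean 𝒰 (fun n => u (n + 1)) = srMean 𝒰 u := by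
  have h1 := srMean_tendsto 𝒰 hu
  obtain ⟨C, hC⟩ := hu
  have h2 : Tendsto (fun M : ℕ => (M:ℝ)⁻¹ • (u M - u 0)) 𝒰 (𝓝 0) := by
    refine Tendsto.mono_left ?_ h𝒰
    rw [tendsto_zero_iff_norm_tendsto_zero]
    have h3 : Tendsto (fun M : ℕ => (M:ℝ)⁻¹ * (2 * C)) atTop (𝓝 0) := by
      simpa using (tendsto_inv_atTop_nhds_zero_nat (𝕜 := ℝ)).mul_const (2 * C)
    refine squeeze_zero (fun _ => norm_nonneg _) (fun M => ?_) h3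
    rw [norm_smul, norm_inv, Real.norm_natCast]
    gcongr
    refine (norm_sub_le _ _).trans ?_
    linarith [hC M, hC 0]
  have h3 := h1.add h2
  rw [add_zero] at h3
  refine srMean_eq _ (h3.congr fun M => ?_)
  simp only [srAvg]
  rw [← smul_add]
  congr 1
  have := Finset.sum_range_succ u M
  rw [Finset.sum_range_succ'] at this
  rw [eq_comm, ← sub_eq_zero]
  rw [← sub_eq_zero] at this
  rw [← this]; abel

lemma srMean_shift (𝒰 : Ultrafilter ℕ) (h𝒰 : (𝒰 : Filter ℕ) ≤ atTop) {u : ℕ → E} (hu : SrB u)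
    (s : ℕ) : srMean 𝒰 (fun n => u (n + s)) = srMean 𝒰 u := by
  induction s with
  | zero => rfl
  | succ s ih =>
    rw [← ih, ← srMean_shift1 𝒰 h𝒰 (hu.comp (fun n => n + s))]
    congr 1; funext n; congr 1; ring

lemma srMean_norm_le (𝒰 : Ultrafilter ℕ) {u : ℕ → E} (hu : SrB u) :
    ‖srMean 𝒰 u‖ ≤ srMean 𝒰 (fun n => ‖u n‖) := by
  refine le_of_tendsto_of_tendsto' (srMean_tendsto 𝒰 hu).norm (srMean_tendsto 𝒰 hu.norm)
    fun M => ?_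
  simp only [srAvg]
  rw [norm_smul, norm_inv, Real.norm_natCast, smul_eq_mul]
  gcongr
  exact norm_sum_le _ _

end Mean

section RMean
variable (𝒰 : Ultrafilter ℕ)

lemma srMean_mono {u v : ℕ → ℝ} (hu : SrB u) (hv : SrB v) (h : ∀ n, u n ≤ v n) :
    srMean 𝒰 u ≤ srMean 𝒰 v := by
  refine le_of_tendsto_of_tendsto' (srMean_tendsto 𝒰 hu) (srMean_tendsto 𝒰 hv) fun M => ?_
  simp only [srAvg, smul_eq_mul]
  gcongr with i
  exact h i

lemma srMean_nonneg {u : ℕ → ℝ} (hu : SrB u) (h : ∀ n, 0 ≤ u n) : 0 ≤ srMean 𝒰 u := by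
  refine ge_of_tendsto' (srMean_tendsto 𝒰 hu) fun M => ?_
  simp only [srAvg, smul_eq_mul]
  have := Finset.sum_nonneg (s := Finset.range M) (fun i _ => h i)
  positivity

lemma srMean_mulc {u : ℕ → ℝ} (hu : SrB u) (r : ℝ) :
    srMean 𝒰 (fun n => r * u n) = r * srMean 𝒰 u := by
  refine srMean_eq _ (((srMean_tendsto 𝒰 hu).const_mul r).congr fun M => ?_)
  simp only [srAvg, smul_eq_mul, ← Finset.mul_sum]; ring

lemma srMean_mulcC {u : ℕ → ℂ} (hu : SrB u) (r : ℂ) :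
    srMean 𝒰 (fun n => r * u n) = r * srMean 𝒰 u := by
  refine srMean_eq _ (((srMean_tendsto 𝒰 hu).const_mul r).congr fun M => ?_)
  simp only [srAvg, Complex.real_smul, ← Finset.mul_sum]; ring

lemma srMean_ofReal {u : ℕ → ℝ} (hu : SrB u) :
    srMean 𝒰 (fun n => (u n : ℂ)) = ((srMean 𝒰 u : ℝ) : ℂ) :=
  srMean_clm 𝒰 Complex.ofRealCLM hu

open ComplexConjugate in
lemma srMean_conj {u : ℕ → ℂ} (hu : SrB u) :
    srMean 𝒰 (fun n => conj (u n)) = conj (srMean 𝒰 u) :=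
  srMean_clm 𝒰 (Complex.conjCLE : ℂ →L[ℝ] ℂ) hu

lemma srMean_re {u : ℕ → ℂ} (hu : SrB u) :
    srMean 𝒰 (fun n => (u n).re) = (srMean 𝒰 u).re :=
  srMean_clm 𝒰 Complex.reCLM hu

lemma srMean_map_mul (l : ℕ) (hl : 0 < l) {g : ℕ → ℝ} (hg : SrB g) (h0 : ∀ n, 0 ≤ g n) :
    srMean 𝒰 (fun c => g (l * c)) ≤ l * srMean (𝒰.map (fun n => l * n)) g := by
  have h1 := srMean_tendsto 𝒰 (hg.comp (fun c => l * c))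
  have h2 := (srMean_tendsto (𝒰.map (fun n => l * n)) hg).const_mul (l : ℝ)
  rw [Ultrafilter.coe_map, Filter.tendsto_map'_iff] at h2
  refine le_of_tendsto_of_tendsto' h1 h2 fun M => ?_
  simp only [srAvg, smul_eq_mul, Function.comp]
  rcases Nat.eq_zero_or_pos M with rfl | hM
  · simp
  have hM' : (0:ℝ) < M := by exact_mod_cast hM
  have hl' : (0:ℝ) < l := by exact_mod_cast hl
  push_cast
  rw [mul_inv, ← mul_assoc, ← mul_assoc, mul_inv_cancel₀ hl'.ne', one_mul]
  gcongr
  rw [← Finset.sum_image (f := g) (g := fun h => l * h)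
        (fun a _ b _ hab => Nat.eq_of_mul_eq_mul_left hl hab)]
  refine Finset.sum_le_sum_of_subset_of_nonneg ?_ fun n _ _ => h0 n
  intro x hx
  obtain ⟨y, hy, rfl⟩ := Finset.mem_image.mp hx
  rw [Finset.mem_range] at hy ⊢
  exact Nat.mul_lt_mul_of_pos_left hy hl

end RMean

section GNS
open ComplexConjugate

/-- bounded complex sequences -/
def srBF : Submodule ℂ (ℕ → ℂ) where
  carrier := {u | SrB u}
  add_mem' := fun hu hv => SrB.add hu hv
  zero_mem' := SrB.const 0
  smul_mem' := fun c _ hu => SrB.mul (SrB.const c) hu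

lemma SrB.conj {u : ℕ → ℂ} (hu : SrB u) : SrB (fun n => conj (u n)) := by
  obtain ⟨C, hC⟩ := hu
  exact ⟨C, fun n => by rw [RCLike.norm_conj]; exact hC n⟩

/-- type synonym without topology -/
structure SrBFT (𝒱 : Ultrafilter ℕ) where
  val : srBF

variable (𝒱 : Ultrafilter ℕ)

/-- the obvious equivalence -/
def srEquiv : SrBFT 𝒱 ≃ srBF := ⟨SrBFT.val, SrBFT.mk, fun _ => rfl, fun _ => rfl⟩

instance : AddCommGroup (SrBFT 𝒱) := (srEquiv 𝒱).addCommGroup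
instance : Module ℂ (SrBFT 𝒱) := (srEquiv 𝒱).module ℂ

/-- underlying function as a linear map -/
def srFun : SrBFT 𝒱 →ₗ[ℂ] (ℕ → ℂ) where
  toFun x := x.val.1
  map_add' _ _ := rfl
  map_smul' _ _ := rfl

lemma srFun_bdd (x : SrBFT 𝒱) : SrB (srFun 𝒱 x) := x.val.2

/-- the GNS inner product core -/
@[reducible]
noncomputable def srCore : PreInnerProductSpace.Core ℂ (SrBFT 𝒱) where
  inner x y := srMean 𝒱 (fun n => conj (srFun 𝒱 x n) * srFun 𝒱 y n)
  conj_inner_symm x y := by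
    rw [← srMean_conj 𝒱 ((srFun_bdd 𝒱 y).conj.mul (srFun_bdd 𝒱 x))]
    congr 1; funext n
    simp [mul_comm]
  re_inner_nonneg x := by
    change 0 ≤ (srMean 𝒱 (fun n => conj (srFun 𝒱 x n) * srFun 𝒱 x n)).re
    rw [← srMean_re 𝒱 ((srFun_bdd 𝒱 x).conj.mul (srFun_bdd 𝒱 x))]
    refine srMean_nonneg 𝒱 ?_ fun n => ?_
    · obtain ⟨C, hC⟩ := (srFun_bdd 𝒱 x).conj.mul (srFun_bdd 𝒱 x)
      exact ⟨C, fun n => (Complex.abs_re_le_norm _).trans (hC n)⟩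
    · rw [Complex.conj_mul']
      norm_cast
      positivity
  add_left x y z := by
    rw [← srMean_add 𝒱 ((srFun_bdd 𝒱 x).conj.mul (srFun_bdd 𝒱 z))
      ((srFun_bdd 𝒱 y).conj.mul (srFun_bdd 𝒱 z))]
    congr 1; funext n
    simp [add_mul]
  smul_left x y r := by
    rw [← srMean_mulcC 𝒱 ((srFun_bdd 𝒱 x).conj.mul (srFun_bdd 𝒱 y))]
    congr 1; funext n
    simp [mul_assoc]

noncomputable instance : SeminormedAddCommGroup (SrBFT 𝒱) :=
  @InnerProductSpace.Core.toSeminormedAddCommGroup ℂ (SrBFT 𝒱) _ _ _ (srCore 𝒱)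

noncomputable instance : InnerProductSpace ℂ (SrBFT 𝒱) := InnerProductSpace.ofCore (srCore 𝒱)

lemma sr_norm_sq (x : SrBFT 𝒱) : ‖x‖ ^ 2 = srMean 𝒱 (fun n => ‖srFun 𝒱 x n‖ ^ 2) := by
  rw [norm_sq_eq_re_inner (𝕜 := ℂ)]
  change (srMean 𝒱 (fun n => conj (srFun 𝒱 x n) * srFun 𝒱 x n)).re = _
  rw [← srMean_re 𝒱 ((srFun_bdd 𝒱 x).conj.mul (srFun_bdd 𝒱 x))]
  congr 1; funext n
  rw [Complex.conj_mul']
  norm_cast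

/-- shift -/
def srShift : SrBFT 𝒱 →ₗ[ℂ] SrBFT 𝒱 where
  toFun x := ⟨⟨fun n => srFun 𝒱 x (n + 1), (srFun_bdd 𝒱 x).comp (fun n => n + 1)⟩⟩
  map_add' _ _ := rfl
  map_smul' _ _ := rfl

lemma srShift_pow (b : ℕ) (x : SrBFT 𝒱) (n : ℕ) :
    srFun 𝒱 ((srShift 𝒱 ^ b) x) n = srFun 𝒱 x (n + b) := by
  induction b generalizing n with
  | zero => simp
  | succ b ih =>
    rw [pow_succ']
    change srFun 𝒱 ((srShift 𝒱 ^ b) x) (n + 1) = _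
    rw [ih, show n + 1 + b = n + (b + 1) by omega]

lemma srShift_norm (h𝒱 : (𝒱 : Filter ℕ) ≤ atTop) (x : SrBFT 𝒱) : ‖srShift 𝒱 x‖ = ‖x‖ := by
  have : ‖srShift 𝒱 x‖ ^ 2 = ‖x‖ ^ 2 := by
    rw [sr_norm_sq, sr_norm_sq]
    have hb : SrB (fun n => ‖srFun 𝒱 x n‖ ^ 2) := by
      simp only [sq]
      exact (srFun_bdd 𝒱 x).norm.mul (srFun_bdd 𝒱 x).norm
    have hs : ∀ n, srFun 𝒱 (srShift 𝒱 x) n = srFun 𝒱 x (n + 1) := fun _ => rfl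
    simp only [hs]
    exact srMean_shift1 𝒱 h𝒱 (u := fun n => ‖srFun 𝒱 x n‖ ^ 2) hb
  exact (pow_left_inj₀ (norm_nonneg _) (norm_nonneg _) two_ne_zero).mp this

lemma sr_l1_le (h𝒱 : (𝒱 : Filter ℕ) ≤ atTop) (x : SrBFT 𝒱) :
    srMean 𝒱 (fun n => ‖srFun 𝒱 x n‖) ≤ ‖x‖ := by
  have hb := (srFun_bdd 𝒱 x).norm
  set μ := srMean 𝒱 (fun n => ‖srFun 𝒱 x n‖) with hμ
  have h2 : SrB (fun n => ‖srFun 𝒱 x n‖ ^ 2) := by simp only [sq]; exact hb.mul hb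
  have h1 : 2 * μ * μ - μ ^ 2 ≤ ‖x‖ ^ 2 := by
    rw [sr_norm_sq]
    have := srMean_mono 𝒱 (u := fun n => 2 * μ * ‖srFun 𝒱 x n‖ - μ ^ 2)
      (((SrB.const (2 * μ)).mul hb).sub (SrB.const (μ ^ 2))) h2
      (fun n => by nlinarith [sq_nonneg (‖srFun 𝒱 x n‖ - μ)])
    rwa [srMean_sub 𝒱 ((SrB.const (2 * μ)).mul hb) (SrB.const (μ ^ 2)), srMean_mulc 𝒱 hb,
      srMean_const 𝒱 h𝒱] at this
  have h3 : μ ^ 2 ≤ ‖x‖ ^ 2 := by linarith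
  exact (le_abs_self _).trans (abs_le_of_sq_le_sq h3 (norm_nonneg _))

/-- Structure theorem for bounded sequences. -/
lemma sr_structure (h𝒱 : (𝒱 : Filter ℕ) ≤ atTop) (f : ℕ → ℂ) (hf : SrB f) (m : ℕ) (hm : 0 < m)
    (τ : ℝ) (hτ : 0 < τ) :
    ∃ (n : ℕ) (l : Fin n → ℂ) (C : ℝ), (∀ j, ‖l j‖ = 1) ∧ 0 ≤ C ∧ ∀ τ' : ℝ, 0 < τ' →
      ∃ (G : Fin n → ℕ → ℂ) (g fu : ℕ → ℂ), (∀ j, SrB (G j)) ∧ SrB g ∧ SrB fu ∧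
        (∀ x, f x = (∑ j, G j x) + g x + fu x) ∧
        (∀ j, srMean 𝒱 (fun x => ‖G j x‖) ≤ C) ∧
        (∀ j b, srMean 𝒱 (fun x => ‖G j (x + b) - l j ^ b * G j x‖) ≤ τ') ∧
        srMean 𝒱 (fun x => ‖g x‖) ≤ τ ∧
        ∀ᶠ M : ℕ in atTop, ∀ φ : ℕ → ℂ, (∀ b, ‖φ b‖ ≤ 1) →
          srMean 𝒱 (fun x => ‖∑ b ∈ Finset.range M, φ b * fu (x + m * b)‖) ≤ τ' * M := by
  obtain ⟨n, l, C, hl, hC, H⟩ := sr_abs (srShift 𝒱) (srShift_norm 𝒱 h𝒱) ⟨⟨f, hf⟩⟩ m hm τ hτ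
  refine ⟨n, l, C, hl, hC, fun τ' hτ' => ?_⟩
  obtain ⟨G, g, Fu, hF, hG, hGb, hg, hM⟩ := H τ' hτ'
  refine ⟨fun j => srFun 𝒱 (G j), srFun 𝒱 g, srFun 𝒱 Fu, fun j => srFun_bdd 𝒱 _, srFun_bdd 𝒱 _,
    srFun_bdd 𝒱 _, fun x => ?_, fun j => (sr_l1_le 𝒱 h𝒱 _).trans (hG j), fun j b => ?_,
    (sr_l1_le 𝒱 h𝒱 _).trans hg, ?_⟩
  · have := congrArg (fun y => srFun 𝒱 y x) hF
    simp only [map_add, map_sum, Pi.add_apply, Finset.sum_apply] at this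
    exact this
  · refine le_trans (le_of_eq ?_) ((sr_l1_le 𝒱 h𝒱 _).trans (hGb j b))
    congr 1; funext x
    rw [map_sub, map_smul, Pi.sub_apply, srShift_pow]
    rfl
  · filter_upwards [hM] with M hM φ hφ
    refine le_trans (le_of_eq ?_) ((sr_l1_le 𝒱 h𝒱 _).trans (hM φ hφ))
    congr 1; funext x
    rw [map_sum, Finset.sum_apply]
    congr 1
    refine Finset.sum_congr rfl fun b _ => ?_
    rw [map_smul, Pi.smul_apply, srShift_pow]
    rfl

end GNS

section Kernel
open ComplexConjugate

/-- uniform mean value -/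
def SrHM (g : ℤ → ℝ) (c : ℝ) : Prop :=
  ∀ ε : ℝ, 0 < ε → ∀ᶠ M : ℕ in atTop, ∀ x : ℤ,
    |(∑ b ∈ Finset.range M, g (b + x)) - M * c| ≤ ε * M

/-- representation as a nonnegative combination of characters -/
structure SrRep (g : ℤ → ℝ) (ι : Type) [Fintype ι] (a : ι → ℝ) (z : ι → ℂ) : Prop where
  a0 : ∀ s, 0 ≤ a s
  z1 : ∀ s, ‖z s‖ = 1
  eq : ∀ h : ℤ, (g h : ℂ) = ∑ s, (a s : ℂ) * z s ^ h

lemma SrHM.unique {g : ℤ → ℝ} {c d : ℝ} (h1 : SrHM g c) (h2 : SrHM g d) : c = d := by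
  by_contra hne
  have hpos : 0 < |c - d| := abs_pos.mpr (sub_ne_zero.mpr hne)
  obtain ⟨M, ⟨hM1, hM2⟩, hM0⟩ := ((h1 _ (by positivity : 0 < |c - d| / 4)).and
    (h2 _ (by positivity : 0 < |c - d| / 4)) |>.and (eventually_gt_atTop 0)).exists
  have e1 := hM1 0
  have e2 := hM2 0
  have hM0' : (0:ℝ) < M := by exact_mod_cast hM0
  have : |(M:ℝ) * (c - d)| ≤ |c - d| / 4 * M + |c - d| / 4 * M := by
    set σ := ∑ b ∈ Finset.range M, g (b + 0)
    have : (M:ℝ) * (c - d) = (σ - M * d) - (σ - M * c) := by ring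
    rw [this]
    refine (abs_sub _ _).trans ?_
    linarith
  rw [abs_mul, abs_of_pos hM0'] at this
  nlinarith

lemma sr_char_sum (z : ℂ) (hz : ‖z‖ = 1) (hz1 : z ≠ 1) (M : ℕ) (x : ℤ) :
    ‖∑ b ∈ Finset.range M, z ^ ((b : ℤ) + x)‖ ≤ 2 / ‖z - 1‖ := by
  have hz0 : z ≠ 0 := by intro h; simp [h] at hz
  have h1 : ∑ b ∈ Finset.range M, z ^ ((b : ℤ) + x) = (∑ b ∈ Finset.range M, z ^ b) * z ^ x := by
    rw [Finset.sum_mul]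
    refine Finset.sum_congr rfl fun b _ => ?_
    rw [zpow_add₀ hz0, zpow_natCast]
  have hpos : 0 < ‖z - 1‖ := norm_pos_iff.mpr (sub_ne_zero.mpr hz1)
  rw [h1, norm_mul, norm_zpow, hz, one_zpow, mul_one, le_div_iff₀ hpos, ← norm_mul, geom_sum_mul]
  refine (norm_sub_le _ _).trans ?_
  rw [norm_pow, hz]; norm_num

open scoped Classical in
lemma SrRep.hm {g : ℤ → ℝ} {ι : Type} [Fintype ι] {a : ι → ℝ} {z : ι → ℂ} (h : SrRep g ι a z) :
    SrHM g (∑ s, if z s = 1 then a s else 0) := by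
  set K := ∑ s, a s * (2 / ‖z s - 1‖) with hK
  have key : ∀ (M : ℕ) (x : ℤ), |(∑ b ∈ Finset.range M, g (b + x))
      - M * ∑ s, (if z s = 1 then a s else 0)| ≤ K := by
    intro M x
    rw [← Real.norm_eq_abs, ← Complex.norm_real]
    push_cast
    simp only [h.eq]
    rw [Finset.sum_comm, Finset.mul_sum, ← Finset.sum_sub_distrib]
    refine (norm_sum_le _ _).trans (Finset.sum_le_sum fun s _ => ?_)
    rw [← Finset.mul_sum]
    split_ifs with hs
    · have : ∑ b ∈ Finset.range M, z s ^ ((b : ℤ) + x) = M := by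
        simp [hs]
      rw [this, mul_comm, sub_self, norm_zero]
      have := h.a0 s
      positivity
    · rw [Complex.ofReal_zero, mul_zero, sub_zero, norm_mul, Complex.norm_real, Real.norm_of_nonneg (h.a0 s)]
      exact mul_le_mul_of_nonneg_left (sr_char_sum _ (h.z1 s) hs M x) (h.a0 s)
  intro ε hε
  have : Tendsto (fun M : ℕ => ε * (M:ℝ)) atTop atTop :=
    tendsto_natCast_atTop_atTop.const_mul_atTop hε
  filter_upwards [this.eventually_ge_atTop K] with M hM x
  exact (key M x).trans hM

lemma SrRep.mul {g g' : ℤ → ℝ} {ι ι' : Type} [Fintype ι] [Fintype ι'] {a : ι → ℝ} {z : ι → ℂ}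
    {a' : ι' → ℝ} {z' : ι' → ℂ} (h : SrRep g ι a z) (h' : SrRep g' ι' a' z') :
    SrRep (fun x => g x * g' x) (ι × ι') (fun p => a p.1 * a' p.2) (fun p => z p.1 * z' p.2) where
  a0 p := mul_nonneg (h.a0 _) (h'.a0 _)
  z1 p := by rw [norm_mul, h.z1, h'.z1, one_mul]
  eq x := by
    push_cast
    rw [h.eq, h'.eq, Finset.sum_mul_sum, Fintype.sum_prod_type]
    refine Finset.sum_congr rfl fun s _ => Finset.sum_congr rfl fun s' _ => ?_
    rw [mul_zpow]; ring

/-- existential form -/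
def SrTP (g : ℤ → ℝ) : Prop :=
  ∃ (ι : Type) (_ : Fintype ι) (a : ι → ℝ) (z : ι → ℂ), SrRep g ι a z

lemma SrTP.mul {g g' : ℤ → ℝ} (h : SrTP g) (h' : SrTP g') : SrTP (fun x => g x * g' x) := by
  obtain ⟨ι, _, a, z, h⟩ := h
  obtain ⟨ι', _, a', z', h'⟩ := h'
  exact ⟨_, _, _, _, h.mul h'⟩

lemma SrTP.hm {g : ℤ → ℝ} (h : SrTP g) : ∃ c, SrHM g c := by
  obtain ⟨ι, _, a, z, h⟩ := h
  exact ⟨_, h.hm⟩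

open scoped Classical in
lemma SrTP.mean_mul {g g' : ℤ → ℝ} (h : SrTP g) (h' : SrTP g') {c c' d : ℝ} (hc : SrHM g c)
    (hc' : SrHM g' c') (hd : SrHM (fun x => g x * g' x) d) : c * c' ≤ d := by
  obtain ⟨ι, _, a, z, h⟩ := h
  obtain ⟨ι', _, a', z', h'⟩ := h'
  rw [hc.unique h.hm, hc'.unique h'.hm, hd.unique (h.mul h').hm, Finset.sum_mul_sum,
    Fintype.sum_prod_type]
  refine Finset.sum_le_sum fun s _ => Finset.sum_le_sum fun s' _ => ?_
  have h1 := h.a0 s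
  have h2 := h'.a0 s'
  by_cases hs : z s = 1
  · by_cases hs' : z' s' = 1
    · simp [hs, hs']
    · simp only [hs, hs', if_true, if_false, mul_zero]
      split_ifs <;> positivity
  · simp only [hs, if_false, zero_mul]
    split_ifs <;> positivity

/-- Fejér type kernel -/
noncomputable def srFej (R : ℕ) (l : ℂ) (h : ℤ) : ℝ := ‖∑ t ∈ Finset.range R, (l ^ h) ^ t‖ ^ 2

lemma srFej_rep (R : ℕ) (l : ℂ) (hl : ‖l‖ = 1) :
    SrRep (srFej R l) (Fin R × Fin R) (fun _ => 1) (fun p => l ^ (p.1 : ℕ) * conj (l ^ (p.2 : ℕ))) where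
  a0 _ := zero_le_one
  z1 p := by simp [hl]
  eq h := by
    unfold srFej
    push_cast
    rw [← Complex.mul_conj', map_sum, Finset.sum_range, Finset.sum_range, Finset.sum_mul_sum,
      Fintype.sum_prod_type]
    refine Finset.sum_congr rfl fun s _ => Finset.sum_congr rfl fun s' _ => ?_
    rw [one_mul, mul_zpow]
    simp only [map_zpow₀, ← zpow_natCast, ← zpow_mul]
    rw [mul_comm h, mul_comm h]

open scoped Classical in
lemma srFej_mean (R : ℕ) (l : ℂ) (hl : ‖l‖ = 1) {c : ℝ} (hc : SrHM (srFej R l) c) : (R : ℝ) ≤ c := by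
  rw [hc.unique (srFej_rep R l hl).hm, Fintype.sum_prod_type]
  have : (R : ℝ) = ∑ s : Fin R, 1 := by simp
  rw [this]
  refine Finset.sum_le_sum fun s _ => ?_
  have h1 : (1 : ℝ) = (fun s' : Fin R => if l ^ (s : ℕ) * conj (l ^ (s' : ℕ)) = 1 then (1:ℝ) else 0) s := by
    simp only
    rw [Complex.mul_conj', norm_pow, hl]; simp
  refine h1.le.trans ?_
  exact Finset.single_le_sum (f := fun s' : Fin R => if l ^ (s : ℕ) * conj (l ^ (s' : ℕ)) = 1
    then (1:ℝ) else 0) (fun _ _ => by split_ifs <;> simp) (Finset.mem_univ s)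

lemma srTP_one : SrTP (fun _ => 1) :=
  ⟨Unit, _, fun _ => 1, fun _ => 1, ⟨fun _ => zero_le_one, fun _ => by simp, fun h => by simp⟩⟩

lemma srHM_one : SrHM (fun _ => 1) 1 := by
  intro ε hε
  filter_upwards with M x
  simp; positivity

lemma sr_prod_tp {n : ℕ} (R : ℕ) (hR : 1 ≤ R) (l : Fin n → ℂ) (hl : ∀ j, ‖l j‖ = 1)
    (s : Finset (Fin n)) : SrTP (fun h => ∏ j ∈ s, srFej R (l j) h) ∧
      ∃ c, 1 ≤ c ∧ SrHM (fun h => ∏ j ∈ s, srFej R (l j) h) c := by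
  classical
  induction s using Finset.induction_on with
  | empty => exact ⟨by simpa using srTP_one, 1, le_rfl, by simpa using srHM_one⟩
  | insert j s hj ih =>
    obtain ⟨h1, c, hc1, hc⟩ := ih
    have hF : SrTP (srFej R (l j)) := ⟨_, _, _, _, srFej_rep R (l j) (hl j)⟩
    simp only [Finset.prod_insert hj]
    have hm := hF.mul h1
    obtain ⟨d, hd⟩ := hm.hm
    obtain ⟨e, he⟩ := hF.hm
    refine ⟨hm, d, ?_, hd⟩
    have h2 := SrTP.mean_mul hF h1 he hc hd
    have h3 := srFej_mean R (l j) (hl j) he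
    have : (1:ℝ) ≤ R := by exact_mod_cast hR
    nlinarith

open scoped Classical in
lemma sr_kernel {n : ℕ} (l : Fin n → ℂ) (hl : ∀ j, ‖l j‖ = 1) (δ : ℝ) (hδ : 0 < δ) :
    ∃ (Ψ : ℤ → ℝ) (ι : Type) (_ : Fintype ι) (a : ι → ℝ) (z : ι → ℂ),
      SrRep Ψ ι a z ∧ (∀ h, 0 ≤ Ψ h) ∧ (∑ s, if z s = 1 then a s else 0) = 1 ∧ SrHM Ψ 1 ∧
      ∀ j, ∀ᶠ M : ℕ in atTop, ∀ x : ℤ,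
        ∑ b ∈ Finset.range M, Ψ (b + x) * ‖l j ^ ((b : ℤ) + x) - 1‖ ≤ δ * M := by
  obtain ⟨R, hR⟩ := exists_nat_ge (max 1 (16 / δ ^ 2))
  have hR1 : (1:ℝ) ≤ R := (le_max_left _ _).trans hR
  have hR2 : 16 / δ ^ 2 ≤ R := (le_max_right _ _).trans hR
  have hR1' : 1 ≤ R := by exact_mod_cast hR1
  set Ψ0 : ℤ → ℝ := fun h => ∏ j, srFej R (l j) h with hΨ0
  obtain ⟨⟨ι, _, a, z, hrep⟩, c0, hc0, hm0⟩ := sr_prod_tp R hR1' l hl Finset.univ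
  have hc0' : 0 < c0 := by linarith
  have hΨ0n : ∀ h, 0 ≤ Ψ0 h := fun h => Finset.prod_nonneg fun j _ => by unfold srFej; positivity
  set Ψ : ℤ → ℝ := fun h => Ψ0 h / c0 with hΨ
  have hrep' : SrRep Ψ ι (fun s => a s / c0) z := by
    refine ⟨fun s => div_nonneg (hrep.a0 s) hc0'.le, hrep.z1, fun h => ?_⟩
    have := hrep.eq h
    simp only [hΨ]
    push_cast
    rw [show (Ψ0 h : ℂ) = _ from this, Finset.sum_div]
    refine Finset.sum_congr rfl fun s _ => by ring
  have hone : (∑ s, if z s = 1 then a s / c0 else 0) = 1 := by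
    have e := hm0.unique hrep.hm
    have : (∑ s, if z s = 1 then a s / c0 else 0) = (∑ s, if z s = 1 then a s else 0) / c0 := by
      rw [Finset.sum_div]
      refine Finset.sum_congr rfl fun s _ => by split_ifs <;> simp
    rw [this, ← e, div_self hc0'.ne']
  have hHM : SrHM Ψ 1 := by have := hrep'.hm; rwa [hone] at this
  have hΨn : ∀ h, 0 ≤ Ψ h := fun h => div_nonneg (hΨ0n h) hc0'.le
  refine ⟨Ψ, ι, _, _, z, hrep', hΨn, hone, hHM, fun j => ?_⟩
  obtain ⟨hTP, c', hc', hm'⟩ := sr_prod_tp R hR1' l hl (Finset.univ.erase j)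
  set pr : ℤ → ℝ := fun h => ∏ i ∈ Finset.univ.erase j, srFej R (l i) h with hpr_def
  have hfac : ∀ h, Ψ0 h = srFej R (l j) h * pr h := by
    intro h
    exact (Finset.mul_prod_erase Finset.univ (fun i => srFej R (l i) h) (Finset.mem_univ j)).symm
  have hcc : R * c' ≤ c0 := by
    have hF : SrTP (srFej R (l j)) := ⟨_, _, _, _, srFej_rep R (l j) (hl j)⟩
    obtain ⟨e, he⟩ := hF.hm
    have h3 := srFej_mean R (l j) (hl j) he
    have h4 : SrHM (fun x => srFej R (l j) x * pr x) c0 := by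
      have : (fun x => srFej R (l j) x * pr x) = Ψ0 := funext fun h => (hfac h).symm
      rw [this]; exact hm0
    have h5 := SrTP.mean_mul hF hTP he hm' h4
    exact (mul_le_mul_of_nonneg_right h3 (by linarith)).trans h5
  have hprn : ∀ h, 0 ≤ pr h := fun h => Finset.prod_nonneg fun j _ => by unfold srFej; positivity
  have hsq : ∀ h : ℤ, Ψ0 h * ‖l j ^ h - 1‖ ^ 2 ≤ 4 * pr h := by
    intro h
    have e : srFej R (l j) h * ‖l j ^ h - 1‖ ^ 2 ≤ 4 := by
      unfold srFej
      rw [← mul_pow, ← norm_mul, geom_sum_mul]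
      have : ‖(l j ^ h) ^ R - 1‖ ≤ 2 := by
        refine (norm_sub_le _ _).trans ?_
        rw [norm_pow, norm_zpow, hl]; norm_num
      have := pow_le_pow_left₀ (norm_nonneg _) this 2
      linarith
    rw [hfac]
    have := mul_le_mul_of_nonneg_right e (hprn h)
    linarith
  filter_upwards [hHM 1 one_pos, hm' c' (by linarith)] with M hM1 hM2 x
  have s1 : ∑ b ∈ Finset.range M, Ψ (b + x) ≤ 2 * M := by
    have := (abs_le.mp (hM1 x)).2; linarith
  have s2 : ∑ b ∈ Finset.range M, pr (b + x) ≤ 2 * c' * M := by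
    have := (abs_le.mp (hM2 x)).2; linarith
  have s3 : ∑ b ∈ Finset.range M, Ψ (b + x) * ‖l j ^ ((b : ℤ) + x) - 1‖ ^ 2 ≤ 8 / R * M := by
    have : ∀ b ∈ Finset.range M, Ψ (b + x) * ‖l j ^ ((b : ℤ) + x) - 1‖ ^ 2
        ≤ 4 / c0 * pr (b + x) := by
      intro b _
      have := hsq (b + x)
      simp only [hΨ]
      rw [div_mul_eq_mul_div, div_mul_eq_mul_div]
      gcongr
    refine (Finset.sum_le_sum this).trans ?_
    rw [← Finset.mul_sum]
    have h6 : 4 / c0 * ∑ b ∈ Finset.range M, pr (b + x) ≤ 4 / c0 * (2 * c' * M) := by gcongr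
    refine h6.trans ?_
    have h7 : 4 / c0 * (2 * c') ≤ 8 / R := by
      rw [div_mul_eq_mul_div, div_le_div_iff₀ hc0' (by linarith)]
      linarith
    have := mul_le_mul_of_nonneg_right h7 (Nat.cast_nonneg M : (0:ℝ) ≤ M)
    linarith
  have s4 : ∑ b ∈ Finset.range M, Ψ (b + x) * ‖l j ^ ((b : ℤ) + x) - 1‖
      ≤ ∑ b ∈ Finset.range M, (δ / 4 * Ψ (b + x)
        + 1 / δ * (Ψ (b + x) * ‖l j ^ ((b : ℤ) + x) - 1‖ ^ 2)) := by
    refine Finset.sum_le_sum fun b _ => ?_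
    set t := ‖l j ^ ((b : ℤ) + x) - 1‖
    have e : t ≤ δ / 4 + 1 / δ * t ^ 2 := by
      have : δ / 4 + 1 / δ * t ^ 2 - t = (δ / 2 - t) ^ 2 / δ := by field_simp; ring
      have h8 : 0 ≤ (δ / 2 - t) ^ 2 / δ := by positivity
      linarith
    have := mul_le_mul_of_nonneg_left e (hΨn (b + x))
    linarith
  refine s4.trans ?_
  rw [Finset.sum_add_distrib, ← Finset.mul_sum, ← Finset.mul_sum]
  have h9 : 1 / δ * (8 / R) ≤ δ / 2 := by
    have hRp : (0:ℝ) < R := by linarith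
    rw [div_le_iff₀ (by positivity)] at hR2
    rw [div_mul_div_comm, div_le_div_iff₀ (by positivity) (by norm_num)]
    nlinarith
  have hM0 : (0:ℝ) ≤ M := Nat.cast_nonneg M
  have h10 : 1 / δ * ∑ b ∈ Finset.range M, Ψ (b + x) * ‖l j ^ ((b : ℤ) + x) - 1‖ ^ 2
      ≤ 1 / δ * (8 / R * M) := by gcongr
  have h11 : δ / 4 * ∑ b ∈ Finset.range M, Ψ (b + x) ≤ δ / 4 * (2 * M) := by gcongr
  have h12 := mul_le_mul_of_nonneg_right h9 hM0
  linarith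

end Kernel

section ShiftTrick

lemma sr_sum_shift (k : ℕ → ℝ) (B : ℝ) (hB : ∀ b, |k b| ≤ B) (M s : ℕ) :
    |∑ b ∈ Finset.range M, k (b + s) - ∑ b ∈ Finset.range M, k b| ≤ 2 * s * B := by
  have h1 : ∑ b ∈ Finset.range (s + M), k b = ∑ b ∈ Finset.range s, k b
      + ∑ b ∈ Finset.range M, k (s + b) := Finset.sum_range_add k s M
  have h2 : ∑ b ∈ Finset.range (M + s), k b = ∑ b ∈ Finset.range M, k b
      + ∑ b ∈ Finset.range s, k (M + b) := Finset.sum_range_add k M s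
  rw [add_comm M s] at h2
  have e : ∑ b ∈ Finset.range M, k (b + s) - ∑ b ∈ Finset.range M, k b
      = ∑ b ∈ Finset.range s, k (M + b) - ∑ b ∈ Finset.range s, k b := by
    simp only [add_comm _ s]; linarith
  rw [e]
  refine (abs_sub _ _).trans ?_
  have h3 : ∀ p : ℕ → ℕ, |∑ b ∈ Finset.range s, k (p b)| ≤ s * B := by
    intro p
    refine (Finset.abs_sum_le_sum_abs _ _).trans
      ((Finset.sum_le_card_nsmul _ _ B fun b _ => hB _).trans ?_)
    simp
  have := h3 (fun b => M + b)
  have := h3 (fun b => b)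
  linarith

lemma sr_bddX (m ℓ : ℕ)
    {P : ℤ → ℝ} {B : ℝ} (hP : ∀ x, |P x| ≤ B) {g : ℕ → ℝ} (hg : SrB g) (M : ℕ) (t : ℤ) :
    SrB (fun c : ℕ => ∑ b ∈ Finset.range M, P ((b:ℤ) - c - t) * g (ℓ * c + m * b)) :=
  SrB.sum _ fun b _ => SrB.mul ⟨B, fun c => by rw [Real.norm_eq_abs]; exact hP _⟩
    (hg.comp (fun c => ℓ * c + m * b))

lemma sr_shift_s (𝒰 : Ultrafilter ℕ) (h𝒰 : (𝒰 : Filter ℕ) ≤ atTop) (m ℓ : ℕ)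
    {P : ℤ → ℝ} {B : ℝ} (hP : ∀ x, |P x| ≤ B) {g : ℕ → ℝ} {C : ℝ}
    (hg : ∀ n, |g n| ≤ C) (M s : ℕ) (u : ℤ) :
    |srMean 𝒰 (fun c : ℕ => ∑ b ∈ Finset.range M, P ((b:ℤ) - c - u) * g (ℓ * c + m * b))
      - srMean 𝒰 (fun c : ℕ => ∑ b ∈ Finset.range M,
          P ((b:ℤ) - c - (u + (m + ℓ) * s)) * g (ℓ * c + m * b))|
      ≤ 2 * (ℓ * s) * (B * C) := by
  have hgB : SrB g := ⟨C, hg⟩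
  have hB0 : 0 ≤ B := (abs_nonneg _).trans (hP 0)
  rw [← srMean_shift 𝒰 h𝒰 (sr_bddX m ℓ hP hgB M u) (m * s),
    ← srMean_sub 𝒰 ((sr_bddX m ℓ hP hgB M u).comp (fun c => c + m * s)) (sr_bddX m ℓ hP hgB M _),
    ← Real.norm_eq_abs]
  have hb := ((sr_bddX m ℓ hP hgB M u).comp (fun c => c + m * s)).sub
    (sr_bddX m ℓ hP hgB M (u + (m + ℓ) * s))
  refine (srMean_norm_le 𝒰 hb).trans ?_
  rw [← srMean_const 𝒰 h𝒰 (2 * (ℓ * s) * (B * C))]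
  refine srMean_mono 𝒰 hb.norm (SrB.const _) fun c => ?_
  rw [Real.norm_eq_abs]
  have := sr_sum_shift (fun b => P ((b:ℤ) - c - (u + (m + ℓ) * s)) * g (ℓ * c + m * b)) (B * C)
    (fun b => by rw [abs_mul]; exact mul_le_mul (hP _) (hg _) (abs_nonneg _) hB0) M (ℓ * s)
  push_cast at this
  refine le_trans (le_of_eq ?_) this
  congr 1
  congr 1
  refine Finset.sum_congr rfl fun b _ => ?_
  congr 2
  · push_cast; ring
  · ring

lemma SrHM.rev {g : ℤ → ℝ} {c : ℝ} (h : SrHM g c) (ε : ℝ) (hε : 0 < ε) :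
    ∀ᶠ M : ℕ in atTop, ∀ x : ℤ, |(∑ t ∈ Finset.range M, g (x - t)) - M * c| ≤ ε * M := by
  filter_upwards [h ε hε] with M hM x
  have := hM (x - M + 1)
  rw [← Finset.sum_range_reflect] at this
  refine le_trans (le_of_eq ?_) this
  congr 2
  refine Finset.sum_congr rfl fun b hb => ?_
  have := Finset.mem_range.mp hb
  congr 1
  have h2 : ((M - 1 - b : ℕ) : ℤ) = M - 1 - b := by omega
  rw [h2]; ring

lemma sr_atTop_map (𝒰 : Ultrafilter ℕ) (ℓ : ℕ)
    (hℓ : 0 < ℓ) (h : (𝒰 : Filter ℕ) ≤ atTop) :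
    ((𝒰.map (fun n => ℓ * n) : Ultrafilter ℕ) : Filter ℕ) ≤ atTop := by
  have : Tendsto (fun n => ℓ * n) atTop atTop :=
    tendsto_atTop_mono (fun M => by nlinarith : ∀ M : ℕ, M ≤ ℓ * M) tendsto_id
  exact this.mono_left h

lemma sr_mean_l (𝒰 : Ultrafilter ℕ) (h𝒰 : (𝒰 : Filter ℕ) ≤ atTop) (ℓ : ℕ)
    (hℓ : 0 < ℓ) {g : ℕ → ℝ} (hg : SrB g) (h0 : ∀ n, 0 ≤ g n) (k : ℕ) :
    srMean 𝒰 (fun c => g (ℓ * c + k)) ≤ ℓ * srMean (𝒰.map (fun n => ℓ * n)) g := by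
  have := srMean_map_mul 𝒰 ℓ hℓ (hg.comp (fun n => n + k)) (fun n => h0 _)
  rwa [srMean_shift _ (sr_atTop_map 𝒰 ℓ hℓ h𝒰) hg] at this

lemma sr_upper (𝒰 : Ultrafilter ℕ) (h𝒰 : (𝒰 : Filter ℕ) ≤ atTop) (m ℓ : ℕ)
    (hm : 0 < m) (hℓ : 0 < ℓ) {Ψ : ℤ → ℝ} {B : ℝ} (hB : ∀ x, |Ψ x| ≤ B) (hΨ : ∀ x, 0 ≤ Ψ x)
    (hHM : SrHM Ψ 1) {g : ℕ → ℝ} (hg : SrB g) (h0 : ∀ n, 0 ≤ g n) (τ : ℝ) (hτ : 0 < τ) :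
    ∀ᶠ M : ℕ in atTop,
      srMean 𝒰 (fun c : ℕ => ∑ b ∈ Finset.range M, Ψ ((b:ℤ) - c) * g (ℓ * c + m * b))
        ≤ (2 * (m + ℓ) * ℓ * srMean (𝒰.map (fun n => ℓ * n)) g + τ) * M := by
  obtain ⟨C, hC⟩ := id hg
  set γ := srMean (𝒰.map (fun n => ℓ * n)) g with hγ
  have htt : Tendsto (fun S : ℕ => (m + ℓ) * S) atTop atTop :=
    tendsto_atTop_mono (fun M => by nlinarith : ∀ M : ℕ, M ≤ (m + ℓ) * M) tendsto_id
  obtain ⟨S, hS1, hS0⟩ := ((htt.eventually (hHM.rev 1 one_pos)).and (eventually_gt_atTop 0)).exists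
  have hS0' : (0:ℝ) < S := by exact_mod_cast hS0
  have ht2 : Tendsto (fun M : ℕ => τ * (M:ℝ)) atTop atTop :=
    tendsto_natCast_atTop_atTop.const_mul_atTop hτ
  have hB0 : 0 ≤ B := (abs_nonneg _).trans (hB 0)
  have hC0 : 0 ≤ C := (norm_nonneg _).trans (hC 0)
  filter_upwards [ht2.eventually_ge_atTop (2 * (ℓ * S) * (B * C))] with M hM
  set X : ℕ → ℝ := fun s => srMean 𝒰 (fun c : ℕ => ∑ b ∈ Finset.range M,
          Ψ ((b:ℤ) - c - (0 + (m + ℓ) * s)) * g (ℓ * c + m * b)) with hX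
  set X0 := srMean 𝒰 (fun c : ℕ => ∑ b ∈ Finset.range M, Ψ ((b:ℤ) - c) * g (ℓ * c + m * b)) with hX0
  have h1 : ∀ s ∈ Finset.range S, X0 ≤ X s + 2 * (ℓ * S) * (B * C) := by
    intro s hs
    have := sr_shift_s 𝒰 h𝒰 m ℓ hB hC M s 0
    simp only [sub_zero] at this
    have h2 := (abs_le.mp this).2
    have h3 : (s:ℝ) ≤ S := by exact_mod_cast (Finset.mem_range.mp hs).le
    have h4 : 2 * (ℓ * (s:ℝ)) * (B * C) ≤ 2 * (ℓ * S) * (B * C) := by gcongr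
    simp only [hX, hX0]
    linarith
  have h2 := Finset.sum_le_sum h1
  rw [Finset.sum_const, Finset.card_range, nsmul_eq_mul, Finset.sum_add_distrib, Finset.sum_const,
    Finset.card_range, nsmul_eq_mul] at h2
  have h3 : ∑ s ∈ Finset.range S, X s ≤ 2 * (m + ℓ) * S * (M * (ℓ * γ)) := by
    simp only [hX]
    rw [← srMean_sum 𝒰 _ fun s _ => sr_bddX m ℓ hB hg M _]
    have hgb : SrB (fun c : ℕ => ∑ b ∈ Finset.range M, g (ℓ * c + m * b)) :=
      SrB.sum _ fun b _ => hg.comp (fun c => ℓ * c + m * b)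
    have h4 : srMean 𝒰 (fun c : ℕ => ∑ b ∈ Finset.range M, g (ℓ * c + m * b)) ≤ M * (ℓ * γ) := by
      rw [srMean_sum 𝒰 _ fun b _ => hg.comp (fun c => ℓ * c + m * b)]
      refine (Finset.sum_le_card_nsmul _ _ (ℓ * γ) fun b _ =>
        sr_mean_l 𝒰 h𝒰 ℓ hℓ hg h0 (m * b)).trans ?_
      simp
    refine le_trans ?_ (mul_le_mul_of_nonneg_left h4 (by positivity : (0:ℝ) ≤ 2 * (m + ℓ) * S))
    rw [← srMean_mulc 𝒰 hgb]
    refine srMean_mono 𝒰 (SrB.sum _ fun s _ => sr_bddX m ℓ hB hg M _) ((SrB.const _).mul hgb)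
      fun c => ?_
    rw [Finset.sum_comm, Finset.mul_sum]
    refine Finset.sum_le_sum fun b _ => ?_
    rw [← Finset.sum_mul]
    refine mul_le_mul_of_nonneg_right ?_ (h0 _)
    have h5 := (abs_le.mp (hS1 ((b:ℤ) - c))).2
    have h6 : ∑ s ∈ Finset.range S, Ψ ((b:ℤ) - c - (0 + (m + ℓ) * s))
        ≤ ∑ t ∈ Finset.range ((m + ℓ) * S), Ψ ((b:ℤ) - c - t) := by
      have h7 := Finset.sum_image (s := Finset.range S)
        (f := fun t : ℕ => Ψ ((b:ℤ) - c - t)) (g := fun h => (m + ℓ) * h)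
        (fun a _ b _ hab => Nat.eq_of_mul_eq_mul_left (by omega) hab)
      push_cast at h7
      simp only [zero_add]
      rw [← h7]
      refine Finset.sum_le_sum_of_subset_of_nonneg ?_ fun n _ _ => hΨ _
      intro x hx
      obtain ⟨y, hy, rfl⟩ := Finset.mem_image.mp hx
      rw [Finset.mem_range] at hy ⊢
      exact Nat.mul_lt_mul_of_pos_left hy (by omega)
    push_cast at h5
    linarith
  have h8 : S * X0 ≤ S * ((2 * (m + ℓ) * ℓ * γ + τ) * M) := by
    have : S * (2 * (ℓ * S) * (B * C)) ≤ S * (τ * M) := by gcongr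
    nlinarith
  exact le_of_mul_le_mul_left h8 hS0'

lemma sr_lip (𝒰 : Ultrafilter ℕ) (h𝒰 : (𝒰 : Filter ℕ) ≤ atTop)
    {f : ℕ → ℝ} {lam : ℝ} (hf : ∀ n, |f (n + 1) - f n| ≤ lam) (n r : ℕ) :
    f n - r * lam ≤ f (n + r) := by
  induction r with
  | zero => simp
  | succ r ih =>
    have := (abs_le.mp (hf (n + r))).1
    rw [← add_assoc]; push_cast; linarith

lemma sr_lower (𝒰 : Ultrafilter ℕ) (h𝒰 : (𝒰 : Filter ℕ) ≤ atTop) (m ℓ : ℕ)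
    (hm : 0 < m) (hℓ : 0 < ℓ) {Ψ : ℤ → ℝ} {B : ℝ} (hB : ∀ x, |Ψ x| ≤ B)
    (hΨ : ∀ x, 0 ≤ Ψ x) (hHM : SrHM Ψ 1) {f : ℕ → ℝ} (hf0 : ∀ n, 0 ≤ f n) (hf1 : ∀ n, f n ≤ 1)
    {lam : ℝ} (hlip : ∀ n, |f (n + 1) - f n| ≤ lam) (δ : ℝ) (hδ : 0 < δ) (hδ1 : δ ≤ 1) :
    ∀ᶠ M : ℕ in atTop,
      ((1 - δ) * (srMean 𝒰 (fun c => f (ℓ * c)) - ℓ * lam) - 2 * ℓ * (m + ℓ) * lam - δ) * M ≤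
      srMean 𝒰 (fun c : ℕ => ∑ b ∈ Finset.range M, Ψ ((b:ℤ) - c) * f (ℓ * c + m * b)) := by
  have hfa : ∀ n, |f n| ≤ 1 := fun n => by rw [abs_of_nonneg (hf0 n)]; exact hf1 n
  have hfB : SrB f := ⟨1, hfa⟩
  have hlam : 0 ≤ lam := (abs_nonneg _).trans (hlip 0)
  obtain ⟨T, hT1, hT0⟩ := ((hHM.rev δ hδ).and (eventually_gt_atTop 0)).exists
  have hT0' : (0:ℝ) < T := by exact_mod_cast hT0
  have ht2 : Tendsto (fun M : ℕ => δ * (M:ℝ)) atTop atTop :=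
    tendsto_natCast_atTop_atTop.const_mul_atTop hδ
  have hB0 : 0 ≤ B := (abs_nonneg _).trans (hB 0)
  filter_upwards [ht2.eventually_ge_atTop (2 * (ℓ * T) * (B * 1)), hHM 1 one_pos] with M hM hM1
  set X : ℕ → ℝ := fun t => srMean 𝒰 (fun c : ℕ => ∑ b ∈ Finset.range M,
          Ψ ((b:ℤ) - c - t) * f (ℓ * c + m * b)) with hX
  set X0 := srMean 𝒰 (fun c : ℕ => ∑ b ∈ Finset.range M, Ψ ((b:ℤ) - c) * f (ℓ * c + m * b)) with hX0
  have hMn : (0:ℝ) ≤ M := Nat.cast_nonneg M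
  have h1 : ∀ t ∈ Finset.range T, X t ≤ X0 + (2 * ℓ * (m + ℓ) * lam + δ) * M := by
    intro t ht
    set u := t % (m + ℓ) with hu
    set s := t / (m + ℓ) with hs
    have hts : (t:ℤ) = u + (m + ℓ) * s := by
      have := Nat.mod_add_div t (m + ℓ)
      have h2 : ((t % (m + ℓ) + (m + ℓ) * (t / (m + ℓ)) : ℕ) : ℤ) = t := by rw [this]
      push_cast at h2
      rw [hu, hs]; push_cast; linarith
    have hul : u ≤ m + ℓ := (Nat.mod_lt _ (by omega)).le
    have hsT : s ≤ T := (Nat.div_le_self _ _).trans (Finset.mem_range.mp ht).le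
    have h3 := sr_shift_s 𝒰 h𝒰 m ℓ hB hfa M s u
    have h4 := (abs_le.mp h3).1
    have h5 : 2 * (ℓ * (s:ℝ)) * (B * 1) ≤ 2 * (ℓ * T) * (B * 1) := by gcongr
    simp only [hX, hX0]
    rw [hts]
    have h6 : srMean 𝒰 (fun c : ℕ => ∑ b ∈ Finset.range M,
        Ψ ((b:ℤ) - c - u) * f (ℓ * c + m * b))
        ≤ srMean 𝒰 (fun c : ℕ => ∑ b ∈ Finset.range M, Ψ ((b:ℤ) - c) * f (ℓ * c + m * b))
          + 2 * ℓ * (m + ℓ) * lam * M := by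
      have hb0 := sr_bddX m ℓ hB hfB M 0
      simp only [sub_zero] at hb0
      rw [← srMean_shift 𝒰 h𝒰 hb0 u]
      have hc : srMean 𝒰 (fun _ => 2 * ℓ * (m + ℓ) * lam * (M:ℝ)) = 2 * ℓ * (m + ℓ) * lam * M :=
        srMean_const 𝒰 h𝒰 _
      rw [← hc, ← srMean_add 𝒰 (hb0.comp (fun c => c + u)) (SrB.const _)]
      refine srMean_mono 𝒰 (sr_bddX m ℓ hB hfB M u) ((hb0.comp (fun c => c + u)).add (SrB.const _))
        fun c => ?_
      have h7 : ∀ b ∈ Finset.range M, Ψ ((b:ℤ) - c - u) * f (ℓ * c + m * b)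
          ≤ Ψ ((b:ℤ) - (c + u : ℕ)) * f (ℓ * (c + u) + m * b)
            + ℓ * (m + ℓ) * lam * Ψ (b + (- c - u)) := by
        intro b _
        have h8 := sr_lip 𝒰 h𝒰 hlip (ℓ * c + m * b) (ℓ * u)
        have e1 : (b:ℤ) - (c + u : ℕ) = (b:ℤ) - c - u := by push_cast; ring
        have e2 : (b:ℤ) + (- c - u) = (b:ℤ) - c - u := by ring
        have e3 : ℓ * (c + u) + m * b = ℓ * c + m * b + ℓ * u := by ring
        rw [e1, e2, e3]
        have h9 : ((ℓ * u : ℕ) : ℝ) * lam ≤ ℓ * (m + ℓ) * lam := by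
          push_cast
          have : (u:ℝ) ≤ m + ℓ := by exact_mod_cast hul
          gcongr
        have h10 : f (ℓ * c + m * b) ≤ f (ℓ * c + m * b + ℓ * u) + ℓ * (m + ℓ) * lam := by linarith
        have := mul_le_mul_of_nonneg_left h10 (hΨ ((b:ℤ) - c - u))
        linarith
      refine (Finset.sum_le_sum h7).trans ?_
      rw [Finset.sum_add_distrib, ← Finset.mul_sum]
      have h11 := (abs_le.mp (hM1 (- c - u))).2
      have h12 : ∑ b ∈ Finset.range M, Ψ (b + (- c - u)) ≤ 2 * M := by linarith
      have h13 := mul_le_mul_of_nonneg_left h12 (by positivity : (0:ℝ) ≤ ℓ * (m + ℓ) * lam)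
      linarith
    linarith
  have h2 := Finset.sum_le_sum h1
  rw [Finset.sum_const, Finset.card_range, nsmul_eq_mul] at h2
  set φ := srMean 𝒰 (fun c => f (ℓ * c)) with hφ
  have h3 : T * ((1 - δ) * (φ - ℓ * lam)) * M ≤ ∑ t ∈ Finset.range T, X t := by
    simp only [hX]
    rw [← srMean_sum 𝒰 _ fun s _ => sr_bddX m ℓ hB hfB M _]
    have hgb : SrB (fun c : ℕ => ∑ b ∈ Finset.range M, f (ℓ * c + m * b)) :=
      SrB.sum _ fun b _ => hfB.comp (fun c => ℓ * c + m * b)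
    have h4 : M * (φ - ℓ * lam) ≤ srMean 𝒰 (fun c : ℕ => ∑ b ∈ Finset.range M, f (ℓ * c + m * b)) := by
      rw [srMean_sum 𝒰 _ fun b _ => hfB.comp (fun c => ℓ * c + m * b)]
      have : ∀ b ∈ Finset.range M, φ - ℓ * lam ≤ srMean 𝒰 (fun c => f (ℓ * c + m * b)) := by
        intro b _
        have hfl := hfB.comp (fun c => ℓ * c)
        rw [hφ, ← srMean_shift 𝒰 h𝒰 hfl (m * b / ℓ)]
        have hc : srMean 𝒰 (fun _ => ℓ * lam) = ℓ * lam := srMean_const 𝒰 h𝒰 _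
        rw [← hc, ← srMean_sub 𝒰 (hfl.comp (fun c => c + m * b / ℓ)) (SrB.const _)]
        refine srMean_mono 𝒰 ((hfl.comp (fun c => c + m * b / ℓ)).sub (SrB.const _))
          (hfB.comp (fun c => ℓ * c + m * b)) fun c => ?_
        have h5 := sr_lip 𝒰 h𝒰 hlip (ℓ * (c + m * b / ℓ)) (m * b % ℓ)
        have h6 : ℓ * (c + m * b / ℓ) + m * b % ℓ = ℓ * c + m * b := by
          rw [mul_add, add_assoc, Nat.div_add_mod]
        rw [h6] at h5
        have h7 : ((m * b % ℓ : ℕ) : ℝ) * lam ≤ ℓ * lam := by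
          have : ((m * b % ℓ : ℕ) : ℝ) ≤ ℓ := by exact_mod_cast (Nat.mod_lt _ hℓ).le
          gcongr
        linarith
      have h8 := Finset.card_nsmul_le_sum _ _ _ this
      simpa using h8
    have h5 := mul_le_mul_of_nonneg_left h4
      (mul_nonneg hT0'.le (by linarith) : (0:ℝ) ≤ T * (1 - δ))
    have e5 : T * ((1 - δ) * (φ - ℓ * lam)) * M = T * (1 - δ) * (M * (φ - ℓ * lam)) := by ring
    rw [e5]
    refine h5.trans ?_
    rw [← srMean_mulc 𝒰 hgb]
    refine srMean_mono 𝒰 ((SrB.const _).mul hgb) (SrB.sum _ fun s _ => sr_bddX m ℓ hB hfB M _)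
      fun c => ?_
    rw [Finset.sum_comm, Finset.mul_sum]
    refine Finset.sum_le_sum fun b _ => ?_
    rw [← Finset.sum_mul]
    refine mul_le_mul_of_nonneg_right ?_ (hf0 _)
    have h5 := (abs_le.mp (hT1 ((b:ℤ) - c))).1
    linarith
  have h8 : T * (((1 - δ) * (φ - ℓ * lam) - 2 * ℓ * (m + ℓ) * lam - δ) * M) ≤ T * X0 := by
    nlinarith
  exact le_of_mul_le_mul_left h8 hT0'

end ShiftTrick

lemma SrRep.bound {g : ℤ → ℝ} {ι : Type} [Fintype ι] {a : ι → ℝ} {z : ι → ℂ} (h : SrRep g ι a z)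
    (x : ℤ) : |g x| ≤ ∑ s, a s := by
  rw [← Real.norm_eq_abs, ← Complex.norm_real, h.eq x]
  refine (norm_sum_le _ _).trans (Finset.sum_le_sum fun s _ => ?_)
  rw [norm_mul, norm_zpow, h.z1, one_zpow, mul_one, Complex.norm_real, Real.norm_eq_abs,
    abs_of_nonneg (h.a0 s)]

section DOp

lemma sr_pow_sub (l : ℂ) (hl : ‖l‖ = 1) (m b c : ℕ) :
    ‖l ^ (m * b) - l ^ (m * c)‖ ≤ m * ‖l ^ ((b:ℤ) - c) - 1‖ := by
  have hl0 : l ≠ 0 := by intro h; simp [h] at hl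
  have h1 : ∀ w : ℂ, ‖w‖ = 1 → ‖w ^ m - 1‖ ≤ m * ‖w - 1‖ := by
    intro w hw
    rw [← geom_sum_mul, norm_mul]
    refine mul_le_mul_of_nonneg_right ?_ (norm_nonneg _)
    refine (norm_sum_le _ _).trans ?_
    simp [hw]
  have h2 : l ^ (m * b) - l ^ (m * c) = l ^ (m * c) * ((l ^ ((b:ℤ) - c)) ^ m - 1) := by
    have : (l ^ ((b:ℤ) - c)) ^ m * l ^ (m * c) = l ^ (m * b) := by
      rw [mul_comm m c, pow_mul l c m, ← mul_pow, zpow_sub₀ hl0]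
      simp only [zpow_natCast]
      rw [div_mul_cancel₀ _ (pow_ne_zero _ hl0), mul_comm m b, pow_mul]
    rw [← this]; ring
  rw [h2, norm_mul, norm_pow, hl, one_pow, one_mul]
  exact h1 _ (by rw [norm_zpow, hl, one_zpow])

/-- the localized operator -/
noncomputable def srD (m ℓ M : ℕ) (Ψ : ℤ → ℝ) (φ : ℕ → ℝ) (p : ℕ → ℝ) (g : ℕ → ℂ) (c : ℕ) : ℂ :=
  ∑ b ∈ Finset.range M, (((φ b - p c) * Ψ ((b:ℤ) - c) : ℝ) : ℂ) * g (ℓ * c + m * b)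

lemma srD_add (m ℓ M : ℕ)
    (Ψ : ℤ → ℝ) (φ : ℕ → ℝ) (p : ℕ → ℝ) (g h : ℕ → ℂ) (c : ℕ) :
    srD m ℓ M Ψ φ p (fun x => g x + h x) c = srD m ℓ M Ψ φ p g c + srD m ℓ M Ψ φ p h c := by
  simp only [srD, mul_add, Finset.sum_add_distrib]

lemma srD_sum (m ℓ M : ℕ)
    (Ψ : ℤ → ℝ) (φ : ℕ → ℝ) (p : ℕ → ℝ) {n : ℕ} (G : Fin n → ℕ → ℂ) (c : ℕ) :
    srD m ℓ M Ψ φ p (fun x => ∑ j, G j x) c = ∑ j, srD m ℓ M Ψ φ p (G j) c := by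
  simp only [srD, Finset.mul_sum]
  rw [Finset.sum_comm]

lemma srD_coef {Ψ : ℤ → ℝ} {B : ℝ} (hB : ∀ x, |Ψ x| ≤ B) (hΨ : ∀ x, 0 ≤ Ψ x)
  {φ p : ℕ → ℝ} (hφ0 : ∀ b, 0 ≤ φ b) (hφ1 : ∀ b, φ b ≤ 1) (hp0 : ∀ c, 0 ≤ p c) (hp2 : ∀ c, p c ≤ 2)
    (b c : ℕ) : ‖(((φ b - p c) * Ψ ((b:ℤ) - c) : ℝ) : ℂ)‖ ≤ 2 * Ψ ((b:ℤ) - c) := by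
  rw [Complex.norm_real, norm_mul, Real.norm_eq_abs, Real.norm_eq_abs, abs_of_nonneg (hΨ _)]
  refine mul_le_mul_of_nonneg_right ?_ (hΨ _)
  rw [abs_le]
  constructor <;> linarith [hφ0 b, hφ1 b, hp0 c, hp2 c]

lemma srD_bdd (m ℓ M : ℕ) {Ψ : ℤ → ℝ} {B : ℝ} (hB : ∀ x, |Ψ x| ≤ B) (hΨ : ∀ x, 0 ≤ Ψ x)
  {φ p : ℕ → ℝ} (hφ0 : ∀ b, 0 ≤ φ b) (hφ1 : ∀ b, φ b ≤ 1) (hp0 : ∀ c, 0 ≤ p c) (hp2 : ∀ c, p c ≤ 2)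
    {g : ℕ → ℂ} (hg : SrB g) : SrB (srD m ℓ M Ψ φ p g) := by
  refine SrB.sum _ fun b _ => SrB.mul ⟨2 * B, fun c => ?_⟩ (hg.comp (fun c => ℓ * c + m * b))
  refine (srD_coef hB hΨ hφ0 hφ1 hp0 hp2 b c).trans ?_
  have := (le_abs_self _).trans (hB ((b:ℤ) - c))
  linarith

lemma srD_tail (𝒰 : Ultrafilter ℕ) (m ℓ M : ℕ) {Ψ : ℤ → ℝ} {B : ℝ} (hB : ∀ x, |Ψ x| ≤ B) (hΨ : ∀ x, 0 ≤ Ψ x)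
  {φ p : ℕ → ℝ} (hφ0 : ∀ b, 0 ≤ φ b) (hφ1 : ∀ b, φ b ≤ 1) (hp0 : ∀ c, 0 ≤ p c) (hp2 : ∀ c, p c ≤ 2)
    {g : ℕ → ℂ} (hg : SrB g) :
    srMean 𝒰 (fun c => ‖srD m ℓ M Ψ φ p g c‖) ≤
    2 * srMean 𝒰 (fun c : ℕ => ∑ b ∈ Finset.range M, Ψ ((b:ℤ) - c) * ‖g (ℓ * c + m * b)‖) := by
  have h0 := sr_bddX m ℓ hB hg.norm M 0
  simp only [sub_zero] at h0
  rw [← srMean_mulc 𝒰 h0]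
  refine srMean_mono 𝒰 (srD_bdd m ℓ M hB hΨ hφ0 hφ1 hp0 hp2 hg).norm ((SrB.const _).mul h0)
    fun c => ?_
  unfold srD
  refine (norm_sum_le _ _).trans ?_
  rw [Finset.mul_sum]
  refine Finset.sum_le_sum fun b _ => ?_
  rw [norm_mul, ← mul_assoc]
  exact mul_le_mul_of_nonneg_right (srD_coef hB hΨ hφ0 hφ1 hp0 hp2 b c) (norm_nonneg _)

lemma srD_fu (𝒰 : Ultrafilter ℕ) (m ℓ M : ℕ) {Ψ : ℤ → ℝ} {B : ℝ} (hB : ∀ x, |Ψ x| ≤ B) (hΨ : ∀ x, 0 ≤ Ψ x)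
  {φ p : ℕ → ℝ} (hφ0 : ∀ b, 0 ≤ φ b) (hφ1 : ∀ b, φ b ≤ 1) (hp0 : ∀ c, 0 ≤ p c) (hp2 : ∀ c, p c ≤ 2)
    (h𝒰 : (𝒰 : Filter ℕ) ≤ atTop) (hℓ : 0 < ℓ) {ι : Type} [Fintype ι] {a : ι → ℝ} {z : ι → ℂ}
    (hrep : SrRep Ψ ι a z) {g : ℕ → ℂ} (hg : SrB g) {τ : ℝ}
    (hu : ∀ ψ : ℕ → ℂ, (∀ b, ‖ψ b‖ ≤ 1) → srMean (𝒰.map (fun n => ℓ * n))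
      (fun x => ‖∑ b ∈ Finset.range M, ψ b * g (x + m * b)‖) ≤ τ * M) :
    srMean 𝒰 (fun c => ‖srD m ℓ M Ψ φ p g c‖) ≤ 3 * (∑ s, a s) * ℓ * τ * M := by
  set F : (ℕ → ℂ) → ℕ → ℝ := fun ψ x => ‖∑ b ∈ Finset.range M, ψ b * g (x + m * b)‖ with hF
  have hFB : ∀ ψ, SrB (F ψ) := fun ψ =>
    SrB.norm (SrB.sum _ fun b _ => (SrB.const (ψ b)).mul (hg.comp (fun x => x + m * b)))
  have hFm : ∀ ψ : ℕ → ℂ, (∀ b, ‖ψ b‖ ≤ 1) → srMean 𝒰 (fun c => F ψ (ℓ * c)) ≤ ℓ * (τ * M) := by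
    intro ψ hψ
    have := sr_mean_l 𝒰 h𝒰 ℓ hℓ (hFB ψ) (fun n => norm_nonneg _) 0
    simp only [add_zero] at this
    exact this.trans (mul_le_mul_of_nonneg_left (hu ψ hψ) (Nat.cast_nonneg _))
  set ψ1 : ι → ℕ → ℂ := fun s b => (φ b : ℂ) * z s ^ b with hψ1
  set ψ2 : ι → ℕ → ℂ := fun s b => z s ^ b with hψ2
  have h1 : ∀ s b, ‖ψ1 s b‖ ≤ 1 := fun s b => by
    simp only [hψ1, norm_mul, norm_pow, hrep.z1, one_pow, mul_one, Complex.norm_real,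
      Real.norm_eq_abs, abs_of_nonneg (hφ0 b)]
    exact hφ1 b
  have h2 : ∀ s b, ‖ψ2 s b‖ ≤ 1 := fun s b => by simp [hψ2, hrep.z1]
  have hb1 : ∀ s, SrB (fun c => a s * (F (ψ1 s) (ℓ * c) + 2 * F (ψ2 s) (ℓ * c))) := fun s =>
    (SrB.const _).mul (((hFB _).comp (fun c => ℓ * c)).add
      ((SrB.const (2:ℝ)).mul ((hFB _).comp (fun c => ℓ * c))))
  have key : srMean 𝒰 (fun c => ‖srD m ℓ M Ψ φ p g c‖) ≤
      srMean 𝒰 (fun c => ∑ s, a s * (F (ψ1 s) (ℓ * c) + 2 * F (ψ2 s) (ℓ * c))) := by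
    refine srMean_mono 𝒰 (srD_bdd m ℓ M hB hΨ hφ0 hφ1 hp0 hp2 hg).norm
      (SrB.sum _ fun s _ => hb1 s) fun c => ?_
    have e : srD m ℓ M Ψ φ p g c = ∑ s, (a s : ℂ) * z s ^ (-(c:ℤ)) *
        ((∑ b ∈ Finset.range M, ψ1 s b * g (ℓ * c + m * b))
          - p c * ∑ b ∈ Finset.range M, ψ2 s b * g (ℓ * c + m * b)) := by
      unfold srD
      have e1 : ∀ b ∈ Finset.range M, (((φ b - p c) * Ψ ((b:ℤ) - c) : ℝ) : ℂ) * g (ℓ * c + m * b)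
          = ∑ s, (a s : ℂ) * z s ^ (-(c:ℤ)) *
            ((ψ1 s b * g (ℓ * c + m * b)) - p c * (ψ2 s b * g (ℓ * c + m * b))) := by
        intro b _
        push_cast
        rw [hrep.eq, Finset.mul_sum, Finset.sum_mul]
        refine Finset.sum_congr rfl fun s _ => ?_
        have hz0 : z s ≠ 0 := by intro h; have := hrep.z1 s; simp [h] at this
        rw [sub_eq_add_neg (b:ℤ) (c:ℤ), zpow_add₀ hz0, zpow_natCast]
        simp only [hψ1, hψ2]
        ring
      rw [Finset.sum_congr rfl e1, Finset.sum_comm]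
      refine Finset.sum_congr rfl fun s _ => ?_
      rw [← Finset.mul_sum, Finset.sum_sub_distrib, ← Finset.mul_sum]
    rw [e]
    refine (norm_sum_le _ _).trans (Finset.sum_le_sum fun s _ => ?_)
    rw [norm_mul, norm_mul, norm_zpow, hrep.z1, one_zpow, mul_one, Complex.norm_real,
      Real.norm_eq_abs, abs_of_nonneg (hrep.a0 s)]
    refine mul_le_mul_of_nonneg_left ((norm_sub_le _ _).trans ?_) (hrep.a0 s)
    rw [norm_mul, Complex.norm_real, Real.norm_eq_abs, abs_of_nonneg (hp0 c)]
    exact add_le_add le_rfl (mul_le_mul_of_nonneg_right (hp2 c) (norm_nonneg _))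
  refine key.trans ?_
  rw [srMean_sum 𝒰 _ fun s _ => hb1 s]
  have e3 : 3 * (∑ s, a s) * ℓ * τ * M = ∑ s, a s * (ℓ * (τ * M) + 2 * (ℓ * (τ * M))) := by
    rw [← Finset.sum_mul]; ring
  rw [e3]
  refine Finset.sum_le_sum fun s _ => ?_
  rw [srMean_mulc 𝒰 (((hFB _).comp (fun c => ℓ * c)).add
      ((SrB.const (2:ℝ)).mul ((hFB _).comp (fun c => ℓ * c)))),
    srMean_add 𝒰 ((hFB _).comp (fun c => ℓ * c)) ((SrB.const (2:ℝ)).mul ((hFB _).comp (fun c => ℓ * c))),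
    srMean_mulc 𝒰 ((hFB _).comp (fun c => ℓ * c))]
  refine mul_le_mul_of_nonneg_left ?_ (hrep.a0 s)
  have := hFm _ (h1 s)
  have := hFm _ (h2 s)
  linarith

lemma srD_G (𝒰 : Ultrafilter ℕ) (m ℓ M : ℕ) {Ψ : ℤ → ℝ} {B : ℝ} (hB : ∀ x, |Ψ x| ≤ B) (hΨ : ∀ x, 0 ≤ Ψ x)
  {φ p : ℕ → ℝ} (hφ0 : ∀ b, 0 ≤ φ b) (hφ1 : ∀ b, φ b ≤ 1) (hp0 : ∀ c, 0 ≤ p c) (hp2 : ∀ c, p c ≤ 2)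
    (h𝒰 : (𝒰 : Filter ℕ) ≤ atTop) (hℓ : 0 < ℓ)
    (hp : ∀ c, p c * M = ∑ b ∈ Finset.range M, φ b * Ψ ((b:ℤ) - c)) {δ : ℝ}
    (hM : ∀ c : ℕ, |(∑ b ∈ Finset.range M, Ψ ((b:ℤ) - c)) - M| ≤ δ * M)
    {l : ℂ} (hl : ‖l‖ = 1)
    (hlΨ : ∀ c : ℕ, ∑ b ∈ Finset.range M, Ψ ((b:ℤ) - c) * ‖l ^ ((b:ℤ) - c) - 1‖ ≤ δ * M)
    {g : ℕ → ℂ} (hg : SrB g) {τ C : ℝ} (hδ : 0 ≤ δ)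
    (hC : srMean (𝒰.map (fun n => ℓ * n)) (fun x => ‖g x‖) ≤ C)
    (hτ : ∀ b, srMean (𝒰.map (fun n => ℓ * n)) (fun x => ‖g (x + b) - l ^ b * g x‖) ≤ τ) :
    srMean 𝒰 (fun c => ‖srD m ℓ M Ψ φ p g c‖) ≤ (2 * B * ℓ * τ + 2 * (m + 1) * δ * ℓ * C) * M := by
  have hB0 : 0 ≤ B := (abs_nonneg _).trans (hB 0)
  set H : ℕ → ℕ → ℝ := fun b x => ‖g (x + b) - l ^ b * g x‖ with hH
  have hHB : ∀ b, SrB (H b) := fun b =>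
    SrB.norm ((hg.comp (fun x => x + b)).sub ((SrB.const (l ^ b)).mul hg))
  have hHB' : ∀ b, SrB (fun c => H b (ℓ * c)) := fun b => (hHB b).comp _
  have hgB : SrB (fun c => ‖g (ℓ * c)‖) := hg.norm.comp (fun c => ℓ * c)
  have hHm : ∀ b, srMean 𝒰 (fun c => H b (ℓ * c)) ≤ ℓ * τ := by
    intro b
    have := sr_mean_l 𝒰 h𝒰 ℓ hℓ (hHB b) (fun n => norm_nonneg _) 0
    simp only [add_zero] at this
    exact this.trans (mul_le_mul_of_nonneg_left (hτ b) (Nat.cast_nonneg _))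
  have hgm : srMean 𝒰 (fun c => ‖g (ℓ * c)‖) ≤ ℓ * C := by
    have := sr_mean_l 𝒰 h𝒰 ℓ hℓ hg.norm (fun n => norm_nonneg _) 0
    simp only [add_zero] at this
    exact this.trans (mul_le_mul_of_nonneg_left hC (Nat.cast_nonneg _))
  have hs1 : SrB (fun c => ∑ b ∈ Finset.range M, 2 * B * H (m * b) (ℓ * c)) :=
    SrB.sum _ fun b _ => (SrB.const (2 * B)).mul (hHB' (m * b))
  have hs2 : SrB (fun c => (2 * (m + 1) * δ * M) * ‖g (ℓ * c)‖) := (SrB.const _).mul hgB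
  have key : srMean 𝒰 (fun c => ‖srD m ℓ M Ψ φ p g c‖) ≤
      srMean 𝒰 (fun c => (∑ b ∈ Finset.range M, 2 * B * H (m * b) (ℓ * c))
        + (2 * (m + 1) * δ * M) * ‖g (ℓ * c)‖) := by
    refine srMean_mono 𝒰 (srD_bdd m ℓ M hB hΨ hφ0 hφ1 hp0 hp2 hg).norm (hs1.add hs2) fun c => ?_
    set k : ℕ → ℂ := fun b => (((φ b - p c) * Ψ ((b:ℤ) - c) : ℝ) : ℂ) with hk
    have hkn : ∀ b, ‖k b‖ ≤ 2 * Ψ ((b:ℤ) - c) := fun b => srD_coef hB hΨ hφ0 hφ1 hp0 hp2 b c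
    have e : srD m ℓ M Ψ φ p g c =
        (∑ b ∈ Finset.range M, k b * (g (ℓ * c + m * b) - l ^ (m * b) * g (ℓ * c)))
        + (∑ b ∈ Finset.range M, k b * (l ^ (m * b) - l ^ (m * c))) * g (ℓ * c)
        + (∑ b ∈ Finset.range M, k b) * l ^ (m * c) * g (ℓ * c) := by
      simp only [srD, hk, Finset.sum_mul]
      rw [← Finset.sum_add_distrib, ← Finset.sum_add_distrib]
      refine Finset.sum_congr rfl fun b _ => ?_
      ring
    have h1 : ‖∑ b ∈ Finset.range M, k b * (g (ℓ * c + m * b) - l ^ (m * b) * g (ℓ * c))‖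
        ≤ ∑ b ∈ Finset.range M, 2 * B * H (m * b) (ℓ * c) := by
      refine (norm_sum_le _ _).trans (Finset.sum_le_sum fun b _ => ?_)
      rw [norm_mul]
      refine mul_le_mul_of_nonneg_right ((hkn b).trans ?_) (norm_nonneg _)
      have := (le_abs_self _).trans (hB ((b:ℤ) - c))
      linarith
    have h2 : ‖∑ b ∈ Finset.range M, k b * (l ^ (m * b) - l ^ (m * c))‖ ≤ 2 * m * δ * M := by
      refine (norm_sum_le _ _).trans ?_
      have h3 := mul_le_mul_of_nonneg_left (hlΨ c) (by positivity : (0:ℝ) ≤ 2 * m)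
      refine le_trans ?_ (h3.trans (le_of_eq (by ring)))
      rw [Finset.mul_sum]
      refine Finset.sum_le_sum fun b _ => ?_
      rw [norm_mul]
      have h4 := mul_le_mul (hkn b) (sr_pow_sub l hl m b c) (norm_nonneg _)
        (by linarith [hΨ ((b:ℤ) - c)])
      linarith
    have h3 : ‖∑ b ∈ Finset.range M, k b‖ ≤ 2 * δ * M := by
      have e1 : ∑ b ∈ Finset.range M, k b
          = ((p c * (M - ∑ b ∈ Finset.range M, Ψ ((b:ℤ) - c)) : ℝ) : ℂ) := by
        simp only [hk]
        rw [← Complex.ofReal_sum]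
        congr 1
        rw [mul_sub, hp c, Finset.mul_sum, ← Finset.sum_sub_distrib]
        refine Finset.sum_congr rfl fun b _ => ?_
        ring
      rw [e1, Complex.norm_real, norm_mul, Real.norm_eq_abs, Real.norm_eq_abs,
        abs_of_nonneg (hp0 c), abs_sub_comm]
      have := mul_le_mul (hp2 c) (hM c) (abs_nonneg _) (by norm_num)
      linarith
    rw [e]
    refine (norm_add₃_le).trans ?_
    rw [norm_mul, norm_mul, norm_mul, norm_pow, hl, one_pow, mul_one]
    have h4 := mul_le_mul_of_nonneg_right h2 (norm_nonneg (g (ℓ * c)))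
    have h5 := mul_le_mul_of_nonneg_right h3 (norm_nonneg (g (ℓ * c)))
    linarith
  refine key.trans ?_
  rw [srMean_add 𝒰 hs1 hs2, srMean_mulc 𝒰 hgB,
    srMean_sum 𝒰 _ fun b _ => (SrB.const (2 * B)).mul (hHB' (m * b))]
  have h6 : ∑ b ∈ Finset.range M, srMean 𝒰 (fun c => 2 * B * H (m * b) (ℓ * c))
      ≤ M * (2 * B * (ℓ * τ)) := by
    refine (Finset.sum_le_card_nsmul _ _ (2 * B * (ℓ * τ)) fun b _ => ?_).trans (by simp)
    rw [srMean_mulc 𝒰 (hHB' (m * b))]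
    exact mul_le_mul_of_nonneg_left (hHm _) (by positivity)
  have h7 := mul_le_mul_of_nonneg_left hgm (by positivity : (0:ℝ) ≤ 2 * (m + 1) * δ * M)
  linarith

end DOp

open scoped Classical in
lemma sr_D_bound (𝒰 : Ultrafilter ℕ) (h𝒰 : (𝒰 : Filter ℕ) ≤ atTop) (m ℓ : ℕ) (hm : 0 < m) (hℓ : 0 < ℓ)
    (f : ℕ → ℝ) (hf : SrB f) (η : ℝ) (hη : 0 < η) :
    ∃ (Ψ : ℤ → ℝ) (ι : Type) (_ : Fintype ι) (a : ι → ℝ) (z : ι → ℂ),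
      SrRep Ψ ι a z ∧ (∀ h, 0 ≤ Ψ h) ∧ (∑ s, if z s = 1 then a s else 0) = 1 ∧ SrHM Ψ 1 ∧
      ∀ᶠ M : ℕ in atTop, ∀ φ p : ℕ → ℝ, (∀ b, 0 ≤ φ b) → (∀ b, φ b ≤ 1) →
        (∀ c : ℕ, p c * M = ∑ b ∈ Finset.range M, φ b * Ψ ((b:ℤ) - c)) →
        srMean 𝒰 (fun c => ‖srD m ℓ M Ψ φ p (fun x => (f x : ℂ)) c‖) ≤ η * M := by
  have hfC : SrB (fun x => (f x : ℂ)) := by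
    obtain ⟨C, hC⟩ := hf; exact ⟨C, fun n => by rw [Complex.norm_real]; exact hC n⟩
  have hVt := sr_atTop_map 𝒰 ℓ hℓ h𝒰
  set 𝒱 := 𝒰.map (fun n => ℓ * n) with h𝒱
  have hmR : (0:ℝ) < m := by exact_mod_cast hm
  have hℓR : (0:ℝ) < ℓ := by exact_mod_cast hℓ
  set τ : ℝ := η / (8 * (2 * (m + ℓ) * ℓ + 1)) with hτd
  have hτ : 0 < τ := by positivity
  obtain ⟨n, l, C, hl, hC0, hst⟩ := sr_structure 𝒱 hVt (fun x => (f x : ℂ)) hfC m hm τ hτ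
  set δ : ℝ := min 1 (η / (8 * (n + 1) * (2 * (m + 1) * ℓ * (C + 1)))) with hδd
  have hδ : 0 < δ := by positivity
  have hδ1 : δ ≤ 1 := min_le_left _ _
  have hδ2 : δ * (8 * (n + 1) * (2 * (m + 1) * ℓ * (C + 1))) ≤ η := by
    have := min_le_right 1 (η / (8 * (n + 1) * (2 * (m + 1) * ℓ * (C + 1))))
    rwa [← hδd, le_div_iff₀ (by positivity)] at this
  obtain ⟨Ψ, ι, hι, a, z, hrep, hΨ, hsum, hHM, hker⟩ := sr_kernel l hl δ hδ
  refine ⟨Ψ, ι, hι, a, z, hrep, hΨ, hsum, hHM, ?_⟩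
  set B := ∑ s, a s with hBd
  have hB := hrep.bound
  have hB0 : 0 ≤ B := (abs_nonneg _).trans (hB 0)
  set τ' : ℝ := η / (8 * ((2 * n + 3) * (B + 1) * ℓ)) with hτ'd
  have hτ' : 0 < τ' := by positivity
  obtain ⟨G, g, fu, hG, hg, hfu, hdec, hGC, hGl, hgτ, hfuτ⟩ := hst τ' hτ'
  have hup := sr_upper 𝒰 h𝒰 m ℓ hm hℓ hB hΨ hHM hg.norm (fun n => norm_nonneg _) τ hτ
  filter_upwards [hup, hfuτ, hHM δ hδ, (eventually_all.mpr hker), eventually_gt_atTop 0]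
    with M h1 h2 h3 h4 hM0 φ p hφ0 hφ1 hp
  have hM0' : (0:ℝ) < M := by exact_mod_cast hM0
  have hM : ∀ c : ℕ, |(∑ b ∈ Finset.range M, Ψ ((b:ℤ) - c)) - M| ≤ δ * M := by
    intro c; have := h3 (-c); simpa [sub_eq_add_neg] using this
  have hp0 : ∀ c, 0 ≤ p c := by
    intro c
    have : 0 ≤ p c * M := by
      rw [hp c]; exact Finset.sum_nonneg fun b _ => mul_nonneg (hφ0 b) (hΨ _)
    exact nonneg_of_mul_nonneg_left this hM0'
  have hp2 : ∀ c, p c ≤ 2 := by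
    intro c
    have h5 : p c * M ≤ ∑ b ∈ Finset.range M, Ψ ((b:ℤ) - c) := by
      rw [hp c]
      exact Finset.sum_le_sum fun b _ => mul_le_of_le_one_left (hΨ _) (hφ1 b)
    have h6 := (abs_le.mp (hM c)).2
    have h7 : δ * M ≤ 1 * M := by gcongr
    exact le_of_mul_le_mul_right (by linarith : p c * M ≤ 2 * M) hM0'
  have hGD : ∀ j, srMean 𝒰 (fun c => ‖srD m ℓ M Ψ φ p (G j) c‖)
      ≤ (2 * B * ℓ * τ' + 2 * (m + 1) * δ * ℓ * C) * M := by
    intro j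
    refine srD_G 𝒰 m ℓ M hB hΨ hφ0 hφ1 hp0 hp2 h𝒰 hℓ hp hM (hl j) ?_ (hG j) hδ.le (hGC j) (hGl j)
    intro c; have := h4 j (-c); simpa [sub_eq_add_neg] using this
  have hgD := srD_tail 𝒰 m ℓ M hB hΨ hφ0 hφ1 hp0 hp2 hg
  have hfD := srD_fu 𝒰 m ℓ M hB hΨ hφ0 hφ1 hp0 hp2 h𝒰 hℓ hrep hfu h2
  have hbd : ∀ {g : ℕ → ℂ}, SrB g → SrB (srD m ℓ M Ψ φ p g) := fun hg =>
    srD_bdd m ℓ M hB hΨ hφ0 hφ1 hp0 hp2 hg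
  have hs1 : SrB (fun c => ∑ j, ‖srD m ℓ M Ψ φ p (G j) c‖) := SrB.sum _ fun j _ => (hbd (hG j)).norm
  have key : srMean 𝒰 (fun c => ‖srD m ℓ M Ψ φ p (fun x => (f x : ℂ)) c‖) ≤
      srMean 𝒰 (fun c => ((∑ j, ‖srD m ℓ M Ψ φ p (G j) c‖) + ‖srD m ℓ M Ψ φ p g c‖)
        + ‖srD m ℓ M Ψ φ p fu c‖) := by
    refine srMean_mono 𝒰 (hbd hfC).norm ((hs1.add (hbd hg).norm).add (hbd hfu).norm) fun c => ?_
    have e : srD m ℓ M Ψ φ p (fun x => (f x : ℂ)) c = (∑ j, srD m ℓ M Ψ φ p (G j) c)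
        + srD m ℓ M Ψ φ p g c + srD m ℓ M Ψ φ p fu c := by
      rw [← srD_sum, ← srD_add, ← srD_add]
      congr 1
      funext x; exact hdec x
    rw [e]
    refine norm_add₃_le.trans ?_
    gcongr
    exact norm_sum_le _ _
  rw [srMean_add 𝒰 (hs1.add (hbd hg).norm) (hbd hfu).norm, srMean_add 𝒰 hs1 (hbd hg).norm,
    srMean_sum 𝒰 _ fun j _ => (hbd (hG j)).norm] at key
  have hsG : ∑ j, srMean 𝒰 (fun c => ‖srD m ℓ M Ψ φ p (G j) c‖)
      ≤ n * ((2 * B * ℓ * τ' + 2 * (m + 1) * δ * ℓ * C) * M) := by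
    refine (Finset.sum_le_card_nsmul _ _ _ fun j _ => hGD j).trans (by simp)
  have hgD2 : srMean 𝒰 (fun c => ‖srD m ℓ M Ψ φ p g c‖) ≤ 2 * ((2 * (m + ℓ) * ℓ * τ + τ) * M) := by
    refine hgD.trans ?_
    gcongr
    refine h1.trans ?_
    gcongr
  have t1 : τ * (8 * (2 * (m + ℓ) * ℓ + 1)) = η := by rw [hτd]; field_simp
  have t2 : τ' * (8 * ((2 * n + 3) * (B + 1) * ℓ)) = η := by rw [hτ'd]; field_simp
  have c1 : 2 * (2 * (m + ℓ) * ℓ * τ + τ) = η / 4 := by linarith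
  have c2 : (n:ℝ) * (2 * B * ℓ * τ') + 3 * B * ℓ * τ' ≤ η / 8 := by
    have : (2 * n + 3) * B * ℓ * τ' ≤ (2 * n + 3) * (B + 1) * ℓ * τ' := by gcongr; linarith
    linarith
  have c3 : (n:ℝ) * (2 * (m + 1) * δ * ℓ * C) ≤ η / 8 := by
    have : (n:ℝ) * (2 * (m + 1) * δ * ℓ * C) ≤ (n + 1) * (2 * (m + 1) * δ * ℓ * (C + 1)) := by
      gcongr <;> linarith
    linarith
  have c4 : 0 < η * M := by positivity
  have c5 := mul_le_mul_of_nonneg_right c2 hM0'.le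
  have c6 := mul_le_mul_of_nonneg_right c3 hM0'.le
  have c7 : 2 * (2 * (m + ℓ) * ℓ * τ + τ) * M = η / 4 * M := by rw [c1]
  linarith

open scoped Classical ComplexConjugate in
lemma sr_pos (𝒰 : Ultrafilter ℕ) (h𝒰 : (𝒰 : Filter ℕ) ≤ atTop)
    {Ψ : ℤ → ℝ} {ι : Type} [Fintype ι] {a : ι → ℝ} {z : ι → ℂ} (hrep : SrRep Ψ ι a z)
    (hΨ : ∀ x, 0 ≤ Ψ x) (hsum : (∑ s, if z s = 1 then a s else 0) = 1)
    (φ : ℕ → ℝ) (hφ0 : ∀ b, 0 ≤ φ b) (hφ1 : ∀ b, φ b ≤ 1) (η : ℝ) (hη : 0 < η) :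
    ∀ᶠ M : ℕ in 𝒰, ∀ u : ℕ → ℝ, (∀ c, 0 ≤ u c) → (∀ c, u c ≤ φ c) →
      ((srMean 𝒰 u) ^ 2 - η) * M ≤
        srMean 𝒰 (fun c : ℕ => u c * ∑ b ∈ Finset.range M, φ b * Ψ ((b:ℤ) - c)) := by
  have hB := hrep.bound
  set B := ∑ s, a s with hBd
  have hB0 : 0 ≤ B := (abs_nonneg _).trans (hB 0)
  have hz0 : ∀ s, z s ≠ 0 := fun s h => by have := hrep.z1 s; simp [h] at this
  -- twisted bounded sequences
  have htw : ∀ (v : ℕ → ℝ), (∀ c, 0 ≤ v c) → (∀ c, v c ≤ 1) → ∀ s, SrB (fun b => (v b : ℂ) * z s ^ b) := by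
    intro v h0 h1 s
    refine ⟨1, fun b => ?_⟩
    simpa [hrep.z1, abs_of_nonneg (h0 b)] using h1 b
  have hφb := htw φ hφ0 hφ1
  set ξ : ι → ℂ := fun s => srMean 𝒰 (fun b => (φ b : ℂ) * z s ^ b) with hξ
  set η' := η / (B + 1) with hη'd
  have hη' : 0 < η' := by positivity
  have hη'B : η' * B ≤ η := by
    rw [hη'd, div_mul_eq_mul_div, div_le_iff₀ (by positivity)]; nlinarith
  have hev : ∀ᶠ M : ℕ in 𝒰, ∀ s, ‖srAvg (fun b => (φ b : ℂ) * z s ^ b) M - ξ s‖ < η' := by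
    refine eventually_all.mpr fun s => ?_
    have := Metric.tendsto_nhds.mp (srMean_tendsto 𝒰 (hφb s)) η' hη'
    simpa [dist_eq_norm] using this
  filter_upwards [hev, h𝒰 (eventually_gt_atTop 0)] with M hM hM0 u hu0 hu
  have hM0' : (0:ℝ) < M := by exact_mod_cast hM0
  have hu1 : ∀ c, u c ≤ 1 := fun c => (hu c).trans (hφ1 c)
  have hub := htw u hu0 hu1
  have huB : SrB u := ⟨1, fun c => by rw [Real.norm_eq_abs, abs_of_nonneg (hu0 c)]; exact hu1 c⟩
  set ω : ι → ℂ := fun s => srMean 𝒰 (fun b => (u b : ℂ) * z s ^ b) with hω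
  -- expansion of finite sums
  have hexp : ∀ (v : ℕ → ℝ) (b c : ℕ), v b * Ψ ((b:ℤ) - c)
      = (∑ s, (a s : ℂ) * z s ^ (-(c:ℤ)) * ((v b : ℂ) * z s ^ b)).re := by
    intro v b c
    have : ((v b * Ψ ((b:ℤ) - c) : ℝ) : ℂ)
        = ∑ s, (a s : ℂ) * z s ^ (-(c:ℤ)) * ((v b : ℂ) * z s ^ b) := by
      push_cast
      rw [hrep.eq, Finset.mul_sum]
      refine Finset.sum_congr rfl fun s _ => ?_
      rw [sub_eq_add_neg (b:ℤ) (c:ℤ), zpow_add₀ (hz0 s), zpow_natCast]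
      ring
    rw [← this, Complex.ofReal_re]
  have hmean : ∀ (v : ℕ → ℝ), (∀ c, 0 ≤ v c) → (∀ c, v c ≤ 1) → ∀ c : ℕ,
      srMean 𝒰 (fun b : ℕ => v b * Ψ ((b:ℤ) - c))
        = (∑ s, (a s : ℂ) * z s ^ (-(c:ℤ)) * srMean 𝒰 (fun b => (v b : ℂ) * z s ^ b)).re := by
    intro v h0 h1 c
    simp only [hexp]
    have hb : ∀ s ∈ Finset.univ, SrB (fun b : ℕ => (a s : ℂ) * z s ^ (-(c:ℤ)) * ((v b : ℂ) * z s ^ b)) :=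
      fun s _ => (SrB.const _).mul (htw v h0 h1 s)
    rw [srMean_re 𝒰 (SrB.sum _ hb), srMean_sum 𝒰 _ hb]
    congr 1
    refine Finset.sum_congr rfl fun s _ => ?_
    rw [srMean_mulcC 𝒰 (htw v h0 h1 s)]
  have hbΨ : ∀ (v : ℕ → ℝ), (∀ c, 0 ≤ v c) → (∀ c, v c ≤ 1) → ∀ c : ℕ,
      SrB (fun b : ℕ => v b * Ψ ((b:ℤ) - c)) := fun v h0 h1 c =>
    SrB.mul ⟨1, fun b => by rw [Real.norm_eq_abs, abs_of_nonneg (h0 b)]; exact h1 b⟩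
      ⟨B, fun b => by rw [Real.norm_eq_abs]; exact hB _⟩
  -- pointwise lower bound
  have hpt : ∀ c : ℕ, (∑ s, (a s : ℂ) * z s ^ (-(c:ℤ)) * ω s).re * M - η * M
      ≤ ∑ b ∈ Finset.range M, φ b * Ψ ((b:ℤ) - c) := by
    intro c
    have h1 : (∑ s, (a s : ℂ) * z s ^ (-(c:ℤ)) * ω s).re
        ≤ (∑ s, (a s : ℂ) * z s ^ (-(c:ℤ)) * ξ s).re := by
      rw [← hmean u hu0 hu1 c, ← hmean φ hφ0 hφ1 c]
      exact srMean_mono 𝒰 (hbΨ u hu0 hu1 c) (hbΨ φ hφ0 hφ1 c)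
        fun b => mul_le_mul_of_nonneg_right (hu b) (hΨ _)
    have h2 : (∑ b ∈ Finset.range M, φ b * Ψ ((b:ℤ) - c))
        = M * (∑ s, (a s : ℂ) * z s ^ (-(c:ℤ)) * srAvg (fun b => (φ b : ℂ) * z s ^ b) M).re := by
      simp only [hexp]
      rw [← Complex.re_sum, Finset.sum_comm, ← Complex.re_ofReal_mul, Finset.mul_sum]
      congr 1
      refine Finset.sum_congr rfl fun s _ => ?_
      simp only [srAvg, Complex.real_smul]
      rw [← Finset.mul_sum]
      have : (M:ℂ) ≠ 0 := by exact_mod_cast hM0.ne'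
      push_cast
      field_simp
    have h3 : (∑ s, (a s : ℂ) * z s ^ (-(c:ℤ)) * ξ s).re
        - (∑ s, (a s : ℂ) * z s ^ (-(c:ℤ)) * srAvg (fun b => (φ b : ℂ) * z s ^ b) M).re ≤ η := by
      rw [← Complex.sub_re, ← Finset.sum_sub_distrib]
      refine (Complex.re_le_norm _).trans ((norm_sum_le _ _).trans (le_trans ?_ hη'B))
      rw [hBd, Finset.mul_sum]
      refine Finset.sum_le_sum fun s _ => ?_
      rw [← mul_sub, norm_mul, norm_mul, norm_zpow, hrep.z1, one_zpow, mul_one, Complex.norm_real,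
        Real.norm_eq_abs, abs_of_nonneg (hrep.a0 s), mul_comm, norm_sub_rev]
      exact mul_le_mul_of_nonneg_right (hM s).le (hrep.a0 s)
    rw [h2]
    nlinarith
  have hbr : SrB (fun c : ℕ => u c * ∑ b ∈ Finset.range M, φ b * Ψ ((b:ℤ) - c)) :=
    huB.mul (SrB.sum _ fun b _ => (SrB.const (φ b)).mul ⟨B, fun c => by rw [Real.norm_eq_abs]; exact hB _⟩)
  have hb1 : ∀ s ∈ Finset.univ, SrB (fun c : ℕ => (a s : ℂ) * ω s * conj ((u c : ℂ) * z s ^ c)) :=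
    fun s _ => (SrB.const _).mul (hub s).conj
  have hb2 : SrB (fun c : ℕ => (∑ s, (a s : ℂ) * ω s * conj ((u c : ℂ) * z s ^ c)).re) := by
    obtain ⟨C, hC⟩ := SrB.sum _ hb1
    exact ⟨C, fun n => by rw [Real.norm_eq_abs]; exact (Complex.abs_re_le_norm _).trans (hC n)⟩
  have hle : srMean 𝒰 (fun c : ℕ => M * (∑ s, (a s : ℂ) * ω s * conj ((u c : ℂ) * z s ^ c)).re - η * M)
      ≤ srMean 𝒰 (fun c : ℕ => u c * ∑ b ∈ Finset.range M, φ b * Ψ ((b:ℤ) - c)) := by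
    refine srMean_mono 𝒰 (((SrB.const (M:ℝ)).mul hb2).sub (SrB.const _)) hbr fun c => ?_
    have e : (∑ s, (a s : ℂ) * ω s * conj ((u c : ℂ) * z s ^ c)).re
        = u c * (∑ s, (a s : ℂ) * z s ^ (-(c:ℤ)) * ω s).re := by
      rw [← Complex.re_ofReal_mul, Finset.mul_sum]
      congr 1
      refine Finset.sum_congr rfl fun s _ => ?_
      have hc : conj (z s ^ c) = z s ^ (-(c:ℤ)) := by
        rw [zpow_neg, zpow_natCast, Complex.inv_eq_conj (by simp [hrep.z1])]
      rw [map_mul, hc, Complex.conj_ofReal]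
      ring
    rw [e]
    have h4 := mul_le_mul_of_nonneg_left (hpt c) (hu0 c)
    have h5 : u c * (η * M) ≤ 1 * (η * M) := mul_le_mul_of_nonneg_right (hu1 c) (by positivity)
    linarith
  refine le_trans ?_ hle
  rw [srMean_sub 𝒰 ((SrB.const (M:ℝ)).mul hb2) (SrB.const _), srMean_mulc 𝒰 hb2,
    srMean_re 𝒰 (SrB.sum _ hb1), srMean_sum 𝒰 _ hb1]
  have hcst : srMean 𝒰 (fun _ => η * (M:ℝ)) = η * M := srMean_const 𝒰 h𝒰 _
  rw [hcst]
  have h6 : (srMean 𝒰 u) ^ 2 ≤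
      (∑ s, srMean 𝒰 (fun c : ℕ => (a s : ℂ) * ω s * conj ((u c : ℂ) * z s ^ c))).re := by
    have e1 : ∀ s, srMean 𝒰 (fun c : ℕ => (a s : ℂ) * ω s * conj ((u c : ℂ) * z s ^ c))
        = ((a s * ‖ω s‖ ^ 2 : ℝ) : ℂ) := by
      intro s
      rw [srMean_mulcC 𝒰 (hub s).conj, srMean_conj 𝒰 (hub s), mul_assoc, Complex.mul_conj,
        Complex.normSq_eq_norm_sq]
      push_cast; rfl
    simp only [e1]
    rw [← Complex.ofReal_sum, Complex.ofReal_re]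
    have e2 : (srMean 𝒰 u) ^ 2 = ∑ s, (if z s = 1 then a s else 0) * (srMean 𝒰 u) ^ 2 := by
      rw [← Finset.sum_mul, hsum, one_mul]
    rw [e2]
    refine Finset.sum_le_sum fun s _ => ?_
    split_ifs with h
    · have : ω s = ((srMean 𝒰 u : ℝ) : ℂ) := by
        rw [← srMean_ofReal 𝒰 huB]
        simp [hω, h]
      rw [this, Complex.norm_real, Real.norm_eq_abs, sq_abs]
    · rw [zero_mul]
      exact mul_nonneg (hrep.a0 s) (sq_nonneg _)
  nlinarith

open scoped Classical in
theorem sr_analytic (𝒰 : Ultrafilter ℕ) (h𝒰 : (𝒰 : Filter ℕ) ≤ atTop) (m ℓ : ℕ) (hm : 0 < m) (hℓ : 0 < ℓ)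
    (f w : ℕ → ℝ) (hf0 : ∀ n, 0 ≤ f n) (hf1 : ∀ n, f n ≤ 1) (hw0 : ∀ n, 0 ≤ w n) (hw1 : ∀ n, w n ≤ 1)
    (lam : ℝ) (hlip : ∀ n, |f (n + 1) - f n| ≤ lam) (ε : ℝ) (hε : 0 < ε)
    (hmean : srMean 𝒰 w + ε ≤ srMean 𝒰 (fun c => f (ℓ * c)))
    (hlam : (ℓ + 2 * ℓ * (m + ℓ)) * lam ≤ ε / 8)
    {κ : Type} [Fintype κ] (χ : ℕ → κ) (d : ℕ) (Bad : ℕ → Set ℕ)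
    (hBad : ∀ M, srMean 𝒰 (fun c => if c ∈ Bad M then (1:ℝ) else 0) ≤ ε / 16)
    (hmain : ∀ M c, c ∉ Bad M → ∀ b, d ≤ b → b < M → χ b = χ c → f (ℓ * c + m * b) ≤ w c) :
    False := by
  have hind : ∀ P : ℕ → Prop, SrB (fun c => if P c then (1:ℝ) else 0) := fun P =>
    ⟨1, fun c => by dsimp only; split_ifs <;> simp⟩
  have hfB : SrB f := ⟨1, fun n => by rw [Real.norm_eq_abs, abs_of_nonneg (hf0 n)]; exact hf1 n⟩
  have hwB : SrB w := ⟨1, fun n => by rw [Real.norm_eq_abs, abs_of_nonneg (hw0 n)]; exact hw1 n⟩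
  have hlam0 : 0 ≤ lam := (abs_nonneg _).trans (hlip 0)
  have : Nonempty κ := ⟨χ 0⟩
  have hK : (0:ℝ) < Fintype.card κ := by exact_mod_cast Fintype.card_pos
  set K : ℝ := (Fintype.card κ : ℝ) with hKd
  set σ : ℝ := ε / (16 * K) with hσd
  have hσ : 0 < σ := by positivity
  have hσK : K * σ = ε / 16 := by rw [hσd]; field_simp
  set ηD : ℝ := ε * σ ^ 2 / 8 with hηD
  have hηD0 : 0 < ηD := by positivity
  obtain ⟨Ψ, ι, hι, a, z, hrep, hΨ, hsum, hHM, hD⟩ := sr_D_bound 𝒰 h𝒰 m ℓ hm hℓ f hfB ηD hηD0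
  have hB := hrep.bound
  set B := ∑ s, a s with hBd
  have hB0 : 0 ≤ B := (abs_nonneg _).trans (hB 0)
  set δ : ℝ := min 1 (ε / 32) with hδd
  have hδ : 0 < δ := by positivity
  have hδ1 : δ ≤ 1 := min_le_left _ _
  have hδ2 : δ ≤ ε / 32 := min_le_right _ _
  have hlow := sr_lower 𝒰 h𝒰 m ℓ hm hℓ hB hΨ hHM hf0 hf1 hlip δ hδ hδ1
  set φ : κ → ℕ → ℝ := fun i c => if χ c = i then (1:ℝ) else 0 with hφ
  have hφ0 : ∀ i b, 0 ≤ φ i b := fun i b => by simp only [hφ]; split_ifs <;> simp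
  have hφ1 : ∀ i b, φ i b ≤ 1 := fun i b => by simp only [hφ]; split_ifs <;> simp
  have hpos : ∀ᶠ M : ℕ in 𝒰, ∀ i, ∀ u : ℕ → ℝ, (∀ c, 0 ≤ u c) → (∀ c, u c ≤ φ i c) →
      ((srMean 𝒰 u) ^ 2 - σ ^ 2 / 4) * M ≤
        srMean 𝒰 (fun c : ℕ => u c * ∑ b ∈ Finset.range M, φ i b * Ψ ((b:ℤ) - c)) :=
    eventually_all.mpr fun i => sr_pos 𝒰 h𝒰 hrep hΨ hsum (φ i) (hφ0 i) (hφ1 i) _ (by positivity)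
  have htt : Tendsto (fun M : ℕ => ηD * (M:ℝ)) atTop atTop :=
    tendsto_natCast_atTop_atTop.const_mul_atTop hηD0
  obtain ⟨M, hpos, hD, hlow, hM1, hM0, hMd⟩ := (hpos.and (h𝒰 (hD.and (hlow.and ((hHM 1 one_pos).and
    ((eventually_gt_atTop 0).and (htt.eventually_ge_atTop (d * B)))))))).exists
  have hM0' : (0:ℝ) < M := by exact_mod_cast hM0
  have hΨM : ∀ c : ℕ, ∑ b ∈ Finset.range M, Ψ ((b:ℤ) - c) ≤ 2 * M := by
    intro c
    have := (abs_le.mp (hM1 (-c))).2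
    simp only [← sub_eq_add_neg] at this
    linarith
  set Fs : ℕ → ℝ := fun c => ∑ b ∈ Finset.range M, Ψ ((b:ℤ) - c) * f (ℓ * c + m * b) with hFs
  have hFsB : SrB Fs := by
    have := sr_bddX m ℓ hB hfB M 0
    simpa only [sub_zero] using this
  have hFs2 : ∀ c, Fs c ≤ 2 * M := fun c =>
    (Finset.sum_le_sum fun b _ => mul_le_of_le_one_right (hΨ _) (hf1 _)).trans (hΨM c)
  set Φ := srMean 𝒰 (fun c => f (ℓ * c)) with hΦ
  have hΦ1 : Φ ≤ 1 := by
    have h1 : srMean 𝒰 (fun _ => (1:ℝ)) = 1 := srMean_const 𝒰 h𝒰 _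
    rw [← h1]
    exact srMean_mono 𝒰 (hfB.comp (fun c => ℓ * c)) (SrB.const _) fun c => hf1 _
  have hFm : (Φ - ε / 4) * M ≤ srMean 𝒰 Fs := by
    refine le_trans (mul_le_mul_of_nonneg_right ?_ hM0'.le) hlow
    have h2 : 0 ≤ δ * (ℓ * lam) := by positivity
    have h3 : δ * Φ ≤ δ * 1 := by gcongr
    linarith
  set G : ℕ → Prop := fun c => (w c + ε / 2) * M < Fs c with hG
  obtain ⟨S, hS⟩ : ∃ S : κ → ℕ → Prop, ∀ i c, S i c ↔ (c ∉ Bad M ∧ G c ∧ χ c = i) :=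
    ⟨fun i c => c ∉ Bad M ∧ G c ∧ χ c = i, fun _ _ => Iff.rfl⟩
  have hh : ε / 8 ≤ srMean 𝒰 (fun c => if G c then (1:ℝ) else 0) := by
    have hb : SrB (fun c => (M:ℝ) * w c + (ε / 2 * M + 2 * M * (if G c then (1:ℝ) else 0))) :=
      ((SrB.const _).mul hwB).add ((SrB.const _).add ((SrB.const _).mul (hind G)))
    have h1 : srMean 𝒰 Fs ≤ srMean 𝒰 (fun c => (M:ℝ) * w c + (ε / 2 * M + 2 * M * (if G c then (1:ℝ) else 0))) := by
      refine srMean_mono 𝒰 hFsB hb fun c => ?_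
      split_ifs with h
      · have := hFs2 c
        have : 0 ≤ M * w c := mul_nonneg hM0'.le (hw0 c)
        have : 0 < ε / 2 * M := by positivity
        linarith
      · simp only [hG, not_lt] at h
        linarith
    rw [srMean_add 𝒰 ((SrB.const _).mul hwB) ((SrB.const _).add ((SrB.const _).mul (hind G))),
      srMean_add 𝒰 (SrB.const _) ((SrB.const _).mul (hind G)), srMean_mulc 𝒰 hwB,
      srMean_mulc 𝒰 (hind G), srMean_const 𝒰 h𝒰] at h1
    set H := srMean 𝒰 (fun c => if G c then (1:ℝ) else 0)
    have h2 : (Φ - ε / 4) * M ≤ (srMean 𝒰 w + ε / 2 + 2 * H) * M := by linarith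
    have h3 := le_of_mul_le_mul_right h2 hM0'
    linarith
  have hpig : ∃ i, σ ≤ srMean 𝒰 (fun c => if S i c then (1:ℝ) else 0) := by
    by_contra hcon
    push Not at hcon
    have h1 : srMean 𝒰 (fun c => if G c then (1:ℝ) else 0) ≤
        srMean 𝒰 (fun c => (if c ∈ Bad M then (1:ℝ) else 0) + ∑ i, if S i c then (1:ℝ) else 0) := by
      refine srMean_mono 𝒰 (hind G) ((hind (· ∈ Bad M)).add (SrB.sum _ fun i _ => hind (S i))) fun c => ?_
      have hnn : ∀ i, (0:ℝ) ≤ if S i c then (1:ℝ) else 0 := fun i => by split_ifs <;> simp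
      by_cases hbad : c ∈ Bad M
      · rw [if_pos hbad]
        have := Finset.sum_nonneg (s := Finset.univ) fun i _ => hnn i
        split_ifs <;> linarith
      · by_cases hg : G c
        · have := Finset.single_le_sum (s := Finset.univ) (fun i _ => hnn i) (Finset.mem_univ (χ c))
          have hs : S (χ c) c := (hS _ _).2 ⟨hbad, hg, rfl⟩
          simp only [if_pos hs] at this
          rw [if_pos hg, if_neg hbad]; linarith
        · rw [if_neg hg, if_neg hbad]
          have := Finset.sum_nonneg (s := Finset.univ) fun i _ => hnn i
          linarith
    rw [srMean_add 𝒰 (hind (· ∈ Bad M)) (SrB.sum _ fun i _ => hind (S i)),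
      srMean_sum 𝒰 _ fun i _ => hind (S i)] at h1
    have h2 : ∑ i, srMean 𝒰 (fun c => if S i c then (1:ℝ) else 0) < ∑ _i : κ, σ :=
      Finset.sum_lt_sum_of_nonempty Finset.univ_nonempty fun i _ => hcon i
    rw [Finset.sum_const, Finset.card_univ, nsmul_eq_mul, ← hKd, hσK] at h2
    have := hBad M
    linarith
  obtain ⟨i, hi⟩ := hpig
  set u : ℕ → ℝ := fun c => if S i c then (1:ℝ) else 0 with hu
  have huB : SrB u := hind (S i)
  have hu0 : ∀ c, 0 ≤ u c := fun c => by simp only [hu]; split_ifs <;> simp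
  have hu1 : ∀ c, u c ≤ φ i c := fun c => by
    simp only [hu, hφ]
    split_ifs with h1 h2 h2
    · exact le_rfl
    · exact absurd ((hS _ _).1 h1).2.2 h2
    · exact zero_le_one
    · exact le_rfl
  set P : ℕ → ℝ := fun c => ∑ b ∈ Finset.range M, φ i b * Ψ ((b:ℤ) - c) with hP
  have hPB : SrB P := SrB.sum _ fun b _ => (SrB.const (φ i b)).mul
    ⟨B, fun c => by rw [Real.norm_eq_abs]; exact hB _⟩
  have hP0 : ∀ c, 0 ≤ P c := fun c => Finset.sum_nonneg fun b _ => mul_nonneg (hφ0 i b) (hΨ _)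
  have h1 := hpos i u hu0 hu1
  have h2 : (3 / 4 * σ ^ 2) * M ≤ srMean 𝒰 (fun c => u c * P c) := by
    refine le_trans (mul_le_mul_of_nonneg_right ?_ hM0'.le) h1
    have : σ ^ 2 ≤ srMean 𝒰 u ^ 2 := by gcongr
    linarith
  have h3 := hD (φ i) (fun c => P c / M) (hφ0 i) (hφ1 i) (fun c => by
    rw [div_mul_cancel₀ _ hM0'.ne'])
  set Df : ℕ → ℂ := srD m ℓ M Ψ (φ i) (fun c => P c / M) (fun x => (f x : ℂ)) with hDf
  have hDfe : ∀ c, Df c = ((∑ b ∈ Finset.range M, φ i b * Ψ ((b:ℤ) - c) * f (ℓ * c + m * b)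
      - P c / M * Fs c : ℝ) : ℂ) := by
    intro c
    simp only [hDf, srD, hFs]
    push_cast
    rw [Finset.mul_sum, ← Finset.sum_sub_distrib]
    refine Finset.sum_congr rfl fun b _ => ?_
    ring
  have hDfB : SrB Df := by
    have hfC : SrB (fun x => (f x : ℂ)) := by
      obtain ⟨C, hC⟩ := hfB; exact ⟨C, fun n => by rw [Complex.norm_real]; exact hC n⟩
    refine SrB.sum _ fun b _ => SrB.mul ?_ (hfC.comp (fun c => ℓ * c + m * b))
    have : SrB (fun c : ℕ => (φ i b - P c / M) * Ψ ((b:ℤ) - c)) := by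
      refine SrB.mul ((SrB.const _).sub ?_) ⟨B, fun c => by rw [Real.norm_eq_abs]; exact hB _⟩
      simpa only [div_eq_mul_inv] using hPB.mul (SrB.const _)
    obtain ⟨C, hC⟩ := this
    exact ⟨C, fun n => by rw [Complex.norm_real]; exact hC n⟩
  have hpt : ∀ c, ε / 2 * (u c * P c) ≤ d * B + ‖Df c‖ := by
    intro c
    simp only [hu]
    split_ifs with h
    · obtain ⟨hc1, hc2, hc3⟩ := (hS _ _).1 h
      have hd : ∑ b ∈ Finset.range M, φ i b * Ψ ((b:ℤ) - c) * f (ℓ * c + m * b) ≤ P c * w c + d * B := by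
        have e1 : ∀ b ∈ Finset.range M, φ i b * Ψ ((b:ℤ) - c) * f (ℓ * c + m * b)
            ≤ φ i b * Ψ ((b:ℤ) - c) * w c + (if b < d then B else 0) := by
          intro b hb
          have hcoef : 0 ≤ φ i b * Ψ ((b:ℤ) - c) := mul_nonneg (hφ0 i b) (hΨ _)
          split_ifs with hbd
          · have e2 : φ i b * Ψ ((b:ℤ) - c) ≤ B :=
              (mul_le_of_le_one_left (hΨ _) (hφ1 i b)).trans ((le_abs_self _).trans (hB _))
            have e3 := mul_le_of_le_one_right hcoef (hf1 (ℓ * c + m * b))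
            have e4 := mul_nonneg hcoef (hw0 c)
            linarith
          · rw [add_zero]
            by_cases hχ : χ b = i
            · exact mul_le_mul_of_nonneg_left (hmain M c hc1 b (not_lt.mp hbd) (Finset.mem_range.mp hb)
                (hχ.trans hc3.symm)) hcoef
            · simp [hφ, hχ]
        refine (Finset.sum_le_sum e1).trans ?_
        rw [Finset.sum_add_distrib, ← Finset.sum_mul]
        refine add_le_add le_rfl ?_
        rw [← Finset.sum_filter, Finset.sum_const, nsmul_eq_mul]
        refine mul_le_mul_of_nonneg_right ?_ hB0
        have : ((Finset.range M).filter (· < d)).card ≤ (Finset.range d).card :=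
          Finset.card_le_card fun x hx => Finset.mem_range.mpr (Finset.mem_filter.mp hx).2
        rw [Finset.card_range] at this
        exact_mod_cast this
      have h4 : P c * (w c + ε / 2) ≤ P c / M * Fs c := by
        have := mul_le_mul_of_nonneg_left hc2.le (div_nonneg (hP0 c) hM0'.le)
        refine le_trans (le_of_eq ?_) this
        field_simp
      have h5 : -(∑ b ∈ Finset.range M, φ i b * Ψ ((b:ℤ) - c) * f (ℓ * c + m * b)
          - P c / M * Fs c) ≤ ‖Df c‖ := by
        rw [hDfe, Complex.norm_real, Real.norm_eq_abs]; exact neg_le_abs _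
      linarith
    · have := norm_nonneg (Df c)
      have : 0 ≤ d * B := by positivity
      linarith
  have h4 := srMean_mono 𝒰 ((SrB.const (ε / 2)).mul (huB.mul hPB)) ((SrB.const (d * B)).add hDfB.norm) hpt
  rw [srMean_mulc 𝒰 (huB.mul hPB), srMean_add 𝒰 (SrB.const _) hDfB.norm, srMean_const 𝒰 h𝒰] at h4
  have h5 := mul_le_mul_of_nonneg_left h2 (by positivity : 0 ≤ ε / 2)
  have h6 : 0 < ε * σ ^ 2 * M := by positivity
  have h7 : ηD * M = ε * σ ^ 2 * M / 8 := by rw [hηD]; ring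
  have h8 : srMean 𝒰 (fun c => ‖Df c‖) ≤ ηD * M := h3
  linarith

open scoped Classical in
lemma sr_select (𝒰 : Ultrafilter ℕ) (Bad : ℕ → ℕ → Set ℕ)
    (hmono : ∀ d M M', M ≤ M' → Bad d M ⊆ Bad d M') (hanti : ∀ d d' M, d ≤ d' → Bad d' M ⊆ Bad d M)
    (h𝒰 : (𝒰 : Filter ℕ) ≤ atTop) (η : ℝ) (hη : 0 < η)
    (h : ∀ d, ∃ M, η < srMean 𝒰 (fun c => if c ∈ Bad d M then (1:ℝ) else 0)) :
    ∃ Mf : ℕ → ℕ, ∀ D, ∃ c, ∀ d ≤ D, c ∈ Bad d (Mf d) := by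
  have hind : ∀ P : ℕ → Prop, SrB (fun c => if P c then (1:ℝ) else 0) := fun P =>
    ⟨1, fun c => by dsimp only; split_ifs <;> simp⟩
  set E : ℕ → ℕ → ℝ := fun d M => srMean 𝒰 (fun c => if c ∈ Bad d M then (1:ℝ) else 0) with hE
  have hE1 : ∀ d M, E d M ≤ 1 := by
    intro d M
    have h1 : srMean 𝒰 (fun _ => (1:ℝ)) = 1 := srMean_const 𝒰 h𝒰 _
    rw [← h1]
    exact srMean_mono 𝒰 (hind _) (SrB.const _) fun c => by split_ifs <;> simp
  have hbdd : ∀ d, BddAbove (Set.range (E d)) := fun d => ⟨1, by rintro _ ⟨M, rfl⟩; exact hE1 d M⟩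
  have hch : ∀ d, ∃ M, (⨆ M, E d M) - η * (1 / 2) ^ (d + 2) < E d M := fun d =>
    exists_lt_of_lt_ciSup (sub_lt_self _ (by positivity))
  choose Mf hMf using hch
  refine ⟨Mf, fun D => ?_⟩
  by_contra hcon
  push Not at hcon
  set N : ℕ → ℕ := fun d => max (Mf d) (Mf D) with hN
  have hle : srMean 𝒰 (fun c => if c ∈ Bad D (Mf D) then (1:ℝ) else 0) ≤
      srMean 𝒰 (fun c => ∑ d ∈ Finset.range D, ((if c ∈ Bad d (N d) then (1:ℝ) else 0)
        - (if c ∈ Bad d (Mf d) then (1:ℝ) else 0))) := by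
    refine srMean_mono 𝒰 (hind _) (SrB.sum _ fun d _ => (hind _).sub (hind _)) fun c => ?_
    have hnn : ∀ d ∈ Finset.range D, (0:ℝ) ≤ (if c ∈ Bad d (N d) then (1:ℝ) else 0)
        - (if c ∈ Bad d (Mf d) then (1:ℝ) else 0) := by
      intro d _
      by_cases h1 : c ∈ Bad d (Mf d)
      · have h2 : c ∈ Bad d (N d) := hmono d _ _ (le_max_left _ _) h1
        simp [h1, h2]
      · rw [if_neg h1]; split_ifs <;> simp
    by_cases hc : c ∈ Bad D (Mf D)
    · obtain ⟨d, hd, hcd⟩ := hcon c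
      have hdD : d < D := lt_of_le_of_ne hd (by rintro rfl; exact hcd hc)
      have h2 : c ∈ Bad d (N d) := hmono d _ _ (le_max_right _ _) (hanti d D _ hd hc)
      have := Finset.single_le_sum hnn (Finset.mem_range.mpr hdD)
      simp only [if_neg hcd, if_pos h2, sub_zero] at this
      rw [if_pos hc]; exact this
    · rw [if_neg hc]; exact Finset.sum_nonneg hnn
  rw [srMean_sum 𝒰 _ fun d _ => (hind _).sub (hind _)] at hle
  have h1 : ∑ d ∈ Finset.range D, srMean 𝒰 (fun c => (if c ∈ Bad d (N d) then (1:ℝ) else 0)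
        - (if c ∈ Bad d (Mf d) then (1:ℝ) else 0)) ≤ ∑ d ∈ Finset.range D, η * (1 / 2) ^ (d + 2) := by
    refine Finset.sum_le_sum fun d _ => ?_
    rw [srMean_sub 𝒰 (hind _) (hind _)]
    have h2 : E d (N d) ≤ ⨆ M, E d M := le_ciSup (hbdd d) _
    have h3 := hMf d
    simp only [hE] at h2 h3 ⊢
    linarith
  have h2 : ∀ D : ℕ, ∑ d ∈ Finset.range D, η * (1 / 2 : ℝ) ^ (d + 2) = η / 2 - η * (1 / 2) ^ (D + 1) := by
    intro D
    induction D with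
    | zero => simp; ring
    | succ D ih => rw [Finset.sum_range_succ, ih]; ring
  obtain ⟨M, hM⟩ := h D
  have h3 : E D M ≤ ⨆ M, E D M := le_ciSup (hbdd D) _
  have h4 := hMf D
  have h5 : (1 / 2 : ℝ) ^ (D + 2) ≤ 1 / 4 := by
    have : (1 / 2 : ℝ) ^ D ≤ 1 := pow_le_one₀ (by norm_num) (by norm_num)
    rw [pow_add]; linarith
  have h6 : η * (1 / 2 : ℝ) ^ (D + 2) ≤ η * (1 / 4) := by gcongr
  have h7 : 0 < η * (1 / 2 : ℝ) ^ (D + 1) := by positivity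
  rw [h2] at h1
  simp only [hE] at h3 h4
  linarith

/-- bad set -/
def srBad (m ℓ : ℕ) (A : Set ℕ) (L d M : ℕ) : Set ℕ :=
  {c | ∃ b, d ≤ b ∧ b < M ∧ (∀ j < d, (ℓ * b + j ∈ A ↔ ℓ * c + j ∈ A) ∧
    ((m + ℓ) * b + j ∈ A ↔ (m + ℓ) * c + j ∈ A)) ∧
    ∃ t, 1 ≤ t ∧ t ≤ L ∧ (m + ℓ) * c + t ∈ A ∧ ℓ * c + m * b + t ∈ A}

lemma sr_build (m ℓ : ℕ) (A : Set ℕ) (x y : ℕ → Prop) (t : ℕ) (ht : 1 ≤ t) (hy : y t)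
    (h : ∀ d, ∃ b, d ≤ b ∧ (∀ j < d, (ℓ * b + j ∈ A ↔ x j) ∧ ((m + ℓ) * b + j ∈ A ↔ y j)) ∧ x (m * b + t)) :
    ∃ B : Set ℕ, B.Infinite ∧ ∃ t : ℕ, 0 < t ∧ ∀ b₁ ∈ B, ∀ b₂ ∈ B, b₁ ≤ b₂ →
      m * b₁ + ℓ * b₂ + t ∈ A := by
  choose β hβ1 hβ2 hβ3 using h
  set dd : ℕ → ℕ := fun s => m * s + t + 1 + s with hdd
  set s : ℕ → ℕ := fun n => Nat.rec (β (t + 1)) (fun _ r => β (dd r)) n with hs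
  have hs0 : s 0 = β (t + 1) := rfl
  have hs1 : ∀ n, s (n + 1) = β (dd (s n)) := fun n => rfl
  have hmono : StrictMono s := strictMono_nat_of_lt_succ fun n => by
    rw [hs1]; have := hβ1 (dd (s n)); simp only [hdd] at this ⊢; omega
  have hrep : ∀ n, ∃ e, s n = β e ∧ t < e ∧ ∀ i < n, m * s i + t < e := by
    intro n
    cases n with
    | zero => exact ⟨t + 1, hs0, by omega, fun i hi => by omega⟩
    | succ n =>
      refine ⟨dd (s n), hs1 n, by simp only [hdd]; omega, fun i hi => ?_⟩
      have : s i ≤ s n := hmono.monotone (by omega)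
      have := Nat.mul_le_mul_left m this
      simp only [hdd]; omega
  refine ⟨Set.range s, Set.infinite_range_of_injective hmono.injective, t, by omega, ?_⟩
  rintro _ ⟨i, rfl⟩ _ ⟨n, rfl⟩ hle
  have hin : i ≤ n := hmono.le_iff_le.mp hle
  obtain ⟨e, he, hte, hie⟩ := hrep n
  rcases eq_or_lt_of_le hin with rfl | hlt
  · have := ((hβ2 e t hte).2).2 hy
    rw [← he] at this
    rwa [← add_mul]
  · have := ((hβ2 e _ (hie i hlt)).1).2 ?_
    · rw [← he] at this
      rwa [show m * s i + ℓ * s n + t = ℓ * s n + (m * s i + t) by ring]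
    · obtain ⟨e', he', -, -⟩ := hrep i
      rw [he']; exact hβ3 e'

open scoped Classical in
lemma sr_comb (𝒰 : Ultrafilter ℕ) (h𝒰 : (𝒰 : Filter ℕ) ≤ atTop) (m ℓ : ℕ) (A : Set ℕ) (L : ℕ)
    (η : ℝ) (hη : 0 < η)
    (h : ∀ d, ∃ M, η < srMean 𝒰 (fun c => if c ∈ srBad m ℓ A L d M then (1:ℝ) else 0)) :
    ∃ B : Set ℕ, B.Infinite ∧ ∃ t : ℕ, 0 < t ∧ ∀ b₁ ∈ B, ∀ b₂ ∈ B, b₁ ≤ b₂ →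
      m * b₁ + ℓ * b₂ + t ∈ A := by
  obtain ⟨Mf, hMf⟩ := sr_select 𝒰 (srBad m ℓ A L)
    (fun d M M' hM c ⟨b, h1, h2, h3⟩ => ⟨b, h1, h2.trans_le hM, h3⟩)
    (fun d d' M hd c ⟨b, h1, h2, h3, h4⟩ => ⟨b, hd.trans h1, h2, fun j hj => h3 j (hj.trans_le hd), h4⟩)
    h𝒰 η hη h
  choose c hc using hMf
  set 𝒲 := hyperfilter ℕ with h𝒲
  set x : ℕ → Prop := fun n => ∀ᶠ D in 𝒲, ℓ * c D + n ∈ A with hx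
  set y : ℕ → Prop := fun n => ∀ᶠ D in 𝒲, (m + ℓ) * c D + n ∈ A with hy
  have hlim : ∀ (P : ℕ → Prop), ∀ᶠ D in (𝒲 : Filter ℕ), (P D ↔ ∀ᶠ D in 𝒲, P D) := by
    intro P
    by_cases hP : ∀ᶠ D in 𝒲, P D
    · filter_upwards [hP] with D hD; exact ⟨fun _ => hP, fun _ => hD⟩
    · have := Ultrafilter.eventually_not.mpr hP
      filter_upwards [this] with D hD; exact ⟨fun h => absurd h hD, fun h => absurd h hP⟩
  have hWtop : (𝒲 : Filter ℕ) ≤ atTop := by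
    rw [h𝒲, ← Nat.cofinite_eq_atTop]; exact hyperfilter_le_cofinite
  have key : ∀ d, ∃ b, d ≤ b ∧ (∀ j < d, (ℓ * b + j ∈ A ↔ x j) ∧ ((m + ℓ) * b + j ∈ A ↔ y j)) ∧
      ∃ t, 1 ≤ t ∧ t ≤ L ∧ y t ∧ x (m * b + t) := by
    intro d
    set N := d + m * Mf d + L + 1 with hN
    have h1 : ∀ᶠ D in (𝒲 : Filter ℕ), ∀ n ∈ Finset.range N,
        (ℓ * c D + n ∈ A ↔ x n) ∧ ((m + ℓ) * c D + n ∈ A ↔ y n) :=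
      (Filter.eventually_all_finset _).mpr fun n _ => (hlim _).and (hlim _)
    obtain ⟨D, hD, hdD⟩ := (h1.and (hWtop (eventually_ge_atTop d))).exists
    obtain ⟨b, hb1, hb2, hb3, t, ht1, ht2, ht3, ht4⟩ := hc D d hdD
    have hmb : m * b ≤ m * Mf d := Nat.mul_le_mul_left m hb2.le
    refine ⟨b, hb1, fun j hj => ?_, t, ht1, ht2, ?_, ?_⟩
    · have := hD j (Finset.mem_range.mpr (by omega))
      exact ⟨(hb3 j hj).1.trans this.1, (hb3 j hj).2.trans this.2⟩
    · exact (hD t (Finset.mem_range.mpr (by omega))).2.1 ht3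
    · refine (hD (m * b + t) (Finset.mem_range.mpr (by omega))).1.1 ?_
      rwa [← add_assoc]
  have hpig : ∃ t, 1 ≤ t ∧ y t ∧ ∀ d, ∃ b, d ≤ b ∧
      (∀ j < d, (ℓ * b + j ∈ A ↔ x j) ∧ ((m + ℓ) * b + j ∈ A ↔ y j)) ∧ x (m * b + t) := by
    by_contra hcon
    have hcon' : ∀ t, ∃ d, 1 ≤ t → y t → ∀ b, d ≤ b →
      (∀ j < d, (ℓ * b + j ∈ A ↔ x j) ∧ ((m + ℓ) * b + j ∈ A ↔ y j)) → ¬ x (m * b + t) := by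
      intro t
      by_contra h
      push Not at h
      have h0 := h 0
      exact hcon ⟨t, h0.1, h0.2.1, fun d => by
        obtain ⟨-, -, b, h1, h2, h3⟩ := h d; exact ⟨b, h1, h2, h3⟩⟩
    choose dt hdt using hcon'
    set d := ∑ t ∈ Finset.range (L + 1), dt t with hd
    obtain ⟨b, hb, hb2, t, ht1, ht2, hyt, hxt⟩ := key d
    have hle : dt t ≤ d := Finset.single_le_sum (f := dt) (fun _ _ => Nat.zero_le _)
      (Finset.mem_range.mpr (by omega))
    exact hdt t ht1 hyt b (hle.trans hb) (fun j hj => hb2 j (hj.trans_le hle)) hxt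
  obtain ⟨t, ht1, hyt, ht⟩ := hpig
  exact sr_build m ℓ A x y t ht1 hyt ht

/-- indicator -/
noncomputable def srInd (A : Set ℕ) (n : ℕ) : ℝ := by
  classical exact if n ∈ A then 1 else 0

lemma srInd_nonneg (A : Set ℕ) (n : ℕ) : 0 ≤ srInd A n := by unfold srInd; split_ifs <;> simp
lemma srInd_le (A : Set ℕ) (n : ℕ) : srInd A n ≤ 1 := by unfold srInd; split_ifs <;> simp

/-- local averages -/
noncomputable def srLoc (A : Set ℕ) (L n : ℕ) : ℝ := (L:ℝ)⁻¹ * ∑ t ∈ Finset.range L, srInd A (n + t + 1)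

/-- counting function -/
noncomputable def srCnt (A : Set ℕ) (n : ℕ) : ℝ := ∑ t ∈ Finset.range n, srInd A (t + 1)

lemma srInd_bdd (A : Set ℕ) : SrB (srInd A) :=
  ⟨1, fun n => by rw [Real.norm_eq_abs, abs_of_nonneg (srInd_nonneg A n)]; exact srInd_le A n⟩

lemma srCnt_add (A : Set ℕ) (n r : ℕ) :
    srCnt A n ≤ srCnt A (n + r) ∧ srCnt A (n + r) ≤ srCnt A n + r := by
  unfold srCnt
  rw [Finset.sum_range_add]
  have h1 := Finset.sum_nonneg (s := Finset.range r) fun t _ => srInd_nonneg A (n + t + 1)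
  have h2 := Finset.sum_le_card_nsmul (Finset.range r) (fun t => srInd A (n + t + 1)) 1
    fun t _ => srInd_le A _
  simp only [Finset.card_range, nsmul_eq_mul, mul_one] at h2
  constructor <;> linarith

lemma srLoc_nonneg (A : Set ℕ) (L n : ℕ) : 0 ≤ srLoc A L n :=
  mul_nonneg (by positivity) (Finset.sum_nonneg fun t _ => srInd_nonneg A _)

lemma srLoc_le (A : Set ℕ) (L n : ℕ) (hL : 0 < L) : srLoc A L n ≤ 1 := by
  have h2 := Finset.sum_le_card_nsmul (Finset.range L) (fun t => srInd A (n + t + 1)) 1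
    fun t _ => srInd_le A _
  simp only [Finset.card_range, nsmul_eq_mul, mul_one] at h2
  have : (0:ℝ) < L := by exact_mod_cast hL
  unfold srLoc
  rw [inv_mul_le_iff₀ this]; linarith

lemma srLoc_lip (A : Set ℕ) (L n : ℕ) : |srLoc A L (n + 1) - srLoc A L n| ≤ (L:ℝ)⁻¹ := by
  unfold srLoc
  rw [← mul_sub, abs_mul, abs_of_nonneg (by positivity : (0:ℝ) ≤ (L:ℝ)⁻¹)]
  refine mul_le_of_le_one_right (by positivity) ?_
  have h1 : ∑ t ∈ Finset.range L, srInd A (n + 1 + t + 1) - ∑ t ∈ Finset.range L, srInd A (n + t + 1)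
      = srInd A (n + L + 1) - srInd A (n + 0 + 1) := by
    rw [← Finset.sum_range_sub (fun t => srInd A (n + t + 1)), ← Finset.sum_sub_distrib]
    refine Finset.sum_congr rfl fun t _ => ?_
    rw [show n + 1 + t + 1 = n + (t + 1) + 1 by ring]
  rw [h1, abs_le]
  constructor <;> linarith [srInd_nonneg A (n + L + 1), srInd_nonneg A (n + 0 + 1),
    srInd_le A (n + L + 1), srInd_le A (n + 0 + 1)]

lemma sr_sum_block (F : ℕ → ℝ) (q R : ℕ) :
    ∑ t ∈ Finset.range (q * R), F t = ∑ r ∈ Finset.range R, ∑ t ∈ Finset.range q, F (q * r + t) := by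
  induction R with
  | zero => simp
  | succ R ih => rw [mul_add, mul_one, Finset.sum_range_add, ih, Finset.sum_range_succ]

lemma srLoc_mean (𝒰 : Ultrafilter ℕ) (h𝒰 : (𝒰 : Filter ℕ) ≤ atTop) (A : Set ℕ) (q R : ℕ) (hq : 0 < q)
    (hR : 0 < R) {β : ℝ} (hβ : ∀ᶠ M : ℕ in 𝒰, β ≤ srCnt A (q * M) / M) :
    β ≤ q * srMean 𝒰 (fun c => srLoc A (q * R) (q * c)) := by
  set g : ℕ → ℝ := fun c => ∑ t ∈ Finset.range q, srInd A (q * c + t + 1) with hg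
  have hgB : SrB g := SrB.sum _ fun t _ => (srInd_bdd A).comp (fun c => q * c + t + 1)
  have hqR : (0:ℝ) < q := by exact_mod_cast hq
  have hRR : (0:ℝ) < R := by exact_mod_cast hR
  have e1 : (fun c => srLoc A (q * R) (q * c))
      = fun c => ((q:ℝ) * R)⁻¹ * ∑ r ∈ Finset.range R, g (c + r) := by
    funext c
    unfold srLoc
    rw [sr_sum_block (fun t => srInd A (q * c + t + 1))]
    push_cast
    congr 1
    refine Finset.sum_congr rfl fun r _ => Finset.sum_congr rfl fun t _ => ?_
    congr 1; ring
  rw [e1, srMean_mulc 𝒰 (SrB.sum _ fun r _ => hgB.comp (fun c => c + r)),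
    srMean_sum 𝒰 _ fun r _ => hgB.comp (fun c => c + r)]
  simp only [srMean_shift 𝒰 h𝒰 hgB, Finset.sum_const, Finset.card_range, nsmul_eq_mul]
  have e2 : (q:ℝ) * (((q:ℝ) * R)⁻¹ * (R * srMean 𝒰 g)) = srMean 𝒰 g := by field_simp
  rw [e2]
  refine ge_of_tendsto (srMean_tendsto 𝒰 hgB) ?_
  filter_upwards [hβ] with M hM
  refine hM.trans (le_of_eq ?_)
  unfold srAvg srCnt
  rw [sr_sum_block (fun t => srInd A (t + 1)), smul_eq_mul, div_eq_inv_mul]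

lemma sr_final (ℓ m : ℕ) (hℓ : 0 < ℓ) (hm : 0 < m) (k : ℝ) (hk : k = (m : ℝ) / ℓ) (A : Set ℕ)
    (ε : ℝ) (hε : 0 < ε)
    (hA : ∃ᶠ N : ℕ in atTop, 1 - 1 / (k + 2) + 2 * ε < srCnt A N / N) :
    ∃ B : Set ℕ, B.Infinite ∧ ∃ t : ℕ, 0 < t ∧ ∀ b₁ ∈ B, ∀ b₂ ∈ B, b₁ ≤ b₂ →
      m * b₁ + ℓ * b₂ + t ∈ A := by
  classical
  have hmR : (0:ℝ) < m := by exact_mod_cast hm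
  have hℓR : (0:ℝ) < ℓ := by exact_mod_cast hℓ
  have hk0 : 0 < k := by rw [hk]; positivity
  set Q := m + ℓ with hQ
  have hQ0 : 0 < Q := by omega
  have hQR : (0:ℝ) < Q := by exact_mod_cast hQ0
  set θ := 1 - 1 / (k + 2) with hθ
  have hθ0 : 0 ≤ θ := by
    rw [hθ, sub_nonneg, div_le_one (by linarith)]; linarith
  -- frequently along multiples of Q
  have hdiv : Tendsto (fun N : ℕ => N / Q) atTop atTop := Nat.tendsto_div_const_atTop hQ0.ne'
  have hfr : ∃ᶠ M : ℕ in atTop, (θ + ε) * Q ≤ srCnt A (Q * M) / M := by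
    have h1 : ∀ᶠ N : ℕ in atTop, Q / (ε * Q) ≤ ((N / Q : ℕ) : ℝ) ∧ 0 < N / Q :=
      ((tendsto_natCast_atTop_atTop.comp hdiv).eventually_ge_atTop _).and (hdiv.eventually_gt_atTop 0)
    refine hdiv.frequently ((hA.and_eventually h1).mono ?_)
    rintro N ⟨hN, hN1, hN0⟩
    set M := N / Q with hM
    have hM0 : (0:ℝ) < M := by exact_mod_cast hN0
    have hNe : Q * M + N % Q = N := Nat.div_add_mod N Q
    have hN0' : (0:ℝ) < N := by
      have : 0 < N := Nat.pos_of_ne_zero (by rintro h; simp [hM, h] at hN0)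
      exact_mod_cast this
    have h2 := (srCnt_add A (Q * M) (N % Q)).2
    rw [hNe] at h2
    have h3 : ((N % Q : ℕ) : ℝ) ≤ Q := by exact_mod_cast (Nat.mod_lt N hQ0).le
    rw [lt_div_iff₀ hN0'] at hN
    have h4 : (Q * M : ℝ) ≤ N := by exact_mod_cast Nat.mul_div_le N Q
    rw [le_div_iff₀ hM0]
    rw [div_le_iff₀ (by positivity)] at hN1
    have h5 : (θ + 2 * ε) * (Q * M) ≤ (θ + 2 * ε) * N := by gcongr
    linarith
  set F : Filter ℕ := atTop ⊓ 𝓟 {M | (θ + ε) * Q ≤ srCnt A (Q * M) / M} with hF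
  have hne : F.NeBot := by rw [hF, ← Filter.frequently_mem_iff_neBot]; exact hfr
  set 𝒰 := Ultrafilter.of F with h𝒰d
  have h𝒰F : (𝒰 : Filter ℕ) ≤ F := Ultrafilter.of_le F
  have h𝒰 : (𝒰 : Filter ℕ) ≤ atTop := h𝒰F.trans inf_le_left
  have hevQ : ∀ᶠ M : ℕ in 𝒰, (θ + ε) * Q ≤ srCnt A (Q * M) / M :=
    h𝒰F (mem_inf_of_right (mem_principal_self _))
  have hevl : ∀ᶠ M : ℕ in 𝒰, (θ + ε) * Q - m ≤ srCnt A (ℓ * M) / M := by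
    filter_upwards [hevQ, h𝒰 (eventually_gt_atTop 0)] with M hM hM0
    have hM0' : (0:ℝ) < M := by exact_mod_cast hM0
    rw [le_div_iff₀ hM0'] at hM ⊢
    have := (srCnt_add A (ℓ * M) (m * M)).2
    rw [show ℓ * M + m * M = Q * M by rw [hQ]; ring] at this
    push_cast at this
    linarith
  -- choose L
  obtain ⟨R, hR⟩ := exists_nat_gt (8 * (ℓ + 2 * ℓ * (m + ℓ)) / ε)
  have hRp : (0:ℝ) < R := lt_of_le_of_lt (by positivity) hR
  have hR0 : 0 < R := by exact_mod_cast hRp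
  set L := Q * (ℓ * R) with hL
  have hL' : L = ℓ * (Q * R) := by rw [hL]; ring
  have hL0 : 0 < L := by positivity
  have hLR : (R:ℝ) ≤ L := by
    have : R ≤ L := by rw [hL, ← mul_assoc]; exact Nat.le_mul_of_pos_left _ (by positivity)
    exact_mod_cast this
  have hmQ := srLoc_mean 𝒰 h𝒰 A Q (ℓ * R) hQ0 (by positivity) hevQ
  have hml := srLoc_mean 𝒰 h𝒰 A ℓ (Q * R) hℓ (by positivity) hevl
  rw [← hL] at hmQ
  rw [← hL'] at hml
  have hfB : SrB (srLoc A L) := ⟨1, fun n => by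
    rw [Real.norm_eq_abs, abs_of_nonneg (srLoc_nonneg A L n)]; exact srLoc_le A L n hL0⟩
  by_contra hno
  have hd : ∃ d, ∀ M, srMean 𝒰 (fun c => if c ∈ srBad m ℓ A L d M then (1:ℝ) else 0) ≤ ε / 16 := by
    by_contra hcon
    push Not at hcon
    exact hno (sr_comb 𝒰 h𝒰 m ℓ A L (ε / 16) (by positivity) hcon)
  obtain ⟨d, hd⟩ := hd
  refine sr_analytic 𝒰 h𝒰 m ℓ hm hℓ (srLoc A L) (fun c => 1 - srLoc A L (Q * c)) (srLoc_nonneg A L)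
    (fun n => srLoc_le A L n hL0) (fun n => by linarith [srLoc_le A L (Q * n) hL0])
    (fun n => by linarith [srLoc_nonneg A L (Q * n)]) (L:ℝ)⁻¹ (srLoc_lip A L) ε hε ?_ ?_
    (κ := Fin d → Prop × Prop) (fun c j => (ℓ * c + j ∈ A, Q * c + j ∈ A)) d
    (srBad m ℓ A L d) hd ?_
  · rw [srMean_sub 𝒰 (SrB.const _) (hfB.comp (fun c => Q * c)), srMean_const 𝒰 h𝒰]
    set u := srMean 𝒰 (fun c => srLoc A L (Q * c))
    set v := srMean 𝒰 (fun c => srLoc A L (ℓ * c))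
    have h1 : θ + ε ≤ u := le_of_mul_le_mul_right (by linarith : (θ + ε) * Q ≤ u * Q) hQR
    have hQk : (Q:ℝ) = ℓ * (k + 1) := by rw [hQ, hk]; push_cast; field_simp
    have hmk : (m:ℝ) = ℓ * k := by rw [hk]; field_simp
    have h2 : (θ + ε) * (k + 1) - k ≤ v := by
      refine le_of_mul_le_mul_left (le_trans (le_of_eq ?_) hml) hℓR
      rw [hQk, hmk]; ring
    have h3 : θ * (k + 2) = k + 1 := by rw [hθ]; field_simp; ring
    nlinarith
  · rw [mul_inv_le_iff₀ (by positivity)]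
    rw [div_lt_iff₀ hε] at hR
    have : R * ε ≤ L * ε := by gcongr
    linarith
  · intro M c hc b hdb hbM hχ
    have hχ' : ∀ j < d, (ℓ * b + j ∈ A ↔ ℓ * c + j ∈ A) ∧ (Q * b + j ∈ A ↔ Q * c + j ∈ A) := by
      intro j hj
      have := congrFun hχ ⟨j, hj⟩
      simp only [Prod.mk.injEq, eq_iff_iff] at this
      exact this
    have hnb : ∀ t ∈ Finset.range L, srInd A (Q * c + t + 1) + srInd A (ℓ * c + m * b + t + 1) ≤ 1 := by
      intro t ht
      have ht' := Finset.mem_range.mp ht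
      by_contra hcon
      apply hc
      refine ⟨b, hdb, hbM, hχ', t + 1, by omega, by omega, ?_, ?_⟩
      · by_contra h
        have h1 : srInd A (Q * c + t + 1) = 0 := by unfold srInd; exact if_neg h
        have := srInd_le A (ℓ * c + m * b + t + 1)
        linarith
      · by_contra h
        have h1 : srInd A (ℓ * c + m * b + t + 1) = 0 := by unfold srInd; exact if_neg h
        have := srInd_le A (Q * c + t + 1)
        linarith
    have hs := Finset.sum_le_sum hnb
    rw [Finset.sum_add_distrib] at hs
    simp only [Finset.sum_const, Finset.card_range, nsmul_eq_mul, mul_one] at hs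
    have hLp : (0:ℝ) < L := by exact_mod_cast hL0
    have h1 := mul_le_mul_of_nonneg_left hs (inv_nonneg.mpr hLp.le)
    rw [mul_add, inv_mul_cancel₀ hLp.ne'] at h1
    unfold srLoc
    linarith

lemma srCnt_eq (A : Set ℕ) [DecidablePred (· ∈ A)] (N : ℕ) :
    (((Finset.Icc 1 N).filter (· ∈ A)).card : ℝ) = srCnt A N := by
  induction N with
  | zero => simp [srCnt]
  | succ n ih =>
    have h1 : srCnt A (n + 1) = srCnt A n + srInd A (n + 1) := by
      unfold srCnt; rw [Finset.sum_range_succ]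
    rw [h1, ← ih, ← Finset.insert_Icc_right_eq_Icc_add_one (by omega), Finset.filter_insert]
    unfold srInd
    split_ifs with h
    · rw [Finset.card_insert_of_notMem (by simp)]; push_cast; rfl
    · simp

/-- For `k = m/ℓ` and `A ⊆ ℕ` with upper density `> 1 - 1/(k+2)`, there exist an infinite
`B ⊆ ℕ` and `t ∈ ℕ` with `{m b₁ + ℓ b₂ : b₁, b₂ ∈ B, b₁ ≤ b₂} + t ⊆ A`. -/
theorem mB_add_lB_diag_upperDensity_shifted (ℓ m : ℕ) (hℓ : 0 < ℓ) (hm : 0 < m)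
    (k : ℝ) (hk : k = (m : ℝ) / ℓ)
    (A : Set ℕ) (hA : upperDensity A > 1 - 1 / (k + 2)) :
    ∃ B : Set ℕ, B.Infinite ∧ ∃ t : ℕ, 0 < t ∧
      ∀ b₁ ∈ B, ∀ b₂ ∈ B, b₁ ≤ b₂ → m * b₁ + ℓ * b₂ + t ∈ A := by
  classical
  obtain ⟨ε, hε, hε2⟩ : ∃ ε : ℝ, 0 < ε ∧ 1 - 1 / (k + 2) + 2 * ε < upperDensity A :=
    ⟨(upperDensity A - (1 - 1 / (k + 2))) / 4, by linarith, by linarith⟩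
  refine sr_final ℓ m hℓ hm k hk A ε hε ?_
  unfold upperDensity at hε2
  refine (Filter.frequently_lt_of_lt_limsup ?_ hε2).mono fun N hN => ?_
  · refine Filter.IsCoboundedUnder.of_frequently_ge (a := 0) (Frequently.of_forall fun N => ?_)
    positivity
  · rw [← srCnt_eq]
    exact hN
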